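/- Let 2 ≤ k ≤ 470, n ≥ k+1, n > 5, and suppose L_n^{(k)} = a·(10^{d1}−1)/9 + (b−a)·10^{d2} with integers 0 ≤ d2 < d1, d1 ≥ 3, 1 ≤ a ≤ 9 and 0 ≤ b ≤ 9. Then d1 − d2 < 65. -/

import Mathlib

/-- Shifted `k`-generalized Lucas sequence: `genLucas k m` equals `L^{(k)}_{m - (k-2)}`,
so that index `m = 0` corresponds to `n = 2 - k`.  The initial values are
`L^{(k)}_{2-k} = ⋯ = L^{(k)}_{-1} = 0`, `L^{(k)}_0 = 2`, `L^{(k)}_1 = 1`, and each term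
afterwards is the sum of the `k` preceding terms. -/
def genLucas (k : ℕ) : ℕ → ℤ := fun m =>
  if h1 : m < k - 2 then 0
  else if h2 : m = k - 2 then 2
  else if h3 : m = k - 1 then 1
  else ∑ i ∈ Finset.range k, genLucas k (m - 1 - i)
decreasing_by omega

/-- The `k`-generalized Lucas number `L^{(k)}_n` for `n ≥ 0`. -/
def lucasL (k n : ℕ) : ℤ := genLucas k (n + k - 2)

set_option linter.all false


/-- Root data. -/
structure IsAlpha (k : ℕ) (α : ℝ) : Prop where
  hk : 2 ≤ k
  h1 : 1 < α
  h2 : α < 2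
  h3 : α ^ k * (2 - α) = 1

lemma exists_isAlpha (k : ℕ) (hk : 2 ≤ k) : ∃ α, IsAlpha k α := by
  have hc : ContinuousOn (fun x : ℝ => x ^ k * (2 - x)) (Set.Icc (3/2) 2) := by fun_prop
  have h := intermediate_value_Icc' (by norm_num : (3/2:ℝ) ≤ 2) hc
  have h1 : (1:ℝ) ∈ Set.Icc ((2:ℝ) ^ k * (2 - 2)) ((3/2) ^ k * (2 - 3/2)) := by
    constructor
    · norm_num
    · have : (3/2:ℝ)^2 ≤ (3/2)^k := pow_le_pow_right₀ (by norm_num) hk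
      nlinarith
  obtain ⟨x, ⟨hx1, hx2⟩, hx⟩ := h h1
  simp only at hx
  refine ⟨x, hk, by linarith, lt_of_le_of_ne hx2 ?_, hx⟩
  rintro rfl
  norm_num at hx

namespace IsAlpha
variable {k : ℕ} {α : ℝ}

lemma sum_pow (h : IsAlpha k α) : ∑ i ∈ Finset.range k, α ^ i = α ^ k := by
  have h1 := h.h1
  have := geom_sum_mul α k
  have h3 := h.h3
  have : (∑ i ∈ Finset.range k, α ^ i - α^k) * (α - 1) = 0 := by
    linear_combination this + h3
  rcases mul_eq_zero.mp this with h | h <;> linarith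

lemma sq_ge (h : IsAlpha k α) : α + 1 ≤ α ^ 2 := by
  have h1 := h.h1
  obtain ⟨j, rfl⟩ := Nat.exists_eq_add_of_le h.hk
  have hs := h.sum_pow
  rw [add_comm 2 j, Finset.sum_range_succ, Finset.sum_range_succ] at hs
  have h0 : 0 ≤ ∑ i ∈ Finset.range j, α ^ i := Finset.sum_nonneg (fun i _ => by positivity)
  have hp : 0 < α ^ j := by positivity
  have q1 : α ^ (j+1) = α^j * α := pow_succ α j
  have q2 : α ^ (j+2) = α^j * α^2 := pow_add α j 2
  have : α ^ j * (α + 1) ≤ α^j * α^2 := by rw [q1, q2] at hs; linarith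
  exact le_of_mul_le_mul_left this hp

lemma ge (h : IsAlpha k α) : 8/5 ≤ α := by
  have h1 := h.h1
  have := h.sq_ge
  nlinarith

lemma pow_ge (h : IsAlpha k α) (hk3 : 3 ≤ k) : (k:ℝ) + 1 ≤ α ^ k := by
  have h1 := h.ge
  rw [← h.sum_pow]
  clear h
  induction k, hk3 using Nat.le_induction with
  | base => simp [Finset.sum_range_succ]; nlinarith
  | succ n hn ih =>
    rw [Finset.sum_range_succ]; push_cast
    have : 1 ≤ α^n := one_le_pow₀ (by linarith)
    linarith

lemma den_eq (h : IsAlpha k α) : (k+1) * α - 2 * k = 2 - (k+1) / α^k := by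
  have h1 := h.h1
  have h3 := h.h3
  have : α^k ≠ 0 := by positivity
  field_simp
  linear_combination (-(k:ℝ) -1) * h3

lemma den_pos (h : IsAlpha k α) : 1/2 < (k+1) * α - 2 * k := by
  rcases eq_or_lt_of_le h.hk with rfl | hk
  · have := h.ge; norm_num; linarith
  · rw [h.den_eq]
    have := h.pow_ge hk
    have hp : 0 < α^k := lt_of_lt_of_le (by positivity) this
    have : (k+1) / α^k ≤ 1 := by rw [div_le_one hp]; exact this
    linarith

lemma den_le (h : IsAlpha k α) : (k+1) * α - 2 * k ≤ 2 := by
  rw [h.den_eq]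
  have h1 := h.h1
  have : 0 ≤ (k+1) / α^k := by positivity
  linarith

end IsAlpha

/-- leading coefficient -/
noncomputable def Cc (k : ℕ) (α : ℝ) : ℝ := (α - 1) * (2 * α - 1) / (α * ((k+1) * α - 2 * k))

lemma Cc_le {k : ℕ} {α : ℝ} (h : IsAlpha k α) : Cc k α ≤ 3/2 := by
  have h1 := h.ge
  have h2 := h.h2
  have hd := h.den_pos
  unfold Cc
  rw [div_le_iff₀ (by nlinarith)]
  rcases eq_or_lt_of_le h.hk with rfl | hk
  · have h3 := h.h3
    have : α ^ 2 = α + 1 := by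
      have : (α^2 - α - 1) * (α - 1) = 0 := by linear_combination -h3
      rcases mul_eq_zero.mp this with h | h <;> linarith
    push_cast
    nlinarith
  · have hp := h.pow_ge hk
    have hpp : 0 < α^k := lt_of_lt_of_le (by positivity) hp
    have : (k+1) / α^k ≤ 1 := by rw [div_le_one hpp]; exact hp
    have hd' : 1 ≤ (k+1) * α - 2 * k := by rw [h.den_eq]; linarith
    nlinarith

lemma Cc_ge {k : ℕ} {α : ℝ} (h : IsAlpha k α) : 1/4 ≤ Cc k α := by
  have h1 := h.ge
  have h2 := h.h2
  have hd := h.den_pos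
  have hd := h.den_le
  unfold Cc
  rw [le_div_iff₀ (by nlinarith)]
  nlinarith

/-- boundedness lemma -/
lemma bounded_of_window {k : ℕ} (hk : 0 < k) (E w : ℕ → ℝ) (B : ℝ) (hB : 0 ≤ B)
    (hrec : ∀ m, E (m + k + 1) = 2 * E (m + k) - E m)
    (hw : ∀ i, 0 < w i)
    (hphi : ∀ m, ∑ i ∈ Finset.range k, w i * E (m + i) = 0)
    (hinit : ∀ m < k, E m ≤ B) : ∀ m, E m ≤ B := by
  intro m
  induction m using Nat.strong_induction_on with
  | _ m ih =>
    rcases lt_or_ge m k with h | h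
    · exact hinit m h
    · by_contra! hc
      obtain ⟨n, rfl⟩ := Nat.exists_eq_add_of_le' h
      have key : ∀ i, i < k → B < E (n + k + i) := by
        intro i
        induction i with
        | zero => intro _; simpa using hc
        | succ i ihi =>
          intro hi
          have h1 := ihi (by omega)
          have h2 := hrec (n + i)
          have h3 := ih (n + i) (by omega)
          rw [show n + k + (i + 1) = n + i + k + 1 by ring, h2, show n + i + k = n + k + i by ring]
          linarith
      have := hphi (n + k)
      have hpos : 0 < ∑ i ∈ Finset.range k, w i * E (n + k + i) := by
        apply Finset.sum_pos
        · intro i hi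
          exact mul_pos (hw i) (by linarith [key i (Finset.mem_range.mp hi)])
        · exact ⟨0, by simpa using hk⟩
      linarith

lemma genLucas_lt {k m : ℕ} (h : m < k - 2) : genLucas k m = 0 := by
  rw [genLucas]; simp [h]
lemma genLucas_two {k : ℕ} : genLucas k (k-2) = 2 := by
  rw [genLucas]; simp
lemma genLucas_one {k : ℕ} (hk : 2 ≤ k) : genLucas k (k-1) = 1 := by
  rw [genLucas, dif_neg (by omega), dif_neg (by omega), dif_pos rfl]
lemma genLucas_rec {k : ℕ} (hk : 2 ≤ k) (m : ℕ) :
    genLucas k (m + k) = ∑ i ∈ Finset.range k, genLucas k (m + i) := by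
  rw [genLucas, dif_neg (by omega), dif_neg (by omega), dif_neg (by omega)]
  rw [← Finset.sum_range_reflect]
  apply Finset.sum_congr rfl
  intro i hi
  have := Finset.mem_range.mp hi
  congr 1; omega

lemma rec2_of_rec {k : ℕ} (u : ℕ → ℝ) (hu : ∀ m, u (m + k) = ∑ i ∈ Finset.range k, u (m + i)) (m : ℕ) :
    u (m + k + 1) = 2 * u (m + k) - u m := by
  have h1 := hu (m + 1)
  have h2 := hu m
  have h3 := Finset.sum_range_succ (fun i => u (m + i)) k
  have h4 := Finset.sum_range_succ' (fun i => u (m + i)) k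
  have h5 : ∑ i ∈ Finset.range k, u (m + 1 + i) = ∑ i ∈ Finset.range k, u (m + (i + 1)) :=
    Finset.sum_congr rfl (fun i _ => by congr 1; ring)
  rw [show m + k + 1 = m + 1 + k by ring, h1, h5]
  simp only [add_zero] at h4
  linarith

lemma phi_step {k : ℕ} {α : ℝ} (hk : 0 < k) (w u : ℕ → ℝ)
    (hw0 : α * w 0 = 1) (hw : ∀ i, α * w (i+1) = w i + 1) (hwk : w (k-1) = 1)
    (hu : ∀ m, u (m + k) = ∑ i ∈ Finset.range k, u (m + i)) (m : ℕ) :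
    ∑ i ∈ Finset.range k, w i * u (m + 1 + i) = α * ∑ i ∈ Finset.range k, w i * u (m + i) := by
  obtain ⟨j, rfl⟩ : ∃ j, k = j + 1 := ⟨k - 1, by omega⟩
  simp only [Nat.add_sub_cancel] at hwk
  have e1 : ∀ i ∈ Finset.range j, α * (w (i+1) * u (m + (i+1))) = w i * u (m + 1 + i) + u (m + (i+1)) := by
    intro i _
    rw [show m + 1 + i = m + (i+1) by ring]
    linear_combination u (m + (i+1)) * hw i
  have e2 : α * ∑ i ∈ Finset.range j, (w (i+1) * u (m + (i+1))) =
      ∑ i ∈ Finset.range j, w i * u (m + 1 + i) + ∑ i ∈ Finset.range j, u (m + (i+1)) := by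
    rw [Finset.mul_sum, Finset.sum_congr rfl e1, Finset.sum_add_distrib]
  rw [Finset.sum_range_succ, hwk, Finset.sum_range_succ' (fun i => w i * u (m+i))]
  have := hu m
  rw [Finset.sum_range_succ'] at this
  rw [show m + 1 + j = m + (j+1) by ring, this]
  linear_combination -e2 - u (m+0) * hw0

lemma lucas_approx {k : ℕ} {α : ℝ} (h : IsAlpha k α) (n : ℕ) :
    |(lucasL k n : ℝ) - Cc k α * α ^ n| ≤ 2 := by
  have hk := h.hk
  have h1 := h.ge
  have h2 := h.h2
  have hα : α ≠ 0 := by positivity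
  have hα1 : α - 1 ≠ 0 := by linarith
  have hd := h.den_pos
  -- shifted
  set c : ℝ := Cc k α / α ^ (k-2) with hc
  set w : ℕ → ℝ := fun i => (1 - 1 / α^(i+1)) / (α - 1) with hwdef
  have hw0 : α * w 0 = 1 := by simp only [hwdef]; field_simp; ring
  have hw : ∀ i, α * w (i+1) = w i + 1 := by
    intro i; simp only [hwdef]; field_simp; ring
  have hwpos : ∀ i, 0 < w i := by
    intro i
    apply div_pos _ (by linarith)
    have : 1 < α^(i+1) := one_lt_pow₀ (by linarith) (by omega)
    rw [sub_pos, div_lt_one (by positivity)]; exact this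
  have hwk : w (k-1) = 1 := by
    simp only [hwdef, Nat.sub_add_cancel (by omega : 1 ≤ k)]
    have h3 := h.h3
    have : α^k ≠ 0 := by positivity
    field_simp
    linear_combination h3
  set u : ℕ → ℝ := fun m => (genLucas k m : ℝ) with hudef
  have hu : ∀ m, u (m + k) = ∑ i ∈ Finset.range k, u (m + i) := by
    intro m; simp only [hudef]; rw [genLucas_rec hk]; push_cast; rfl
  have hv : ∀ m, α^(m + k) = ∑ i ∈ Finset.range k, α^(m + i) := by
    intro m
    simp only [pow_add]
    rw [← Finset.mul_sum, h.sum_pow]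
  set E : ℕ → ℝ := fun m => u m - c * α^m with hE
  have hErec : ∀ m, E (m + k) = ∑ i ∈ Finset.range k, E (m + i) := by
    intro m
    simp only [hE, Finset.sum_sub_distrib, ← Finset.mul_sum, ← hu, ← hv]
  have hphi0 : ∑ i ∈ Finset.range k, w i * E (0 + i) = 0 := by
    have e1 : ∑ i ∈ Finset.range k, w i * α^i = (α^k - k / α) / (α - 1) := by
      have : ∀ i ∈ Finset.range k, w i * α^i = (α^i - 1/α) / (α-1) := by
        intro i _
        simp only [hwdef]
        field_simp
        ring
      rw [Finset.sum_congr rfl this, ← Finset.sum_div, Finset.sum_sub_distrib, h.sum_pow]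
      simp; ring
    have e2 : ∑ i ∈ Finset.range k, w i * u i = 2 * α - 1 := by
      obtain ⟨j, rfl⟩ : ∃ j, k = j + 2 := ⟨k - 2, by omega⟩
      rw [Finset.sum_range_succ, Finset.sum_range_succ]
      have z : ∑ i ∈ Finset.range j, w i * u i = 0 := by
        apply Finset.sum_eq_zero
        intro i hi
        simp only [hudef]
        rw [genLucas_lt (by simpa using hi)]; simp
      have z2 : u j = 2 := by
        have := genLucas_two (k := j+2); simp only [Nat.add_sub_cancel] at this
        simp only [hudef]; rw [this]; norm_num
      have z1 : u (j+1) = 1 := by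
        have := genLucas_one (k := j+2) (by omega)
        simp only [hudef]; rw [show j + 1 = j + 2 - 1 by omega, this]; norm_num
      have hwj : w (j+1) = 1 := hwk
      have := hw j
      rw [z, z1, z2, hwj]
      rw [hwj] at this
      linarith
    have e3 : ∑ i ∈ Finset.range k, w i * E (0 + i) = (2*α - 1) - c * ((α^k - k / α) / (α - 1)) := by
      rw [← e1, ← e2, Finset.mul_sum, ← Finset.sum_sub_distrib]
      apply Finset.sum_congr rfl
      intro i _
      simp only [hE, zero_add]; ring
    rw [e3, hc, Cc]
    have h3 := h.h3
    have hk2 : α^k = α^(k-2) * α^2 := by rw [← pow_add]; congr 1; omega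
    have hp : α^(k-2) ≠ 0 := by positivity
    have hdd : (k+1) * α - 2 * k ≠ 0 := by linarith
    rw [hk2] at h3 ⊢
    have key : α^(k-2)*α^2 - k/α = α^(k-2)*α*((k+1)*α-2*k) := by
      have : k/α = k * (α^(k-2) * α^2 * (2-α))/α := by rw [h3, mul_one]
      rw [this]; field_simp; ring
    rw [key]
    generalize (k+1)*α-2*k = d at *
    field_simp
    ring
  have hphi : ∀ m, ∑ i ∈ Finset.range k, w i * E (m + i) = 0 := by
    intro m
    induction m with
    | zero => exact hphi0
    | succ m ih => rw [phi_step (by omega) w E hw0 hw hwk hErec m, ih, mul_zero]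
  have hrec2 := rec2_of_rec E hErec
  have hCle := Cc_le h
  have hCge := Cc_ge h
  have hinit : ∀ m < k, |E m| ≤ 2 := by
    intro m hm
    have hp : 0 < α^(k-2) := by positivity
    have hcp : 0 < c := by rw [hc]; positivity
    have hcm : c * α^(k-2) = Cc k α := by rw [hc]; field_simp
    rcases lt_trichotomy m (k-2) with hlt | heq | hgt
    · have : u m = 0 := by simp only [hudef]; rw [genLucas_lt hlt]; simp
      simp only [hE, this]
      have h5 : α^m ≤ α^(k-2) := pow_le_pow_right₀ (by linarith) hlt.le
      have h6 : 0 < α^m := by positivity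
      rw [abs_le]; constructor <;> nlinarith
    · have : u m = 2 := by simp only [hudef]; rw [heq, genLucas_two]; norm_num
      simp only [hE, this]
      rw [heq, hcm, abs_le]; constructor <;> linarith
    · have hm1 : m = k - 1 := by omega
      have : u m = 1 := by simp only [hudef]; rw [hm1, genLucas_one hk]; norm_num
      simp only [hE, this]
      have : c * α^m = Cc k α * α := by
        rw [hm1, show k - 1 = k - 2 + 1 by omega, pow_succ, ← mul_assoc, hcm]
      rw [this, abs_le]; constructor <;> nlinarith
  have up := bounded_of_window (k := k) (by omega) E w 2 (by norm_num) hrec2 hwpos hphi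
    (fun m hm => (abs_le.mp (hinit m hm)).2)
  have dn := bounded_of_window (k := k) (by omega) (fun m => - E m) w 2 (by norm_num)
    (fun m => by simp only [hrec2]; ring) hwpos
    (fun m => by have := hphi m; simp only [mul_neg, Finset.sum_neg_distrib, this, neg_zero])
    (fun m hm => by have := (abs_le.mp (hinit m hm)).1; linarith)
  have hfin : (lucasL k n : ℝ) - Cc k α * α ^ n = E (n + k - 2) := by
    simp only [hE, hudef, lucasL, hc]
    rw [show n + k - 2 = (k-2) + n by omega, pow_add]
    have hp : α^(k-2) ≠ 0 := by positivity
    field_simp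
  rw [hfin, abs_le]
  exact ⟨by linarith [dn (n+k-2)], up _⟩


lemma entire_dslope {f : ℂ → ℂ} (hf : Differentiable ℂ f) (a : ℂ) : Differentiable ℂ (dslope f a) := by
  rw [← differentiableOn_univ]
  exact (Complex.differentiableOn_dslope Filter.univ_mem).2 hf.differentiableOn

lemma entire_iter {f : ℂ → ℂ} (hf : Differentiable ℂ f) (j : ℕ) : Differentiable ℂ (deriv^[j] f) := by
  induction j with
  | zero => simpa
  | succ j ih =>
    rw [Function.iterate_succ_apply']
    exact ih.deriv

lemma iter_mul {g : ℂ → ℂ} (hg : Differentiable ℂ g) (a c : ℂ) (j : ℕ) (z : ℂ) :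
    deriv^[j+1] (fun z => c + (z - a) * g z) z = (z - a) * deriv^[j+1] g z + (j+1) * deriv^[j] g z := by
  induction j generalizing z with
  | zero =>
    simp only [zero_add, Function.iterate_one, Function.iterate_zero, id]
    have h := ((hasDerivAt_id z).sub_const a).mul (hg z).hasDerivAt
    have := (h.const_add c).deriv
    simp only [id, Pi.mul_apply] at this
    refine Eq.trans ?_ (this.trans ?_)
    · congr 1
    · push_cast; ring
  | succ j ih =>
    rw [Function.iterate_succ_apply', funext ih]
    have h1 := (entire_iter hg (j+1) z).hasDerivAt
    have h0 := (entire_iter hg j z).hasDerivAt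
    have h := (((hasDerivAt_id z).sub_const a).mul h1).add (h0.const_mul ((j:ℂ)+1))
    rw [← Function.iterate_succ_apply' deriv, ← Function.iterate_succ_apply' deriv] at h
    refine Eq.trans ?_ (h.deriv.trans ?_)
    · congr 1
    · simp only [id]; push_cast; ring

lemma nat_dist {l a : ℕ} (h : l ≠ a) : 1 ≤ ‖(l:ℂ) - a‖ := by
  have : ((l:ℂ) - a) = (((l:ℤ) - (a:ℤ) : ℤ) : ℂ) := by push_cast; rfl
  rw [this, Complex.norm_intCast]
  have h2 : (1:ℤ) ≤ |(l:ℤ) - a| := Int.one_le_abs (by omega)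
  exact_mod_cast h2

lemma hermite (S S' T : ℕ) (Rad : ℝ) (x : ℂ) (hS : S ≤ S') (hxR : ‖x‖ ≤ Rad) (hR : (S + S' : ℝ) ≤ Rad)
    (hS' : 1 ≤ S') (hRS : (S:ℝ) < Rad)
    (hx : ∀ l < S, ‖x - (l:ℂ)‖ ≤ S') :
    ∀ (N : ℕ) (m : ℕ → ℕ) (f : ℂ → ℂ) (ε Bd : ℝ), Differentiable ℂ f → 0 ≤ ε → 0 ≤ Bd →
      ∑ l ∈ Finset.range S, m l = N → (∀ l, m l ≤ T) →
      (∀ l < S, ∀ j < m l, ‖deriv^[j] f l‖ ≤ ε * j.factorial) →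
      (∀ z, ‖z‖ = Rad → ‖f z‖ ≤ Bd) →
      ‖f x‖ ≤ Bd * (S' / (Rad - S)) ^ N + ε * (2 + S' * (T + 2)) ^ N := by
  have hq0 : (0:ℝ) < Rad - S := by linarith
  have hS'r : (1:ℝ) ≤ S' := by exact_mod_cast hS'
  have hq1 : (S':ℝ) / (Rad - S) ≤ 1 := by rw [div_le_one hq0]; linarith
  have hqn : (0:ℝ) ≤ (S':ℝ) / (Rad - S) := by positivity
  intro N
  induction N with
  | zero =>
    intro m f ε Bd hf hε hBd _ _ _ hb
    have := Complex.norm_le_of_forall_mem_frontier_norm_le (U := Metric.ball (0:ℂ) Rad) (f := f) (C := Bd)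
      Metric.isBounded_ball hf.diffContOnCl (by
        intro z hz
        rw [frontier_ball _ (by linarith)] at hz
        exact hb z (by simpa using hz)) (z := x) (by
          rw [closure_ball _ (by linarith)]; simpa using hxR)
    simp; linarith
  | succ N ih =>
    intro m f ε Bd hf hε hBd hm hmT hj hb
    obtain ⟨a, haS, ha⟩ : ∃ a < S, 0 < m a := by
      by_contra! hc
      have : ∑ l ∈ Finset.range S, m l = 0 := Finset.sum_eq_zero (fun l hl => by
        have := hc l (Finset.mem_range.mp hl); omega)
      omega
    set g := dslope f a with hg
    have hgd : Differentiable ℂ g := entire_dslope hf a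
    have hfg : f = fun z => f a + (z - a) * g z := by
      funext z
      have := sub_smul_dslope f a z
      rw [smul_eq_mul] at this
      rw [hg, this]; ring
    have hfa : ‖f a‖ ≤ ε := by simpa using hj a haS 0 ha
    have hder : ∀ j z, deriv^[j+1] f z = (z - a) * deriv^[j+1] g z + (j+1) * deriv^[j] g z := by
      intro j z
      conv_lhs => rw [hfg]
      exact iter_mul hgd _ _ _ _
    set m' := Function.update m a (m a - 1) with hm'
    have hm'T : ∀ l, m' l ≤ T := by
      intro l
      by_cases h : l = a
      · subst h; simp [hm']; have := hmT l; omega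
      · simp [hm', h]; exact hmT l
    have hm'N : ∑ l ∈ Finset.range S, m' l = N := by
      have h1 := Finset.add_sum_erase (Finset.range S) m (Finset.mem_range.mpr haS)
      have h2 := Finset.add_sum_erase (Finset.range S) m' (Finset.mem_range.mpr haS)
      have h3 : ∑ l ∈ (Finset.range S).erase a, m' l = ∑ l ∈ (Finset.range S).erase a, m l :=
        Finset.sum_congr rfl (fun l hl => by simp [hm', Finset.ne_of_mem_erase hl])
      have h4 : m' a = m a - 1 := by simp [hm']
      omega
    have key : ∀ l < S, l ≠ a → ∀ j < m l, ‖deriv^[j] g l‖ ≤ (j + 2) * ε * j.factorial := by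
      intro l hl hla j
      have hd := nat_dist hla
      induction j with
      | zero =>
        intro h0
        have e := hj l hl 0 h0
        simp only [Function.iterate_zero, id, Nat.factorial_zero, Nat.cast_one, mul_one] at e ⊢
        have e2 : ((l:ℂ) - a) * g l = f l - f a := by
          have := congrFun hfg l; rw [this]; ring
        have e3 : ‖(l:ℂ) - a‖ * ‖g l‖ ≤ 2 * ε := by
          rw [← norm_mul, e2]
          exact (norm_sub_le _ _).trans (by linarith)
        have : 0 ≤ ‖g l‖ := norm_nonneg _
        push_cast
        nlinarith
      | succ j ihj =>
        intro h0
        have e := hj l hl (j+1) h0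
        have i := ihj (by omega)
        have e2 : ((l:ℂ) - a) * deriv^[j+1] g l = deriv^[j+1] f l - (j+1) * deriv^[j] g l := by
          rw [hder]; ring
        have n1 : ‖((j:ℂ)+1)‖ = (j:ℝ)+1 := by
          have : ((j:ℂ)+1) = ((j+1 : ℕ) : ℂ) := by push_cast; rfl
          rw [this, Complex.norm_natCast]; push_cast; rfl
        have e3 : ‖(l:ℂ) - a‖ * ‖deriv^[j+1] g l‖ ≤ ε * (j+1).factorial + (j+1) * ((j + 2) * ε * j.factorial) := by
          rw [← norm_mul, e2]
          refine (norm_sub_le _ _).trans (add_le_add e ?_)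
          rw [norm_mul, n1]
          gcongr
        have : 0 ≤ ‖deriv^[j+1] g l‖ := norm_nonneg _
        have hle : ‖deriv^[j+1] g l‖ ≤ ‖(l:ℂ) - a‖ * ‖deriv^[j+1] g l‖ := by nlinarith
        refine (hle.trans e3).trans (le_of_eq ?_)
        rw [Nat.factorial_succ]; push_cast; ring
    have hT0 : (0:ℝ) ≤ T := by positivity
    have hj' : ∀ l < S, ∀ j < m' l, ‖deriv^[j] g l‖ ≤ ((T + 2) * ε) * j.factorial := by
      intro l hl j hjl
      by_cases h : l = a
      · subst h
        have hjl2 : j + 1 < m l := by simp [hm'] at hjl; omega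
        have e := hj l hl (j+1) hjl2
        rw [hder] at e
        simp only [sub_self, zero_mul, zero_add, norm_mul] at e
        have n1 : ‖((j:ℂ)+1)‖ = (j:ℝ)+1 := by
          have : ((j:ℂ)+1) = ((j+1 : ℕ) : ℂ) := by push_cast; rfl
          rw [this, Complex.norm_natCast]; push_cast; rfl
        rw [n1, Nat.factorial_succ] at e
        push_cast at e
        have hj0 : (0:ℝ) < (j:ℝ)+1 := by positivity
        have e4 : ‖deriv^[j] g l‖ ≤ ε * j.factorial := by
          refine le_of_mul_le_mul_left ?_ hj0
          linarith
        refine e4.trans ?_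
        gcongr
        nlinarith
      · have hjl2 : j < m l := by simpa [hm', h] using hjl
        refine (key l hl h j hjl2).trans ?_
        have : (j:ℝ) ≤ T := by exact_mod_cast (hjl2.le.trans (hmT l))
        gcongr
    have haR : ‖(a:ℂ)‖ ≤ S := by
      rw [Complex.norm_natCast]; exact_mod_cast haS.le
    have hbg : ∀ z, ‖z‖ = Rad → ‖g z‖ ≤ (Bd + ε) / (Rad - S) := by
      intro z hz
      rw [le_div_iff₀ hq0]
      have e2 : (z - a) * g z = f z - f a := by
        have := congrFun hfg z; rw [this]; ring
      have e3 : ‖z - a‖ * ‖g z‖ ≤ Bd + ε := by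
        rw [← norm_mul, e2]
        exact (norm_sub_le _ _).trans (add_le_add (hb z hz) hfa)
      have e4 : Rad - S ≤ ‖z - a‖ := by
        have := norm_sub_norm_le z (a:ℂ)
        linarith
      have : 0 ≤ ‖g z‖ := norm_nonneg _
      nlinarith
    have fin := ih m' g ((T+2) * ε) ((Bd + ε) / (Rad - S)) hgd (by positivity) (by positivity) hm'N hm'T hj' hbg
    have e5 : ‖f x‖ ≤ ε + S' * ‖g x‖ := by
      rw [congrFun hfg x]
      refine (norm_add_le _ _).trans (add_le_add hfa ?_)
      rw [norm_mul]
      gcongr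
      exact hx a haS
    set q := (S':ℝ) / (Rad - S) with hqd
    have hqN : q ^ (N+1) ≤ 1 := pow_le_one₀ hqn hq1
    have hQ1 : (1:ℝ) ≤ (2 + S' * (T + 2)) ^ N := one_le_pow₀ (by nlinarith)
    calc ‖f x‖ ≤ ε + S' * ((Bd + ε) / (Rad - S) * q ^ N + (T+2) * ε * (2 + S' * (T + 2)) ^ N) := by
          refine e5.trans ?_
          gcongr
      _ = ε + (Bd + ε) * q^(N+1) + S' * (T+2) * ε * (2 + S' * (T + 2)) ^ N := by
          rw [pow_succ, hqd]; ring
      _ ≤ _ := by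
          rw [pow_succ (2 + (S':ℝ) * (T+2)) N]
          nlinarith [mul_le_mul_of_nonneg_left hqN hε, mul_le_mul_of_nonneg_left hQ1 hε]


open Polynomial in
/-- characteristic polynomial -/
noncomputable def Psi (k : ℕ) : Polynomial ℤ := X ^ k - ∑ i ∈ Finset.range k, X ^ i

section
open Polynomial

lemma Psi_sum_degree (k : ℕ) (hk : 0 < k) : (∑ i ∈ Finset.range k, (X:ℤ[X]) ^ i).degree < k := by
  refine lt_of_le_of_lt (degree_sum_le _ _) ?_
  rw [Finset.sup_lt_iff (by exact_mod_cast WithBot.bot_lt_coe k)]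
  intro i hi
  rw [degree_X_pow]
  exact_mod_cast Finset.mem_range.mp hi

lemma Psi_monic (k : ℕ) (hk : 0 < k) : (Psi k).Monic :=
  monic_X_pow_sub_of_lt (Psi_sum_degree k hk)
where monic_X_pow_sub_of_lt {k : ℕ} {p : ℤ[X]} (h : p.degree < k) : (X^k - p).Monic := by
        apply Monic.sub_of_left (monic_X_pow k)
        rwa [degree_X_pow]

lemma Psi_natDegree (k : ℕ) (hk : 0 < k) : (Psi k).natDegree = k := by
  apply natDegree_eq_of_degree_eq_some
  unfold Psi
  rw [degree_sub_eq_left_of_degree_lt, degree_X_pow]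
  rw [degree_X_pow]
  exact Psi_sum_degree k hk

lemma Psi_mul (k : ℕ) : (X - 1) * Psi k = X^(k+1) - 2 * X^k + 1 := by
  have := geom_sum_mul (X:ℤ[X]) k
  unfold Psi
  linear_combination -this

lemma Psi_aeval {R : Type*} [CommRing R] (k : ℕ) (z : R) :
    aeval z (Psi k) = z^k - ∑ i ∈ Finset.range k, z^i := by
  simp [Psi]

lemma root_eq {R : Type*} [CommRing R] {k : ℕ} {z : R} (h : aeval z (Psi k) = 0) : z^k * (2 - z) = 1 := by
  rw [Psi_aeval] at h
  have := geom_sum_mul z k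
  linear_combination -this - (z-1) * h

lemma root_norm_le {k : ℕ} {z : ℂ} (h : aeval z (Psi k) = 0) : ‖z‖ ≤ 2 := by
  by_contra! hc
  rw [Psi_aeval, sub_eq_zero] at h
  have h1 : ‖z‖^k ≤ ∑ i ∈ Finset.range k, ‖z‖^i := by
    rw [← norm_pow, h]
    refine (norm_sum_le _ _).trans (le_of_eq ?_)
    simp
  have h2 := geom_sum_mul ‖z‖ k
  have h3 : 0 ≤ ∑ i ∈ Finset.range k, ‖z‖^i := Finset.sum_nonneg (fun i _ => by positivity)
  nlinarith

lemma exists_w {k : ℕ} {α : ℝ} (h : IsAlpha k α) : ∃ w : ℕ → ℝ, α * w 0 = 1 ∧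
    (∀ i, α * w (i+1) = w i + 1) ∧ (∀ i, 0 < w i) ∧ w (k-1) = 1 := by
  have hk := h.hk
  have h1 := h.ge
  have hα : α ≠ 0 := by positivity
  have hα1 : α - 1 ≠ 0 := by linarith
  refine ⟨fun i => (1 - 1 / α^(i+1)) / (α - 1), ?_, ?_, ?_, ?_⟩
  · field_simp; ring
  · intro i; field_simp; ring
  · intro i
    apply div_pos _ (by linarith)
    have : 1 < α^(i+1) := one_lt_pow₀ (by linarith) (by omega)
    rw [sub_pos, div_lt_one (by positivity)]; exact this
  · simp only [Nat.sub_add_cancel (by omega : 1 ≤ k)]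
    have h3 := h.h3
    have : α^k ≠ 0 := by positivity
    field_simp
    linear_combination h3

lemma root_norm_lt {k : ℕ} {α : ℝ} (h : IsAlpha k α) {z : ℂ} (hz : aeval z (Psi k) = 0) (hne : z ≠ α) :
    ‖z‖ < 1 := by
  have hk := h.hk
  obtain ⟨w, hw0, hw, hwp, hwk⟩ := exists_w h
  have hu : ∀ m, z^(m + k) = ∑ i ∈ Finset.range k, z^(m + i) := by
    intro m
    rw [Psi_aeval, sub_eq_zero] at hz
    simp only [pow_add]
    rw [← Finset.mul_sum, hz]
  have hre : ∀ m, (z^(m + k)).re = ∑ i ∈ Finset.range k, (z^(m + i)).re := by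
    intro m; rw [hu, Complex.re_sum]
  have him : ∀ m, (z^(m + k)).im = ∑ i ∈ Finset.range k, (z^(m + i)).im := by
    intro m; rw [hu, Complex.im_sum]
  have pr := phi_step (by omega) w (fun m => (z^m).re) hw0 hw hwk hre
  have pi := phi_step (by omega) w (fun m => (z^m).im) hw0 hw hwk him
  set φ : ℕ → ℂ := fun m => ∑ i ∈ Finset.range k, (w i : ℂ) * z^(m+i) with hφ
  have φre : ∀ m, (φ m).re = ∑ i ∈ Finset.range k, w i * (z^(m + i)).re := by
    intro m; simp only [hφ, Complex.re_sum, Complex.re_ofReal_mul]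
  have φim : ∀ m, (φ m).im = ∑ i ∈ Finset.range k, w i * (z^(m + i)).im := by
    intro m; simp only [hφ, Complex.im_sum, Complex.im_ofReal_mul]
  have φz : ∀ m, φ m = z^m * φ 0 := by
    intro m
    simp only [hφ, Finset.mul_sum]
    apply Finset.sum_congr rfl
    intro i _
    rw [pow_add, pow_add]; ring
  have φ1 : φ 1 = α * φ 0 := by
    apply Complex.ext
    · rw [Complex.re_ofReal_mul, φre, φre]; exact pr 0
    · rw [Complex.im_ofReal_mul, φim, φim]; exact pi 0
  have φ0 : φ 0 = 0 := by
    have := φz 1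
    rw [φ1, pow_one] at this
    have : (z - α) * φ 0 = 0 := by linear_combination -this
    rcases mul_eq_zero.mp this with h | h
    · exact absurd (sub_eq_zero.mp h) hne
    · exact h
  have φall : ∀ m, φ m = 0 := fun m => by rw [φz, φ0, mul_zero]
  have sre : ∀ m, ∑ i ∈ Finset.range k, w i * (z^(m + i)).re = 0 := fun m => by rw [← φre, φall]; rfl
  have sim : ∀ m, ∑ i ∈ Finset.range k, w i * (z^(m + i)).im = 0 := fun m => by rw [← φim, φall]; rfl
  have hB : ∀ m < k, ‖z^m‖ ≤ 2^k := by
    intro m hm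
    rw [norm_pow]
    calc ‖z‖^m ≤ 2^m := pow_le_pow_left₀ (norm_nonneg _) (root_norm_le hz) m
      _ ≤ 2^k := pow_le_pow_right₀ (by norm_num) hm.le
  have rr := rec2_of_rec (fun m => (z^m).re) hre
  have ri := rec2_of_rec (fun m => (z^m).im) him
  have b1 := bounded_of_window (k := k) (by omega) (fun m => (z^m).re) w (2^k) (by positivity) rr hwp sre
    (fun m hm => (Complex.re_le_norm _).trans (hB m hm))
  have b2 := bounded_of_window (k := k) (by omega) (fun m => (z^m).im) w (2^k) (by positivity) ri hwp sim
    (fun m hm => ((le_abs_self _).trans (Complex.abs_im_le_norm _)).trans (hB m hm))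
  have b3 := bounded_of_window (k := k) (by omega) (fun m => -(z^m).re) w (2^k) (by positivity)
    (fun m => by have := rr m; rw [this]; ring) hwp
    (fun m => by have := sre m; simp only [mul_neg, Finset.sum_neg_distrib, this, neg_zero])
    (fun m hm => ((neg_le_abs _).trans (Complex.abs_re_le_norm _)).trans (hB m hm))
  have b4 := bounded_of_window (k := k) (by omega) (fun m => -(z^m).im) w (2^k) (by positivity)
    (fun m => by have := ri m; rw [this]; ring) hwp
    (fun m => by have := sim m; simp only [mul_neg, Finset.sum_neg_distrib, this, neg_zero])
    (fun m hm => ((neg_le_abs _).trans (Complex.abs_im_le_norm _)).trans (hB m hm))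
  have bd : ∀ m, ‖z‖^m ≤ 2^k + 2^k := by
    intro m
    rw [← norm_pow]
    refine (Complex.norm_le_abs_re_add_abs_im _).trans (add_le_add ?_ ?_)
    · exact abs_le.mpr ⟨by linarith [b3 m], b1 m⟩
    · exact abs_le.mpr ⟨by linarith [b4 m], b2 m⟩
  have le1 : ‖z‖ ≤ 1 := by
    by_contra! hc
    obtain ⟨m, hm⟩ := pow_unbounded_of_one_lt ((2:ℝ)^k + 2^k) hc
    exact absurd (bd m) (not_le.mpr hm)
  refine lt_of_le_of_ne le1 ?_
  intro h1
  have h2 := congrArg norm (root_eq hz)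
  rw [norm_mul, norm_pow, h1, one_pow, one_mul, norm_one] at h2
  have h3 : ‖z‖^2 = 1 := by rw [h1]; norm_num
  have h4 : ‖2 - z‖^2 = 1 := by rw [h2]; norm_num
  rw [← Complex.normSq_eq_norm_sq, Complex.normSq_apply] at h3 h4
  simp only [Complex.sub_re, Complex.sub_im, Complex.re_ofNat, Complex.im_ofNat] at h4
  have hz1 : z = 1 := by
    have r1 : z.re = 1 := by nlinarith
    apply Complex.ext
    · simpa using r1
    · rw [r1] at h3; simp; nlinarith
  rw [Psi_aeval, hz1] at hz
  simp only [one_pow, Finset.sum_const, Finset.card_range, nsmul_eq_mul, mul_one] at hz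
  have : (k:ℂ) = 1 := by linear_combination -hz
  have : k = 1 := by exact_mod_cast this
  omega

lemma IsAlpha.aeval_eq {k : ℕ} {α : ℝ} (h : IsAlpha k α) : aeval α (Psi k) = 0 := by
  rw [Psi_aeval, h.sum_pow, sub_self]

lemma IsAlpha.aeval_eqC {k : ℕ} {α : ℝ} (h : IsAlpha k α) : aeval (α:ℂ) (Psi k) = 0 := by
  have := congrArg (algebraMap ℝ ℂ) h.aeval_eq
  rw [← aeval_algebraMap_apply, map_zero] at this
  exact this

lemma aevalC {α : ℝ} (Q : ℤ[X]) : aeval (α:ℂ) Q = ((aeval α Q : ℝ) : ℂ) :=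
  aeval_algebraMap_apply ℂ α Q

lemma Psi_simple {k : ℕ} {α : ℝ} (h : IsAlpha k α) (f g : ℤ[X]) (hfg : f * g = Psi k)
    (hf : aeval α f = 0) (hg : aeval α g = 0) : False := by
  have h0 : (X - 1) * Psi k = X^(k+1) - C 2 * X^k + 1 := Psi_mul k
  have h1 := congrArg (fun p => aeval α (derivative p)) h0
  simp only [← hfg, derivative_mul, map_add, map_mul, hf, hg] at h1
  simp only [derivative_sub, derivative_C_mul, derivative_X_pow, derivative_one, map_sub, map_mul, map_pow, aeval_C, aeval_X, map_natCast, map_add] at h1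
  have hk := h.hk
  obtain ⟨j, rfl⟩ : ∃ j, k = j + 1 := ⟨k - 1, by omega⟩
  have hd := h.den_pos
  have hp : 0 < α^j := by have := h.h1; positivity
  simp only [Nat.add_sub_cancel, pow_succ] at h1
  simp at h1
  push_cast at hd h1
  nlinarith

lemma no_factor {k : ℕ} {α : ℝ} (h : IsAlpha k α) (f g : ℤ[X]) (hg : g.Monic) (hfg : f * g = Psi k)
    (hf : aeval α f = 0) : g.natDegree = 0 := by
  by_contra hdeg
  have hk := h.hk
  have hga : aeval α g ≠ 0 := fun hg => Psi_simple h f g hfg hf hg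
  have hroots : ∀ z : ℂ, aeval z g = 0 → ‖z‖ < 1 := by
    intro z hz
    apply root_norm_lt h
    · rw [← hfg, map_mul, hz, mul_zero]
    · rintro rfl
      rw [aevalC] at hz
      exact hga (by exact_mod_cast hz)
  -- constant coeff
  have hc : IsUnit (g.coeff 0) := by
    have : f.coeff 0 * g.coeff 0 = (Psi k).coeff 0 := by rw [← hfg, mul_coeff_zero]
    have h0 : (Psi k).coeff 0 = -1 := by
      obtain ⟨j, rfl⟩ : ∃ j, k = j + 1 := ⟨k - 1, by omega⟩
      simp [Psi, coeff_zero_eq_eval_zero, eval_finsetSum, Finset.sum_range_succ']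
    rw [h0] at this
    exact IsUnit.of_mul_eq_one (-f.coeff 0) (by linarith)
  set gc := g.map (algebraMap ℤ ℂ) with hgc
  have hgm : gc.Monic := hg.map _
  have hsp : gc.Splits := IsAlgClosed.splits gc
  have hdegc : gc.natDegree = g.natDegree := hg.natDegree_map _
  have hprod := hsp.coeff_zero_eq_prod_roots_of_monic hgm
  have hn := congrArg norm hprod
  have hn1 : ‖gc.coeff 0‖ = 1 := by
    rw [hgc, coeff_map]
    rcases Int.isUnit_iff.mp hc with h | h <;> rw [h] <;> simp
  rw [hn1, norm_mul, norm_pow, norm_neg, norm_one, one_pow, one_mul] at hn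
  have hlt : ‖gc.roots.prod‖ < 1 := by
    have hcard : 0 < Multiset.card gc.roots := by
      rw [← hsp.natDegree_eq_card_roots, hdegc]; omega
    have hall : ∀ z ∈ gc.roots, ‖z‖ < 1 := by
      intro z hz
      apply hroots
      rw [mem_roots hgm.ne_zero, IsRoot, hgc, eval_map_algebraMap] at hz
      exact hz
    clear hn hprod
    generalize gc.roots = s at *
    induction s using Multiset.induction with
    | empty => simp at hcard
    | cons a s ih =>
      rw [Multiset.prod_cons, norm_mul]
      have ha := hall a (Multiset.mem_cons_self a s)
      rcases Nat.eq_zero_or_pos (Multiset.card s) with h0 | h0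
      · rw [Multiset.card_eq_zero] at h0
        subst h0; simpa using ha
      · have := ih h0 (fun z hz => hall z (Multiset.mem_cons_of_mem hz))
        have := norm_nonneg a
        have := norm_nonneg s.prod
        nlinarith
  linarith

lemma Psi_irreducible {k : ℕ} {α : ℝ} (h : IsAlpha k α) : Irreducible (Psi k) := by
  have hk := h.hk
  rw [(Psi_monic k (by omega)).irreducible_iff_natDegree]
  refine ⟨?_, ?_⟩
  · intro h1
    have := Psi_natDegree k (by omega)
    rw [h1, natDegree_one] at this; omega
  · intro f g hf hg hfg
    have := h.aeval_eq
    rw [← hfg, map_mul] at this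
    rcases mul_eq_zero.mp this with h0 | h0
    · right; exact no_factor h f g hg hfg h0
    · left; exact no_factor h g f hf (by rw [mul_comm, hfg]) h0

/-- if an integer polynomial vanishes at one root it vanishes at `α` -/
lemma aeval_zero_of_root {k : ℕ} {α : ℝ} (h : IsAlpha k α) (Q : ℤ[X]) (z : ℂ) (hz : aeval z (Psi k) = 0)
    (hQ : aeval z Q = 0) : aeval α Q = 0 := by
  have hm := Psi_monic k (by have := h.hk; omega)
  have hint : IsIntegral ℤ z := ⟨Psi k, hm, by simpa [aeval_def] using hz⟩
  have hmin : minpoly ℤ z ∣ Psi k := minpoly.isIntegrallyClosed_dvd hint hz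
  have hmq : minpoly ℤ z ∣ Q := minpoly.isIntegrallyClosed_dvd hint hQ
  have hass : Associated (minpoly ℤ z) (Psi k) :=
    (minpoly.irreducible hint).associated_of_dvd (Psi_irreducible h) hmin
  have : Psi k ∣ Q := hass.symm.dvd.trans hmq
  obtain ⟨r, rfl⟩ := this
  rw [map_mul, h.aeval_eq, zero_mul]

/-- norm of an integer polynomial value -/
noncomputable def nrm (k : ℕ) (Q : ℤ[X]) : ℤ := resultant (Psi k) Q (Psi k).natDegree Q.natDegree

lemma nrm_cast {k : ℕ} (hk : 0 < k) (Q : ℤ[X]) :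
    (nrm k Q : ℂ) = (((Psi k).map (algebraMap ℤ ℂ)).roots.map (fun z => aeval z Q)).prod := by
  have hm := Psi_monic k hk
  have h1 := resultant_map_map (Psi k) Q (Psi k).natDegree Q.natDegree (algebraMap ℤ ℂ)
  have h2 := resultant_eq_prod_eval ((Psi k).map (algebraMap ℤ ℂ)) (Q.map (algebraMap ℤ ℂ)) Q.natDegree
    natDegree_map_le (IsAlgClosed.splits _)
  rw [hm.natDegree_map, h1, (hm.map _).leadingCoeff, one_pow, one_mul] at h2
  refine Eq.trans ?_ (h2.trans ?_)
  · simp [nrm]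
  · congr 1
    apply Multiset.map_congr rfl
    intro z _
    rw [eval_map_algebraMap]

lemma nrm_mul {k : ℕ} (hk : 0 < k) (P Q : ℤ[X]) : nrm k (P * Q) = nrm k P * nrm k Q := by
  have : (nrm k (P*Q) : ℂ) = nrm k P * nrm k Q := by
    rw [nrm_cast hk, nrm_cast hk, nrm_cast hk, ← Multiset.prod_map_mul]
    simp
  exact_mod_cast this

lemma mem_rootsC {k : ℕ} (hk : 0 < k) (z : ℂ) : z ∈ ((Psi k).map (algebraMap ℤ ℂ)).roots ↔ aeval z (Psi k) = 0 := by
  rw [mem_roots ((Psi_monic k hk).map _).ne_zero, IsRoot, eval_map_algebraMap]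

lemma nrm_ne_zero {k : ℕ} {α : ℝ} (h : IsAlpha k α) (Q : ℤ[X]) (hQ : aeval α Q ≠ 0) : nrm k Q ≠ 0 := by
  have hk : 0 < k := by have := h.hk; omega
  intro h0
  have := nrm_cast hk Q
  rw [h0, Int.cast_zero] at this
  have := Multiset.prod_eq_zero_iff.mp this.symm
  obtain ⟨z, hz, hz0⟩ := Multiset.mem_map.mp this
  exact hQ (aeval_zero_of_root h Q z ((mem_rootsC hk z).mp hz) hz0)

lemma liouville {k : ℕ} {α : ℝ} (h : IsAlpha k α) (Q : ℤ[X]) (hQ : aeval α Q ≠ 0) (B : ℝ) (hB : 0 ≤ B)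
    (hb : ∀ z : ℂ, ‖z‖ ≤ 2 → ‖aeval z Q‖ ≤ B) : 1 ≤ |aeval α Q| * B ^ (k-1) := by
  have hk : 0 < k := by have := h.hk; omega
  have h1 : (1:ℝ) ≤ ‖(nrm k Q : ℂ)‖ := by
    rw [Complex.norm_intCast]
    exact_mod_cast Int.one_le_abs (nrm_ne_zero h Q hQ)
  rw [nrm_cast hk] at h1
  obtain ⟨t, ht⟩ := Multiset.exists_cons_of_mem ((mem_rootsC hk (α:ℂ)).mpr h.aeval_eqC)
  have hcard : Multiset.card ((Psi k).map (algebraMap ℤ ℂ)).roots = k := by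
    rw [← (IsAlgClosed.splits ((Psi k).map (algebraMap ℤ ℂ))).natDegree_eq_card_roots,
      (Psi_monic k hk).natDegree_map, Psi_natDegree k hk]
  have hroot : ∀ z ∈ t, ‖aeval z Q‖ ≤ B := by
    intro z hz
    apply hb
    apply root_norm_le (k := k)
    rw [← mem_rootsC hk, ht]
    exact Multiset.mem_cons_of_mem hz
  rw [ht] at h1 hcard
  rw [Multiset.card_cons] at hcard
  rw [Multiset.map_cons, Multiset.prod_cons, norm_mul, aevalC, Complex.norm_real, Real.norm_eq_abs] at h1
  refine h1.trans ?_
  gcongr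
  have : k - 1 = Multiset.card t := by omega
  rw [this]
  clear this h1 hcard ht
  induction t using Multiset.induction with
  | empty => simp
  | cons a s ih =>
    rw [Multiset.map_cons, Multiset.prod_cons, norm_mul, Multiset.card_cons, pow_succ']
    gcongr
    · exact hroot a (Multiset.mem_cons_self a s)
    · exact ih (fun z hz => hroot z (Multiset.mem_cons_of_mem hz))
end


section
open Polynomial

/-- domination of an integer polynomial, evaluation at 2 -/
def Dom (Q : ℤ[X]) (c : ℝ) : Prop := ∃ R : ℝ[X], (∀ i, |(Q.coeff i : ℝ)| ≤ R.coeff i) ∧ R.eval 2 ≤ c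

lemma eval2_nonneg (R : ℝ[X]) (h : ∀ i, 0 ≤ R.coeff i) : 0 ≤ R.eval 2 := by
  rw [eval_eq_sum_range]
  exact Finset.sum_nonneg (fun i _ => mul_nonneg (h i) (by positivity))

lemma Dom.nonneg {Q : ℤ[X]} {c : ℝ} (h : Dom Q c) : 0 ≤ c := by
  obtain ⟨R, h1, h2⟩ := h
  exact (eval2_nonneg R (fun i => (abs_nonneg _).trans (h1 i))).trans h2

lemma Dom.mono {Q : ℤ[X]} {c d : ℝ} (h : Dom Q c) (hcd : c ≤ d) : Dom Q d := by
  obtain ⟨R, h1, h2⟩ := h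
  exact ⟨R, h1, h2.trans hcd⟩

lemma Dom.mul {P Q : ℤ[X]} {c d : ℝ} (hP : Dom P c) (hQ : Dom Q d) : Dom (P * Q) (c * d) := by
  have hc := hP.nonneg
  obtain ⟨R, h1, h2⟩ := hP
  obtain ⟨S, h3, h4⟩ := hQ
  refine ⟨R * S, ?_, ?_⟩
  · intro i
    rw [coeff_mul, coeff_mul]; push_cast
    refine (Finset.abs_sum_le_sum_abs _ _).trans (Finset.sum_le_sum fun x _ => ?_)
    rw [abs_mul]
    exact mul_le_mul (h1 _) (h3 _) (abs_nonneg _) ((abs_nonneg _).trans (h1 _))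
  · rw [eval_mul]
    exact mul_le_mul h2 h4 (eval2_nonneg S (fun i => (abs_nonneg _).trans (h3 i))) hc

lemma Dom.one : Dom 1 1 := by
  refine ⟨1, fun i => ?_, by simp⟩
  rw [coeff_one, coeff_one]; split_ifs <;> simp

lemma Dom.X : Dom X 2 := by
  refine ⟨Polynomial.X, fun i => ?_, by simp⟩
  rw [coeff_X, coeff_X]; split_ifs <;> simp

lemma Dom.C (a : ℤ) : Dom (C a) |(a:ℝ)| := by
  refine ⟨Polynomial.C |(a:ℝ)|, fun i => ?_, by simp⟩
  rw [coeff_C, coeff_C]; split_ifs <;> simp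

lemma Dom.add {P Q : ℤ[X]} {c d : ℝ} (hP : Dom P c) (hQ : Dom Q d) : Dom (P + Q) (c + d) := by
  obtain ⟨R, h1, h2⟩ := hP
  obtain ⟨S, h3, h4⟩ := hQ
  refine ⟨R + S, fun i => ?_, ?_⟩
  · rw [coeff_add, coeff_add]; push_cast
    exact (abs_add_le _ _).trans (add_le_add (h1 i) (h3 i))
  · rw [eval_add]; linarith

lemma Dom.pow {P : ℤ[X]} {c : ℝ} (hP : Dom P c) (n : ℕ) : Dom (P ^ n) (c ^ n) := by
  induction n with
  | zero => simpa using Dom.one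
  | succ n ih => rw [pow_succ, pow_succ]; exact ih.mul hP

lemma Dom.sum {ι : Type*} (s : Finset ι) (P : ι → ℤ[X]) (c : ι → ℝ) (h : ∀ i ∈ s, Dom (P i) (c i)) :
    Dom (∑ i ∈ s, P i) (∑ i ∈ s, c i) := by
  classical
  induction s using Finset.induction with
  | empty => exact ⟨0, by simp, by simp⟩
  | insert a s ha ih =>
    rw [Finset.sum_insert ha, Finset.sum_insert ha]
    exact (h a (by simp)).add (ih (fun i hi => h i (by simp [hi])))

lemma Dom.sum_coeff {Q : ℤ[X]} {c : ℝ} (h : Dom Q c) (v : ℕ → ℝ) (hv : ∀ i, |v i| ≤ 2^i) :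
    ∑ i ∈ Finset.range (Q.natDegree + 1), |(Q.coeff i : ℝ)| * |v i| ≤ c := by
  obtain ⟨R, h1, h2⟩ := h
  refine le_trans ?_ h2
  rw [eval_eq_sum_range' (n := max (Q.natDegree+1) (R.natDegree + 1)) (by omega)]
  refine (Finset.sum_le_sum_of_subset_of_nonneg (Finset.range_subset_range.mpr (le_max_left _ _))
    (fun i _ _ => by positivity)).trans (Finset.sum_le_sum fun i _ => ?_)
  exact mul_le_mul (h1 i) (hv i) (abs_nonneg _) ((abs_nonneg _).trans (h1 i))

lemma Dom.eval {Q : ℤ[X]} {c : ℝ} (h : Dom Q c) {z : ℂ} (hz : ‖z‖ ≤ 2) : ‖aeval z Q‖ ≤ c := by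
  refine le_trans ?_ (h.sum_coeff (fun i => ‖z‖^i) (fun i => ?_))
  · rw [aeval_eq_sum_range]
    refine (norm_sum_le _ _).trans (Finset.sum_le_sum fun i _ => ?_)
    rw [zsmul_eq_mul, norm_mul, norm_pow, Complex.norm_intCast, abs_of_nonneg (by positivity : 0 ≤ ‖z‖^i)]
  · rw [abs_of_nonneg (by positivity)]
    exact pow_le_pow_left₀ (norm_nonneg _) hz i

/-- coordinates of `α^i` -/
def vv (k : ℕ) : ℕ → ℕ → ℤ
  | 0, j => if j = 0 then 1 else 0
  | i+1, 0 => vv k i (k-1)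
  | i+1, j+1 => vv k i j + vv k i (k-1)

lemma vv_le (k i j : ℕ) : |vv k i j| ≤ 2^i := by
  induction i generalizing j with
  | zero => rw [vv]; split_ifs <;> simp
  | succ i ih =>
    have h1 := ih (k-1)
    cases j with
    | zero => rw [vv, pow_succ]; have : (0:ℤ) < 2^i := by positivity
              linarith
    | succ j => rw [vv, pow_succ]; have := ih j; have := abs_add_le (vv k i j) (vv k i (k-1)); linarith

lemma vv_spec {k : ℕ} {α : ℝ} (h : IsAlpha k α) (i : ℕ) :
    α^i = ∑ j ∈ Finset.range k, (vv k i j : ℝ) * α^j := by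
  have hk := h.hk
  obtain ⟨n, rfl⟩ : ∃ n, k = n + 1 := ⟨k - 1, by omega⟩
  induction i with
  | zero =>
    rw [Finset.sum_range_succ']
    simp [vv]
  | succ i ih =>
    have hs := h.sum_pow
    rw [Finset.sum_range_succ'] at hs
    rw [Finset.sum_range_succ] at ih
    rw [Finset.sum_range_succ']
    simp only [vv, Nat.add_sub_cancel] 
    push_cast
    simp only [add_mul, Finset.sum_add_distrib, ← Finset.mul_sum]
    have e : ∑ x ∈ Finset.range n, (vv (n+1) i x:ℝ) * α^(x+1) = α * ∑ x ∈ Finset.range n, (vv (n+1) i x:ℝ) * α^x := by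
      rw [Finset.mul_sum]; apply Finset.sum_congr rfl; intro x _; ring
    rw [pow_succ, ih, e]
    linear_combination (-(vv (n+1) i n : ℝ)) * hs

/-- coordinate -/
noncomputable def coo (k : ℕ) (Q : ℤ[X]) (j : ℕ) : ℤ := ∑ i ∈ Finset.range (Q.natDegree + 1), Q.coeff i * vv k i j

lemma coo_spec {k : ℕ} {α : ℝ} (h : IsAlpha k α) (Q : ℤ[X]) :
    aeval α Q = ∑ j ∈ Finset.range k, (coo k Q j : ℝ) * α^j := by
  rw [aeval_eq_sum_range]
  simp only [coo]; push_cast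
  simp only [Finset.sum_mul]
  rw [Finset.sum_comm]
  apply Finset.sum_congr rfl
  intro i _
  rw [zsmul_eq_mul, vv_spec h i, Finset.mul_sum]
  apply Finset.sum_congr rfl
  intro j _; ring

lemma coo_le {k : ℕ} {Q : ℤ[X]} {c : ℝ} (h : Dom Q c) (j : ℕ) : |(coo k Q j : ℝ)| ≤ c := by
  refine le_trans ?_ (h.sum_coeff (fun i => (vv k i j : ℝ)) (fun i => ?_))
  · simp only [coo]; push_cast
    refine (Finset.abs_sum_le_sum_abs _ _).trans (le_of_eq ?_)
    simp only [abs_mul]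
  · exact_mod_cast vv_le k i j

lemma siegel {k : ℕ} {α : ℝ} (h : IsAlpha k α) {ι E : Type*} [Fintype ι] [Fintype E]
    (P : E → ι → ℤ[X]) (c : ℝ) (hc : 1 ≤ c) (hP : ∀ e i, Dom (P e i) c) (hE : 0 < Fintype.card E)
    (hcard : 2 * (Fintype.card E * k) ≤ Fintype.card ι) :
    ∃ p : ι → ℤ, p ≠ 0 ∧ (∀ e, ∑ i, (p i : ℝ) * aeval α (P e i) = 0) ∧
      ∀ i, |(p i : ℝ)| ≤ Fintype.card ι * c := by
  classical
  have hk := h.hk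
  have hcE : Fintype.card (E × Fin k) = Fintype.card E * k := by simp
  have hpos : 0 < Fintype.card E * k := by positivity
  letI : SeminormedAddCommGroup (Matrix (E × Fin k) ι ℤ) := Matrix.seminormedAddCommGroup
  let A : Matrix (E × Fin k) ι ℤ := fun e i => coo k (P e.1 i) e.2
  obtain ⟨t, ht0, htA, htn⟩ := Int.Matrix.exists_ne_zero_int_vec_norm_le A
    (by rw [hcE]; omega) (by rw [hcE]; exact hpos)
  refine ⟨t, ht0, ?_, ?_⟩
  · intro e
    simp only [coo_spec h, Finset.mul_sum]
    rw [Finset.sum_comm]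
    apply Finset.sum_eq_zero
    intro j hj
    have := congrFun htA (e, ⟨j, Finset.mem_range.mp hj⟩)
    simp only [Matrix.mulVec, dotProduct, A, Pi.zero_apply] at this
    have h2 : ∑ i, (coo k (P e i) j : ℝ) * t i = 0 := by exact_mod_cast this
    have : ∑ i, (t i : ℝ) * ((coo k (P e i) j : ℝ) * α^j) = (∑ i, (coo k (P e i) j : ℝ) * t i) * α^j := by
      rw [Finset.sum_mul]; apply Finset.sum_congr rfl; intro i _; ring
    rw [this, h2, zero_mul]
  · intro i
    have hι : (1:ℝ) ≤ Fintype.card ι := by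
      have : 1 ≤ Fintype.card ι := by omega
      exact_mod_cast this
    have hA : ‖A‖ ≤ c := by
      rw [Matrix.norm_le_iff (by linarith)]
      intro e i
      rw [Int.norm_eq_abs]
      exact coo_le (hP _ _) _
    have h1 : ‖t i‖ ≤ ‖t‖ := norm_le_pi_norm t i
    rw [Int.norm_eq_abs] at h1
    refine (h1.trans htn).trans ?_
    have hb : (1:ℝ) ≤ Fintype.card ι * max 1 ‖A‖ := by
      nlinarith [le_max_left 1 ‖A‖]
    have hexp : ((Fintype.card (E × Fin k) : ℕ) : ℝ) / ((Fintype.card ι : ℝ) - (Fintype.card (E × Fin k) : ℕ)) ≤ 1 := by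
      rw [hcE]
      have h2 : (2:ℝ) * ((Fintype.card E * k : ℕ) : ℝ) ≤ Fintype.card ι := by exact_mod_cast hcard
      have h3 : (0:ℝ) < ((Fintype.card E * k : ℕ) : ℝ) := by exact_mod_cast hpos
      rw [div_le_one (by linarith)]; linarith
    refine (Real.rpow_le_rpow_of_exponent_le hb hexp).trans ?_
    rw [Real.rpow_one]
    gcongr
    exact max_le hc hA
end


section
open Complex

/-- exponential polynomial -/
noncomputable def FF {ι : Type} [Fintype ι] (p g1 g2 w : ι → ℝ) (m1 m2 : ℕ) (z : ℂ) : ℂ :=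
  ∑ i, ((p i * g1 i ^ m1 * g2 i ^ m2 : ℝ) : ℂ) * cexp (w i * z)

variable {ι : Type} [Fintype ι] (p g1 g2 w : ι → ℝ)

lemma FF_deriv (m1 m2 j : ℕ) : deriv^[j] (FF p g1 g2 w m1 m2) =
    fun z => ∑ i, ((p i * g1 i ^ m1 * g2 i ^ m2 : ℝ) : ℂ) * ((w i : ℂ)^j * cexp (w i * z)) := by
  induction j with
  | zero => funext z; simp [FF]
  | succ j ih =>
    rw [Function.iterate_succ_apply', ih]
    funext z
    have : HasDerivAt (fun z => ∑ i, ((p i * g1 i ^ m1 * g2 i ^ m2 : ℝ) : ℂ) * ((w i : ℂ)^j * cexp (w i * z)))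
      (∑ i, ((p i * g1 i ^ m1 * g2 i ^ m2 : ℝ) : ℂ) * ((w i : ℂ)^(j+1) * cexp (w i * z))) z := by
      apply HasDerivAt.fun_sum
      intro i _
      apply HasDerivAt.const_mul
      have h1 : HasDerivAt (fun z : ℂ => (w i : ℂ) * z) (w i) z := by
        simpa using (hasDerivAt_id z).const_mul (w i : ℂ)
      have := (h1.cexp).const_mul ((w i : ℂ)^j)
      convert this using 1
      ring
    exact this.deriv

lemma FF_diff (m1 m2 : ℕ) : Differentiable ℂ (FF p g1 g2 w m1 m2) := by
  unfold FF
  fun_prop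

lemma FF_jet (l1 l2 b : ℝ) (hb : b ≠ 0) (hw : ∀ i, w i = (g1 i * l1 + g2 i * l2) / b) (m1 m2 j : ℕ) (z : ℂ) :
    (b:ℂ)^j * deriv^[j] (FF p g1 g2 w m1 m2) z =
    ∑ s ∈ Finset.range (j+1), (l1:ℂ)^s * (l2:ℂ)^(j-s) * (j.choose s : ℂ) * FF p g1 g2 w (m1+s) (m2+(j-s)) z := by
  rw [FF_deriv]
  simp only [FF, Finset.mul_sum]
  rw [Finset.sum_comm]
  apply Finset.sum_congr rfl
  intro i _
  have e : (b:ℂ)^j * (w i : ℂ)^j = ∑ s ∈ Finset.range (j+1), ((g1 i:ℂ) * l1)^s * ((g2 i:ℂ) * l2)^(j-s) * (j.choose s : ℂ) := by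
    rw [← mul_pow, ← add_pow, hw]
    congr 1
    have : (b:ℂ) ≠ 0 := by exact_mod_cast hb
    push_cast
    field_simp
  calc (b:ℂ)^j * (((p i * g1 i ^ m1 * g2 i ^ m2 : ℝ) : ℂ) * ((w i : ℂ)^j * cexp (w i * z)))
      = ((b:ℂ)^j * (w i : ℂ)^j) * (((p i * g1 i ^ m1 * g2 i ^ m2 : ℝ) : ℂ) * cexp (w i * z)) := by ring
    _ = _ := by
      rw [e, Finset.sum_mul]
      apply Finset.sum_congr rfl
      intro s _
      push_cast
      rw [mul_pow, mul_pow, pow_add, pow_add]; ring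

lemma FF_le (m1 m2 : ℕ) (Bp wm r : ℝ) (z : ℂ) (hz : ‖z‖ ≤ r) (hw : ∀ i, |w i| ≤ wm)
    (hB : ∑ i, |p i * g1 i ^ m1 * g2 i ^ m2| ≤ Bp) : ‖FF p g1 g2 w m1 m2 z‖ ≤ Bp * Real.exp (wm * r) := by
  unfold FF
  refine (norm_sum_le _ _).trans ?_
  refine le_trans ?_ (mul_le_mul_of_nonneg_right hB (Real.exp_pos _).le)
  rw [Finset.sum_mul]
  apply Finset.sum_le_sum
  intro i _
  rw [norm_mul, Complex.norm_real, Real.norm_eq_abs, Complex.norm_exp]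
  gcongr
  refine (Complex.re_le_norm _).trans ?_
  rw [norm_mul, Complex.norm_real, Real.norm_eq_abs]
  have : 0 ≤ wm := (abs_nonneg _).trans (hw i)
  exact mul_le_mul (hw i) hz (norm_nonneg _) this

lemma analytic_step (l1 l2 b : ℝ) (hb : 1 ≤ b) (hl1 : 0 ≤ l1) (hl2 : 0 ≤ l2) (hl12 : l1 + l2 ≤ 4)
    (hw : ∀ i, w i = (g1 i * l1 + g2 i * l2) / b) (T Δ S : ℕ) (hS : 1 ≤ S) (ε Bp wm : ℝ) (hε : 0 ≤ ε)
    (hwm : ∀ i, |w i| ≤ wm)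
    (hB : ∀ m1 < T, ∀ m2 < T, ∑ i, |p i * g1 i ^ m1 * g2 i ^ m2| ≤ Bp)
    (hz : ∀ m1 < T, ∀ m2 < T, ∀ l < S, ‖FF p g1 g2 w m1 m2 (l:ℕ)‖ ≤ ε)
    (m1 m2 : ℕ) (h1 : m1 + Δ < T) (h2 : m2 + Δ < T) (x : ℕ) (hx : x < 2 * S) :
    ‖FF p g1 g2 w m1 m2 (x:ℂ)‖ ≤ Bp * Real.exp (wm * (257 * S)) * (1/2)^(7 * (S * Δ))
      + (4^Δ * ε) * (2 + 2 * S * (Δ + 2))^(S * Δ) := by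
  have hSr : (1:ℝ) ≤ S := by exact_mod_cast hS
  have hxr : (x:ℝ) ≤ 2 * S := by exact_mod_cast hx.le
  have hB0 : 0 ≤ Bp := (Finset.sum_nonneg (fun i _ => abs_nonneg _)).trans (hB m1 (by omega) m2 (by omega))
  have := hermite S (2*S) Δ (257 * S) (x:ℂ) (by omega) (by rw [Complex.norm_natCast]; linarith)
    (by push_cast; linarith) (by omega) (by linarith) (by
      intro l hl
      have : ((x:ℂ) - l) = (((x:ℝ) - (l:ℝ) : ℝ) : ℂ) := by push_cast; rfl
      rw [this, Complex.norm_real, Real.norm_eq_abs]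
      have hlr : (l:ℝ) ≤ S := by exact_mod_cast hl.le
      have : (0:ℝ) ≤ l := by positivity
      have : (0:ℝ) ≤ x := by positivity
      push_cast
      rw [abs_le]; constructor <;> linarith) (S * Δ) (fun _ => Δ) (FF p g1 g2 w m1 m2) (4^Δ * ε)
    (Bp * Real.exp (wm * (257 * S))) (FF_diff p g1 g2 w m1 m2) (by positivity) (by positivity)
    (by simp) (fun _ => le_rfl) (by
      intro l hl j hj
      have e := FF_jet p g1 g2 w l1 l2 b (by linarith) hw m1 m2 j (l:ℂ)
      have e2 : b^j * ‖deriv^[j] (FF p g1 g2 w m1 m2) (l:ℂ)‖ ≤ (l1 + l2)^j * ε := by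
        have n1 : ‖(b:ℂ)^j * deriv^[j] (FF p g1 g2 w m1 m2) (l:ℂ)‖ = b^j * ‖deriv^[j] (FF p g1 g2 w m1 m2) (l:ℂ)‖ := by
          rw [norm_mul, norm_pow, Complex.norm_real, Real.norm_eq_abs, abs_of_nonneg (by linarith)]
        rw [← n1, e, add_pow, Finset.sum_mul]
        refine (norm_sum_le _ _).trans (Finset.sum_le_sum fun s hs => ?_)
        have hs := Finset.mem_range.mp hs
        rw [norm_mul, norm_mul, norm_mul, norm_pow, norm_pow, Complex.norm_real, Complex.norm_real,
          Real.norm_eq_abs, Real.norm_eq_abs, abs_of_nonneg hl1, abs_of_nonneg hl2, Complex.norm_natCast]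
        gcongr
        exact hz _ (by omega) _ (by omega) l hl
      have e3 : 1 ≤ b^j := one_le_pow₀ hb
      have e4 : (l1 + l2)^j ≤ 4^Δ := (pow_le_pow_left₀ (by linarith) hl12 j).trans
        (pow_le_pow_right₀ (by norm_num) hj.le)
      have e5 : (1:ℝ) ≤ j.factorial := by exact_mod_cast Nat.factorial_pos j
      have e6 : (0:ℝ) ≤ 4^Δ * ε := by positivity
      have e7 := norm_nonneg (deriv^[j] (FF p g1 g2 w m1 m2) (l:ℂ))
      have e8 : (l1 + l2)^j * ε ≤ 4^Δ * ε := by gcongr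
      nlinarith) (by
      intro z hz
      exact FF_le p g1 g2 w m1 m2 Bp wm _ z hz.le hwm (hB m1 (by omega) m2 (by omega)))
  refine this.trans (le_of_eq ?_)
  have : ((2 * S : ℕ) : ℝ) / (257 * S - S) = (1/2)^7 := by
    push_cast
    have : (S:ℝ) ≠ 0 := by linarith
    rw [div_eq_iff (by intro h; apply this; linarith)]
    ring
  rw [this, ← pow_mul]
  push_cast
  rfl

/-- closeness of two exponential sums -/
lemma FF_close (w' : ι → ℝ) (m1 m2 l : ℕ) (Bp wm δ : ℝ) (hwm : ∀ i, |w' i| ≤ wm) (hδ0 : 0 ≤ δ) (hδ : δ ≤ 1)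
    (hd : ∀ i, |(w i - w' i) * l| ≤ δ)
    (hB : ∑ i, |p i * g1 i ^ m1 * g2 i ^ m2| ≤ Bp) :
    ‖FF p g1 g2 w m1 m2 (l:ℂ) - FF p g1 g2 w' m1 m2 (l:ℂ)‖ ≤ Bp * Real.exp (wm * l) * (2 * δ) := by
  unfold FF
  rw [← Finset.sum_sub_distrib]
  refine (norm_sum_le _ _).trans ?_
  have hc : 0 ≤ Real.exp (wm * l) * (2 * δ) := by positivity
  rw [mul_assoc]
  refine le_trans ?_ (mul_le_mul_of_nonneg_right hB hc)
  rw [Finset.sum_mul]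
  apply Finset.sum_le_sum
  intro i _
  have e1 : cexp (w i * l) = cexp (w' i * l) * cexp (((w i - w' i) * l : ℝ)) := by
    rw [← Complex.exp_add]; congr 1; push_cast; ring
  rw [← mul_sub, norm_mul, Complex.norm_real, Real.norm_eq_abs]
  gcongr
  rw [e1, show cexp (w' i * l) * cexp (((w i - w' i) * l : ℝ)) - cexp (w' i * l) =
    cexp (w' i * l) * (cexp (((w i - w' i) * l : ℝ)) - 1) by ring, norm_mul, Complex.norm_exp]
  have h1 : ((w' i : ℂ) * l).re ≤ wm * l := by
    simp
    have : (0:ℝ) ≤ l := by positivity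
    exact mul_le_mul_of_nonneg_right ((le_abs_self _).trans (hwm i)) this
  have h2 : ‖cexp (((w i - w' i) * l : ℝ)) - 1‖ ≤ 2 * δ := by
    have hx : ‖(((w i - w' i) * l : ℝ) : ℂ)‖ ≤ 1 := by
      rw [Complex.norm_real, Real.norm_eq_abs]; exact (hd i).trans hδ
    refine (Complex.norm_exp_sub_one_le hx).trans ?_
    rw [Complex.norm_real, Real.norm_eq_abs]
    linarith [hd i]
  exact mul_le_mul (Real.exp_le_exp.mpr h1) h2 (norm_nonneg _) (Real.exp_pos _).le
end


section
open Polynomial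

structure BD (k Hh Z Lr L S0 Δ T D : ℕ) (α : ℝ) (A2 : ℕ) (G H : ℤ[X]) (b1 b2 b3 : ℤ) : Prop where
  hα : IsAlpha k α
  hk : k ≤ 470
  hZ : 2048 ≤ Z
  hHh : 1 ≤ Hh
  hA2 : 2 ≤ A2
  hA10 : A2 ≤ 10
  hG : Dom G (2^Hh)
  hH : Dom H (2^Hh)
  hGp : 0 < aeval α G
  hHp : 0 < aeval α H
  hl3 : |Real.log (aeval α G / aeval α H)| ≤ Hh
  hb1 : |b1| ≤ 2^Z
  hb2 : |b2| ≤ 2^Z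
  hb3 : b3 ≤ 2^Z
  hb3p : 1 ≤ b3
  hLr : Lr = 2^47 * Z^4
  hL : L = Hh * Lr
  hS0 : S0 = 2^13 * Z^2
  hΔ : Δ = 2^11 * L
  hT : T = 2 * Z * Δ
  hD : D = 2 * Z + 12 * Z * T + 6 * L * S0
  hN : L * L * Lr ≤ 2^Z
  hind : ∀ x y z : ℤ, x * Real.log α + y * Real.log A2 + z * Real.log (aeval α G / aeval α H) = 0 →
    x = 0 ∧ y = 0 ∧ z = 0

abbrev IX (L Lr : ℕ) := Fin L × Fin L × Fin Lr

def gA (b1 b3 : ℤ) {L Lr : ℕ} (i : IX L Lr) : ℤ := b3 * i.1.val - b1 * i.2.2.val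
def gB (b2 b3 : ℤ) {L Lr : ℕ} (i : IX L Lr) : ℤ := b3 * i.2.1.val - b2 * i.2.2.val
noncomputable def om (l1 l2 l3 : ℝ) {L Lr : ℕ} (i : IX L Lr) : ℝ := i.1.val * l1 + i.2.1.val * l2 + i.2.2.val * l3
noncomputable def mon (A2 : ℕ) (G H : ℤ[X]) {L Lr : ℕ} (i : IX L Lr) (l : ℕ) : ℤ[X] :=
  C ((A2:ℤ)^(i.2.1.val * l)) * X^(i.1.val * l) * G^(i.2.2.val * l) * H^((Lr - 1 - i.2.2.val) * l)

variable {k Hh Z Lr L S0 Δ T D : ℕ} {α : ℝ} {A2 : ℕ} {G H : ℤ[X]} {b1 b2 b3 : ℤ}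

lemma BD.mon_dom (h : BD k Hh Z Lr L S0 Δ T D α A2 G H b1 b2 b3) (i : IX L Lr) (l : ℕ) :
    Dom (mon A2 G H i l) (2^(6*L*l)) := by
  have e1 : Dom (C ((A2:ℤ)^(i.2.1.val * l))) ((2:ℝ)^(4*L*l)) := by
    refine (Dom.C _).mono ?_
    push_cast
    rw [abs_of_nonneg (by positivity), mul_assoc 4, pow_mul 2 4]
    have : (A2:ℝ) ≤ 10 := by exact_mod_cast h.hA10
    have h2 : (2:ℝ) ≤ A2 := by exact_mod_cast h.hA2
    refine (pow_le_pow_left₀ (by positivity) (this.trans (by norm_num : (10:ℝ) ≤ 2^4)) _).trans ?_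
    apply pow_le_pow_right₀ (by norm_num)
    exact Nat.mul_le_mul_right _ i.2.1.isLt.le
  have e2 : Dom ((X:ℤ[X])^(i.1.val * l)) ((2:ℝ)^(L*l)) := by
    refine (Dom.X.pow _).mono ?_
    apply pow_le_pow_right₀ (by norm_num)
    exact Nat.mul_le_mul_right _ i.1.isLt.le
  have e3 := (h.hG.pow (i.2.2.val * l)).mul (h.hH.pow ((Lr - 1 - i.2.2.val) * l))
  have := (e1.mul e2).mul e3
  unfold mon
  rw [mul_assoc _ (G ^ _)]
  refine this.mono ?_
  rw [← pow_mul, ← pow_mul, ← pow_add, ← pow_add, ← pow_add]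
  apply pow_le_pow_right₀ (by norm_num)
  have : (i.2.2.val * l) + ((Lr - 1 - i.2.2.val) * l) ≤ Lr * l := by
    rw [← add_mul]; apply Nat.mul_le_mul_right; have := i.2.2.isLt; omega
  have h3 : Hh * (i.2.2.val * l) + Hh * ((Lr - 1 - i.2.2.val) * l) ≤ L * l := by
    have hL : L * l = Hh * (Lr * l) := by rw [← mul_assoc, ← h.hL]
    rw [← mul_add, hL]; exact Nat.mul_le_mul_left _ this
  nlinarith

lemma BD.mon_eval (h : BD k Hh Z Lr L S0 Δ T D α A2 G H b1 b2 b3) (i : IX L Lr) (l : ℕ) :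
    aeval α (mon A2 G H i l) = (aeval α H)^((Lr-1)*l) *
      Real.exp (om (Real.log α) (Real.log A2) (Real.log (aeval α G / aeval α H)) i * l) := by
  have hHp := h.hHp
  have hGp := h.hGp
  have hαp : 0 < α := by linarith [h.hα.h1]
  have hA : (0:ℝ) < A2 := by have := h.hA2; positivity
  have e : Real.exp (om (Real.log α) (Real.log A2) (Real.log (aeval α G / aeval α H)) i * l)
      = α ^ (i.1.val * l) * (A2:ℝ)^(i.2.1.val * l) * (aeval α G / aeval α H)^(i.2.2.val * l) := by
    unfold om
    rw [add_mul, add_mul, Real.exp_add, Real.exp_add]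
    have key : ∀ (m : ℕ) (x : ℝ), 0 < x → Real.exp (m * Real.log x * l) = x^(m * l) := by
      intro m x hx
      rw [show (m:ℝ) * Real.log x * l = ((m * l : ℕ) : ℝ) * Real.log x by push_cast; ring,
        Real.exp_nat_mul, Real.exp_log hx]
    rw [key _ _ hαp, key _ _ hA, key _ _ (by positivity)]
  rw [e]
  unfold mon
  have e2 : (Lr - 1) * l = i.2.2.val * l + (Lr - 1 - i.2.2.val) * l := by
    rw [← add_mul]; congr 1; have := i.2.2.isLt; omega
  simp only [map_mul, map_pow, aeval_X, aeval_C]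
  rw [e2, pow_add, div_pow]
  have : aeval α H ^ (i.2.2.val * l) ≠ 0 := by positivity
  field_simp
  simp

lemma BD.L_ge (h : BD k Hh Z Lr L S0 Δ T D α A2 G H b1 b2 b3) : Lr ≤ L ∧ 2^47 ≤ Lr ∧ Z ≤ Lr := by
  have h1 := h.hHh
  have h2 := h.hZ
  refine ⟨?_, ?_, ?_⟩
  · rw [h.hL]; nlinarith
  · rw [h.hLr]
    have : 1 ≤ Z^4 := Nat.one_le_pow _ _ (by omega)
    omega
  · rw [h.hLr]
    have : Z^1 ≤ Z^4 := Nat.pow_le_pow_right (by omega) (by omega)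
    rw [pow_one] at this
    omega

lemma BD.bigL (h : BD k Hh Z Lr L S0 Δ T D α A2 G H b1 b2 b3) : 2^14 * L ≤ 2^Z := by
  obtain ⟨h1, h2, h3⟩ := h.L_ge
  refine le_trans ?_ h.hN
  have : 2^14 * L ≤ L * Lr := by rw [mul_comm]; exact Nat.mul_le_mul_left _ (by omega)
  have h4 : L * Lr * 1 ≤ L * Lr * L := Nat.mul_le_mul_left _ (by omega)
  nlinarith

lemma BD.g_le (h : BD k Hh Z Lr L S0 Δ T D α A2 G H b1 b2 b3) (b : ℤ) (hb : |b| ≤ 2^Z) (x y : ℕ) (hx : x ≤ L) (hy : y ≤ L) :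
    |((b3 * x - b * y : ℤ) : ℝ)| ≤ 2^(3*Z) := by
  have h1 : |b3 * x - b * y| ≤ 2^(3*Z) := by
    have hb3 : |b3| ≤ 2^Z := by rw [abs_of_pos (by linarith [h.hb3p])]; exact h.hb3
    have hL : (2:ℤ)^14 * L ≤ 2^Z := by exact_mod_cast h.bigL
    have hL0 : (0:ℤ) ≤ L := by positivity
    have hx' : (x:ℤ) ≤ L := by exact_mod_cast hx
    have hy' : (y:ℤ) ≤ L := by exact_mod_cast hy
    have hp : (1:ℤ) ≤ 2^Z := one_le_pow₀ (by norm_num)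
    calc |b3 * x - b * y| ≤ |b3 * x| + |b * y| := abs_sub _ _
      _ = |b3| * x + |b| * y := by rw [abs_mul, abs_mul]; simp
      _ ≤ 2^Z * L + 2^Z * L := by gcongr
      _ = 2^Z * (2 * L) := by ring
      _ ≤ 2^Z * 2^Z := by gcongr; linarith
      _ = 2^Z * 2^Z * 1 := by ring
      _ ≤ 2^Z * 2^Z * 2^Z := by gcongr
      _ = 2^(3*Z) := by ring
  exact_mod_cast h1

lemma BD.om_le (h : BD k Hh Z Lr L S0 Δ T D α A2 G H b1 b2 b3) (i : IX L Lr) :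
    |om (Real.log α) (Real.log A2) (Real.log (aeval α G / aeval α H)) i| ≤ 5 * L := by
  have hL0 : (0:ℝ) ≤ L := by positivity
  have x1 : (i.1.val:ℝ) ≤ L := by exact_mod_cast i.1.isLt.le
  have x2 : (i.2.1.val:ℝ) ≤ L := by exact_mod_cast i.2.1.isLt.le
  have x3 : (i.2.2.val:ℝ) ≤ Lr := by exact_mod_cast i.2.2.isLt.le
  have y1 : |Real.log α| ≤ 1 := by
    rw [abs_of_nonneg (Real.log_nonneg h.hα.h1.le)]
    have := Real.log_le_sub_one_of_pos (show 0 < α by linarith [h.hα.h1]); linarith [h.hα.h2]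
  have y2 : |Real.log A2| ≤ 3 := by
    have a2 : (2:ℝ) ≤ A2 := by exact_mod_cast h.hA2
    have a10 : (A2:ℝ) ≤ 10 := by exact_mod_cast h.hA10
    rw [abs_of_nonneg (Real.log_nonneg (by linarith)), Real.log_le_iff_le_exp (by linarith)]
    refine a10.trans ?_
    have := Real.exp_one_gt_d9
    rw [show (3:ℝ) = 1 + 1 + 1 by norm_num, Real.exp_add, Real.exp_add]
    have e2 : (2.7:ℝ) * 2.7 ≤ Real.exp 1 * Real.exp 1 := by gcongr <;> linarith
    nlinarith
  have y3 := h.hl3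
  have hL : (L:ℝ) = Hh * Lr := by rw [h.hL]; push_cast; ring
  unfold om
  refine (abs_add_three _ _ _).trans ?_
  rw [abs_mul, abs_mul, abs_mul, Nat.abs_cast, Nat.abs_cast, Nat.abs_cast]
  have z1 : (i.1.val:ℝ) * |Real.log α| ≤ L * 1 := by gcongr
  have z2 : (i.2.1.val:ℝ) * |Real.log A2| ≤ L * 3 := by gcongr
  have z3 : (i.2.2.val:ℝ) * |Real.log (aeval α G / aeval α H)| ≤ Lr * Hh := by gcongr
  linarith

/-- existence of the auxiliary function -/
lemma BD.aux (h : BD k Hh Z Lr L S0 Δ T D α A2 G H b1 b2 b3) :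
    ∃ p : IX L Lr → ℤ, p ≠ 0 ∧ (∀ m1 < T, ∀ m2 < T, ∀ i, |(p i : ℝ) * (gA b1 b3 i:ℝ)^m1 * (gB b2 b3 i:ℝ)^m2| * 2^Z ≤ 2^D) ∧
      ∀ m1 < T, ∀ m2 < T, ∀ l < S0,
        ∑ i, (p i : ℝ) * (gA b1 b3 i:ℝ)^m1 * (gB b2 b3 i:ℝ)^m2 *
          Real.exp (om (Real.log α) (Real.log A2) (Real.log (aeval α G / aeval α H)) i * l) = 0 := by
  have hcardι : Fintype.card (IX L Lr) = L * L * Lr := by simp [IX, mul_assoc]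
  obtain ⟨hL1, hL2, hL3⟩ := h.L_ge
  have hZ := h.hZ
  have hT0 : 0 < T := by
    rw [h.hT, h.hΔ]
    have : 0 < L := by omega
    positivity
  have hS00 : 0 < S0 := by rw [h.hS0]; positivity
  have hgA : ∀ i : IX L Lr, |(gA b1 b3 i:ℝ)| ≤ 2^(3*Z) := fun i =>
    h.g_le b1 h.hb1 _ _ i.1.isLt.le (by have := i.2.2.isLt; omega)
  have hgB : ∀ i : IX L Lr, |(gB b2 b3 i:ℝ)| ≤ 2^(3*Z) := fun i =>
    h.g_le b2 h.hb2 _ _ i.2.1.isLt.le (by have := i.2.2.isLt; omega)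
  have hgg : ∀ i : IX L Lr, ∀ m1 < T, ∀ m2 < T, |(gA b1 b3 i:ℝ)^m1 * (gB b2 b3 i:ℝ)^m2| ≤ 2^(6*Z*T) := by
    intro i m1 h1 m2 h2
    rw [abs_mul, abs_pow, abs_pow]
    calc |(gA b1 b3 i:ℝ)|^m1 * |(gB b2 b3 i:ℝ)|^m2 ≤ (2^(3*Z))^m1 * (2^(3*Z))^m2 := by
          gcongr; exacts [hgA i, hgB i]
      _ = 2^(3*Z*(m1+m2)) := by rw [← pow_mul, ← pow_mul, ← pow_add, mul_add]
      _ ≤ _ := by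
        apply pow_le_pow_right₀ (by norm_num)
        nlinarith
  obtain ⟨p, hp0, hp1, hp2⟩ := siegel h.hα (ι := IX L Lr) (E := Fin T × Fin T × Fin S0)
    (fun e i => C ((gA b1 b3 i)^(e.1.val) * (gB b2 b3 i)^(e.2.1.val)) * mon A2 G H i e.2.2.val)
    (2^(6*Z*T) * 2^(6*L*S0)) (by
      have a1 : (1:ℝ) ≤ 2^(6*Z*T) := one_le_pow₀ (by norm_num)
      have a2 : (1:ℝ) ≤ 2^(6*L*S0) := one_le_pow₀ (by norm_num)
      nlinarith) (by
      intro e i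
      apply Dom.mul
      · refine (Dom.C _).mono ?_
        push_cast
        exact hgg i _ e.1.isLt _ e.2.1.isLt
      · refine (h.mon_dom i _).mono ?_
        apply pow_le_pow_right₀ (by norm_num)
        exact Nat.mul_le_mul_left _ e.2.2.isLt.le) (by simp; omega) (by
      rw [hcardι]
      simp only [Fintype.card_prod, Fintype.card_fin]
      rw [h.hT, h.hΔ, h.hS0]
      have e : Lr = 2^47 * Z^4 := h.hLr
      have hk := h.hk
      calc 2 * (2 * Z * (2^11 * L) * (2 * Z * (2^11*L) * (2^13 * Z^2)) * k)
          = (2 * k) * (2^37 * (Z^4 * (L * L))) := by ring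
        _ ≤ 2^10 * (2^37 * (Z^4 * (L * L))) := Nat.mul_le_mul_right _ (by omega)
        _ = L * L * (2^47 * Z^4) := by ring
        _ = _ := by rw [← e])
  refine ⟨p, hp0, ?_, ?_⟩
  · intro m1 h1 m2 h2 i
    have e1 := hp2 i
    have e2 := hgg i m1 h1 m2 h2
    have e3 : ((Fintype.card (IX L Lr) : ℕ):ℝ) ≤ 2^Z := by rw [hcardι]; exact_mod_cast h.hN
    rw [mul_assoc (p i:ℝ), abs_mul]
    calc |(p i : ℝ)| * |(gA b1 b3 i:ℝ)^m1 * (gB b2 b3 i:ℝ)^m2| * 2^Z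
       ≤ (2^Z * (2^(6*Z*T) * 2^(6*L*S0))) * 2^(6*Z*T) * 2^Z := by
          gcongr
          refine e1.trans ?_
          gcongr
      _ = 2^D := by
        rw [h.hD, ← pow_add, ← pow_add, ← pow_add, ← pow_add]; congr 1; ring
  · intro m1 h1 m2 h2 l hl
    have e := hp1 (⟨m1, h1⟩, ⟨m2, h2⟩, ⟨l, hl⟩)
    have hne : (aeval α H)^((Lr-1)*l) ≠ 0 := by have := h.hHp; positivity
    rw [← mul_right_inj' hne, mul_zero, ← e, Finset.mul_sum]
    apply Finset.sum_congr rfl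
    intro i _
    rw [map_mul, h.mon_eval]
    simp
    ring
end


section
open Polynomial

lemma exp_two_mul_le (n : ℕ) : Real.exp (2 * n) ≤ 2^(3*n) := by
  rw [mul_comm, Real.exp_nat_mul, pow_mul]
  apply pow_le_pow_left₀ (Real.exp_pos _).le
  rw [show (2:ℝ) = 1 + 1 by norm_num, Real.exp_add]
  have := Real.exp_one_lt_d9
  have h0 := Real.exp_pos 1
  nlinarith

lemma num_step (D L S Δ Z W : ℕ) (lam f ε : ℝ) (hlam : 0 ≤ lam) (hW : lam * 2^W < 1)
    (hε : ε = 2^(D + 18*L*S + 3*Z) * lam)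
    (hA : 470*D + 7943*L*S + 1 < 7 * (S * Δ))
    (hB : 7*(S*Δ) + 2*Δ + 3*Z*(S*Δ) + 3*Z + 2 ≤ W)
    (hQ : (2 + 2 * S * (Δ + 2) : ℝ) ≤ 2^(3*Z))
    (hf : |f| ≤ 2^D * Real.exp (6 * L * (257 * S)) * (1/2)^(7 * (S * Δ))
      + (4^Δ * ε) * (2 + 2 * S * (Δ + 2))^(S * Δ) + ε) : |f| * 2^(469*D + 5630*L*S) < 1 := by
  have e1 : Real.exp (6 * L * (257 * S)) ≤ 2^(2313 * L * S) := by
    have := exp_two_mul_le (771 * L * S)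
    push_cast at this
    rw [show (6:ℝ) * L * (257 * S) = 2 * (771 * L * S) by ring]
    refine this.trans (le_of_eq ?_)
    congr 1; ring
  set E := 469*D + 5630*L*S with hE
  have hε0 : 0 ≤ ε := by rw [hε]; positivity
  have t1 : 2^D * Real.exp (6 * L * (257 * S)) * (1/2)^(7 * (S * Δ)) * 2^E < 1/2 := by
    have : (2:ℝ)^D * Real.exp (6 * L * (257 * S)) * (1/2)^(7 * (S * Δ)) * 2^E ≤
      2^D * 2^(2313 * L * S) * (1/2)^(7 * (S * Δ)) * 2^E := by gcongr
    refine this.trans_lt ?_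
    rw [one_div_pow, one_div ((2:ℝ)^_)]
    rw [show (2:ℝ)^D * 2^(2313 * L * S) * (2^(7 * (S * Δ)))⁻¹ * 2^E = 2^(D + 2313 * L * S + E) / 2^(7 * (S * Δ)) by
      rw [pow_add, pow_add]; ring]
    rw [div_lt_div_iff₀ (by positivity) (by norm_num), one_mul, ← pow_succ]
    apply pow_lt_pow_right₀ (by norm_num)
    have : 470*D + 7943*L*S = D + 2313 * L * S + E := by rw [hE]; ring
    omega
  have t2 : ((4^Δ * ε) * (2 + 2 * S * (Δ + 2))^(S * Δ) + ε) * 2^E < 1/2 := by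
    have q1 : (2 + 2 * S * (Δ + 2) : ℝ)^(S * Δ) ≤ 2^(3*Z*(S*Δ)) := by
      rw [pow_mul 2]; exact pow_le_pow_left₀ (by positivity) hQ _
    have q2 : ((4:ℝ)^Δ * ε) * (2 + 2 * S * (Δ + 2))^(S * Δ) + ε ≤ 2^(2*Δ + 3*Z*(S*Δ) + 1) * ε := by
      have : ((4:ℝ)^Δ * ε) * (2 + 2 * S * (Δ + 2))^(S * Δ) ≤ (4^Δ * ε) * 2^(3*Z*(S*Δ)) := by gcongr
      have o : (1:ℝ) ≤ 2^(2*Δ + 3*Z*(S*Δ)) := one_le_pow₀ (by norm_num)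
      have r : ((4:ℝ)^Δ * ε) * 2^(3*Z*(S*Δ)) = 2^(2*Δ + 3*Z*(S*Δ)) * ε := by
        rw [pow_add, pow_mul 2 2]; norm_num; ring
      rw [pow_succ]
      nlinarith
    have q3 : ((4:ℝ)^Δ * ε * (2 + 2 * S * (Δ + 2))^(S * Δ) + ε) * 2^E ≤ 2^(2*Δ + 3*Z*(S*Δ) + 1) * ε * 2^E := by gcongr
    refine q3.trans_lt ?_
    rw [hε]
    have q4 : (2:ℝ)^(2*Δ + 3*Z*(S*Δ) + 1) * (2^(D + 18*L*S + 3*Z) * lam) * 2^E =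
      (lam * 2^(2*Δ + 3*Z*(S*Δ) + 1 + (D + 18*L*S + 3*Z) + E + 1)) / 2 := by
      rw [pow_succ _ (_ + E), pow_add _ _ E, pow_add _ (2*Δ + 3*Z*(S*Δ) + 1) (D + 18*L*S + 3*Z)]; ring
    rw [q4]
    have q5 : (2:ℝ)^(2*Δ + 3*Z*(S*Δ) + 1 + (D + 18*L*S + 3*Z) + E + 1) ≤ 2^W := by
      apply pow_le_pow_right₀ (by norm_num)
      have : D + 18 * L * S + E + 2295 * L * S= 470*D + 7943*L*S := by rw [hE]; ring
      omega
    have : lam * (2:ℝ)^(2*Δ + 3*Z*(S*Δ) + 1 + (D + 18*L*S + 3*Z) + E + 1) ≤ lam * 2^W := by gcongr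
    linarith
  have : |f| * 2^E ≤ (2^D * Real.exp (6 * L * (257 * S)) * (1/2)^(7 * (S * Δ))
      + ((4^Δ * ε) * (2 + 2 * S * (Δ + 2))^(S * Δ) + ε)) * 2^E := by
    gcongr; linarith
  rw [add_mul] at this
  linarith

variable {k Hh Z Lr L S0 Δ T D : ℕ} {α : ℝ} {A2 : ℕ} {G H : ℤ[X]} {b1 b2 b3 : ℤ}

/-- the real exponential sums -/
noncomputable def fs (b1 b2 b3 : ℤ) (l1 l2 l3 : ℝ) {L Lr : ℕ} (p : IX L Lr → ℤ) (m1 m2 l : ℕ) : ℝ :=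
  ∑ i, (p i : ℝ) * (gA b1 b3 i:ℝ)^m1 * (gB b2 b3 i:ℝ)^m2 * Real.exp (om l1 l2 l3 i * l)

lemma fs_FF (l1 l2 l3 : ℝ) (p : IX L Lr → ℤ) (m1 m2 l : ℕ) :
    FF (fun i => (p i:ℝ)) (fun i => (gA b1 b3 i:ℝ)) (fun i => (gB b2 b3 i:ℝ)) (om l1 l2 l3) m1 m2 (l:ℂ)
      = (fs b1 b2 b3 l1 l2 l3 p m1 m2 l : ℝ) := by
  unfold FF fs
  push_cast
  rfl

lemma BD.sumB (h : BD k Hh Z Lr L S0 Δ T D α A2 G H b1 b2 b3) (p : IX L Lr → ℤ)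
    (hp : ∀ m1 < T, ∀ m2 < T, ∀ i, |(p i : ℝ) * (gA b1 b3 i:ℝ)^m1 * (gB b2 b3 i:ℝ)^m2| * 2^Z ≤ 2^D)
    (m1 : ℕ) (h1 : m1 < T) (m2 : ℕ) (h2 : m2 < T) :
    ∑ i, |(p i : ℝ) * (gA b1 b3 i:ℝ)^m1 * (gB b2 b3 i:ℝ)^m2| ≤ 2^D := by
  have hcardι : Fintype.card (IX L Lr) = L * L * Lr := by simp [IX, mul_assoc]
  have e3 : ((Fintype.card (IX L Lr) : ℕ):ℝ) ≤ 2^Z := by rw [hcardι]; exact_mod_cast h.hN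
  have : ∑ i, |(p i : ℝ) * (gA b1 b3 i:ℝ)^m1 * (gB b2 b3 i:ℝ)^m2| ≤ ∑ i : IX L Lr, (2:ℝ)^D / 2^Z := by
    apply Finset.sum_le_sum
    intro i _
    rw [le_div_iff₀ (by positivity)]
    exact hp m1 h1 m2 h2 i
  refine this.trans ?_
  rw [Finset.sum_const, Finset.card_univ, nsmul_eq_mul]
  calc ((Fintype.card (IX L Lr) : ℕ):ℝ) * (2^D / 2^Z) ≤ 2^Z * (2^D / 2^Z) := by gcongr
    _ = 2^D := by field_simp

/-- Liouville for the sums -/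
lemma BD.fs_liou (h : BD k Hh Z Lr L S0 Δ T D α A2 G H b1 b2 b3) (p : IX L Lr → ℤ)
    (hp : ∀ m1 < T, ∀ m2 < T, ∀ i, |(p i : ℝ) * (gA b1 b3 i:ℝ)^m1 * (gB b2 b3 i:ℝ)^m2| * 2^Z ≤ 2^D)
    (m1 : ℕ) (h1 : m1 < T) (m2 : ℕ) (h2 : m2 < T) (S x : ℕ) (hx : x ≤ 2 * S)
    (hf : |fs b1 b2 b3 (Real.log α) (Real.log A2) (Real.log (aeval α G / aeval α H)) p m1 m2 x| * 2^(469*D + 5630*L*S) < 1) :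
    fs b1 b2 b3 (Real.log α) (Real.log A2) (Real.log (aeval α G / aeval α H)) p m1 m2 x = 0 := by
  set f := fs b1 b2 b3 (Real.log α) (Real.log A2) (Real.log (aeval α G / aeval α H)) p m1 m2 x with hfd
  by_contra hne
  have hHp := h.hHp
  let Q : ℤ[X] := ∑ i, C (p i * (gA b1 b3 i)^m1 * (gB b2 b3 i)^m2) * mon A2 G H i x
  have hQ : aeval α Q = (aeval α H)^((Lr-1)*x) * f := by
    rw [hfd]
    unfold fs
    simp only [Q, map_sum, Finset.mul_sum]
    apply Finset.sum_congr rfl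
    intro i _
    rw [map_mul, h.mon_eval]
    simp
    ring
  have hdom : Dom Q (2^(D + 12*L*S)) := by
    have := Dom.sum Finset.univ (fun i => C (p i * (gA b1 b3 i)^m1 * (gB b2 b3 i)^m2) * mon A2 G H i x)
      (fun i => |(p i : ℝ) * (gA b1 b3 i:ℝ)^m1 * (gB b2 b3 i:ℝ)^m2| * 2^(12*L*S)) (by
        intro i _
        apply Dom.mul
        · refine (Dom.C _).mono ?_
          push_cast; rfl
        · refine (h.mon_dom i x).mono ?_
          apply pow_le_pow_right₀ (by norm_num)
          nlinarith [Nat.mul_le_mul_left (6*L) hx])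
    refine this.mono ?_
    rw [← Finset.sum_mul, pow_add]
    gcongr
    exact h.sumB p hp m1 h1 m2 h2
  have hH2 : aeval α H ≤ 2^Hh := by
    have := h.hH.eval (z := (α:ℂ)) (by rw [Complex.norm_real, Real.norm_eq_abs, abs_of_pos (by linarith [h.hα.h1])]; exact h.hα.h2.le)
    have e : aeval (α:ℂ) H = ((aeval α H : ℝ) : ℂ) := by
      exact (aeval_algebraMap_apply ℂ α H)
    rw [e, Complex.norm_real, Real.norm_eq_abs] at this
    exact (le_abs_self _).trans this
  have hl := liouville h.hα Q (by rw [hQ]; exact mul_ne_zero (by positivity) hne) (2^(D + 12*L*S)) (by positivity)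
    (fun z hz => hdom.eval hz)
  rw [hQ, abs_mul, abs_of_pos (by positivity)] at hl
  have e1 : aeval α H ^ ((Lr-1)*x) ≤ 2^(2*L*S) := by
    calc aeval α H ^ ((Lr-1)*x) ≤ (2^Hh)^((Lr-1)*x) := by gcongr
      _ = 2^(Hh * ((Lr-1)*x)) := by rw [← pow_mul]
      _ ≤ _ := by
        apply pow_le_pow_right₀ (by norm_num)
        have hL : 2 * L * S = Hh * (Lr * (2 * S)) := by
          have : 2 * L * S = L * (2 * S) := by ring
          rw [this]
          nth_rw 1 [h.hL]
          ring
        rw [hL]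
        exact Nat.mul_le_mul_left _ (Nat.mul_le_mul (Nat.sub_le _ _) hx)
  have e2 : ((2:ℝ)^(D + 12*L*S))^(k-1) ≤ 2^(469*(D+12*L*S)) := by
    rw [← pow_mul, mul_comm]
    apply pow_le_pow_right₀ (by norm_num)
    exact Nat.mul_le_mul_right _ (by have := h.hk; omega)
  have : aeval α H ^ ((Lr-1)*x) * |f| * ((2:ℝ)^(D + 12*L*S))^(k-1) ≤ 2^(2*L*S) * |f| * 2^(469*(D+12*L*S)) := by gcongr
  have e3 : (2:ℝ)^(2*L*S) * |f| * 2^(469*(D+12*L*S)) = |f| * 2^(469*D + 5630*L*S) := by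
    rw [show 469*D + 5630*L*S = 2*L*S + 469*(D+12*L*S) by ring, pow_add]; ring
  linarith

lemma BD.numA (h : BD k Hh Z Lr L S0 Δ T D α A2 G H b1 b2 b3) (S : ℕ) (hS : S0 ≤ S) :
    470*D + 7943*L*S + 1 < 7 * (S * Δ) := by
  obtain ⟨hL1, hL2, hL3⟩ := h.L_ge
  have hZ := h.hZ
  have hLpos : 0 < L := by omega
  have hΔL : Δ = 2048 * L := by rw [h.hΔ]; norm_num
  have hT : T = 2 * Z * (2048 * L) := by rw [h.hT, hΔL]
  have hD : D = 2 * Z + 98304 * (Z^2 * L) := by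
    rw [h.hD, hT, h.hS0]; ring
  have hZL : Z ≤ Z^2 * L := by
    calc Z = Z * 1 * 1 := by ring
      _ ≤ Z * Z * L := Nat.mul_le_mul (Nat.mul_le_mul_left _ (by omega)) hLpos
      _ = _ := by ring
  have hLS : 8192 * (Z^2 * L) ≤ L * S := by
    calc 8192 * (Z^2 * L) = L * S0 := by rw [h.hS0]; ring
      _ ≤ L * S := Nat.mul_le_mul_left _ hS
  have : S * Δ = 2048 * (L * S) := by rw [hΔL]; ring
  rw [this, mul_assoc 7943]
  omega

lemma BD.numLS (h : BD k Hh Z Lr L S0 Δ T D α A2 G H b1 b2 b3) (S : ℕ) (hSN : S < L * L * Lr) :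
    16 * 2^10 * (L:ℝ) * S ≤ (2:ℝ)^(3*Z) := by
  have hLz : (2:ℝ)^14 * L ≤ 2^Z := by exact_mod_cast h.bigL
  have hSz : (S:ℝ) ≤ 2^Z := by exact_mod_cast (hSN.le.trans h.hN)
  have h2Z : (1:ℝ) ≤ 2^Z := one_le_pow₀ (by norm_num)
  have h3Z : (2:ℝ)^(3*Z) = 2^Z * 2^Z * 2^Z := by ring
  rw [h3Z]
  calc 16 * 2^10 * (L:ℝ) * S = 2^14 * L * S * 1 := by norm_num
    _ ≤ 2^Z * 2^Z * 2^Z := by gcongr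

lemma BD.numQ (h : BD k Hh Z Lr L S0 Δ T D α A2 G H b1 b2 b3) (S : ℕ) (hSpos : 0 < S) (hSN : S < L * L * Lr) :
    (2 + 2 * S * (Δ + 2) : ℝ) ≤ 2^(3*Z) := by
  have hΔL : (Δ:ℝ) = 2048 * L := by rw [h.hΔ]; push_cast; ring
  have := h.numLS S hSN
  obtain ⟨hL1, hL2, hL3⟩ := h.L_ge
  have hL0 : (1:ℝ) ≤ L := by exact_mod_cast (by omega : 1 ≤ L)
  have hS0 : (1:ℝ) ≤ S := by exact_mod_cast hSpos
  have : (1:ℝ) * S ≤ L * S := by gcongr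
  rw [hΔL]
  nlinarith

lemma BD.numB (h : BD k Hh Z Lr L S0 Δ T D α A2 G H b1 b2 b3) (S : ℕ) (hSpos : 0 < S) (hSN : S < L * L * Lr) :
    7*(S*Δ) + 2*Δ + 3*Z*(S*Δ) + 3*Z + 2 ≤ 4*Z*(L*L*Lr)*Δ := by
  obtain ⟨hL1, hL2, hL3⟩ := h.L_ge
  have hZ := h.hZ
  have hΔL : Δ = 2048 * L := by rw [h.hΔ]; norm_num
  have hΔ1 : 1 * Δ ≤ S * Δ := Nat.mul_le_mul_right _ hSpos
  have hNW : S * Δ ≤ (L*L*Lr) * Δ := Nat.mul_le_mul_right _ hSN.le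
  have hWB : 4 * Z * (S * Δ) ≤ 4*Z*(L*L*Lr)*Δ := by
    calc 4 * Z * (S * Δ) ≤ 4 * Z * ((L*L*Lr) * Δ) := Nat.mul_le_mul_left _ hNW
      _ = _ := by ring
  have hZS : 2048 * (S * Δ) ≤ Z * (S * Δ) := Nat.mul_le_mul_right _ hZ
  have : 4 * Z * (S * Δ) = 3 * Z * (S * Δ) + Z * (S * Δ) := by ring
  omega

lemma BD.step (h : BD k Hh Z Lr L S0 Δ T D α A2 G H b1 b2 b3) (p : IX L Lr → ℤ)
    (hp : ∀ m1 < T, ∀ m2 < T, ∀ i, |(p i : ℝ) * (gA b1 b3 i:ℝ)^m1 * (gB b2 b3 i:ℝ)^m2| * 2^Z ≤ 2^D)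
    (hΛ : |b1 * Real.log α + b2 * Real.log A2 + b3 * Real.log (aeval α G / aeval α H)| * 2^(4*Z*(L*L*Lr)*Δ) < 1)
    (S : ℕ) (hS : S0 ≤ S) (hSN : S < L * L * Lr) (T' : ℕ) (hT' : T' ≤ T)
    (hv : ∀ m1 < T', ∀ m2 < T', ∀ l < S, fs b1 b2 b3 (Real.log α) (Real.log A2) (Real.log (aeval α G / aeval α H)) p m1 m2 l = 0)
    (m1 m2 : ℕ) (h1 : m1 + Δ < T') (h2 : m2 + Δ < T') (x : ℕ) (hx : x < 2 * S) :
    fs b1 b2 b3 (Real.log α) (Real.log A2) (Real.log (aeval α G / aeval α H)) p m1 m2 x = 0 := by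
  apply h.fs_liou p hp m1 (by omega) m2 (by omega) S x hx.le
  set l1 := Real.log α with hl1
  set l2 := Real.log A2 with hl2
  set l3 := Real.log (aeval α G / aeval α H) with hl3
  set Λ := b1 * l1 + b2 * l2 + b3 * l3 with hΛd
  obtain ⟨hL1, hL2, hL3⟩ := h.L_ge
  have hZ := h.hZ
  have hLpos : 0 < L := by omega
  have hSpos : 0 < S := by
    have : 0 < S0 := by rw [h.hS0]; positivity
    omega
  have hb : (1:ℝ) ≤ b3 := by exact_mod_cast h.hb3p
  have hΔL : Δ = 2048 * L := by rw [h.hΔ]; norm_num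
  have hB := h.numB S hSpos hSN
  have hLamle : |Λ| ≤ 1 := by
    have : (1:ℝ) ≤ 2^(4*Z*(L*L*Lr)*Δ) := one_le_pow₀ (by norm_num)
    nlinarith [abs_nonneg Λ]
  have hdiff : ∀ i : IX L Lr, om l1 l2 l3 i - (gA b1 b3 i * l1 + gB b2 b3 i * l2) / b3 = i.2.2.val * Λ / b3 := by
    intro i
    unfold om gA gB
    push_cast
    field_simp
    rw [hΛd]
    ring
  have hdl : ∀ i : IX L Lr, |om l1 l2 l3 i - (gA b1 b3 i * l1 + gB b2 b3 i * l2) / b3| ≤ L * |Λ| := by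
    intro i
    rw [hdiff, abs_div, abs_mul, Nat.abs_cast, abs_of_pos (show (0:ℝ) < b3 by linarith)]
    rw [div_le_iff₀ (by linarith)]
    have : (i.2.2.val:ℝ) ≤ L := by exact_mod_cast (by have := i.2.2.isLt; omega)
    have : (i.2.2.val:ℝ) * |Λ| ≤ L * |Λ| := by gcongr
    have : L * |Λ| * 1 ≤ L * |Λ| * b3 := by gcongr
    linarith
  have homw : ∀ i : IX L Lr, |(gA b1 b3 i * l1 + gB b2 b3 i * l2) / b3| ≤ 6 * L := by
    intro i
    have a1 := h.om_le i
    have a2 := hdl i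
    have a3 : L * |Λ| ≤ L * 1 := by gcongr
    have := abs_sub_abs_le_abs_sub ((gA b1 b3 i * l1 + gB b2 b3 i * l2) / b3) (om l1 l2 l3 i)
    rw [abs_sub_comm] at this
    linarith
  have hLz : (2:ℝ)^14 * L ≤ 2^Z := by exact_mod_cast h.bigL
  have hSz : (S:ℝ) ≤ 2^Z := by exact_mod_cast (hSN.le.trans h.hN)
  have hL0 : (1:ℝ) ≤ L := by exact_mod_cast hLpos
  have hS0 : (1:ℝ) ≤ S := by exact_mod_cast hSpos
  have h2Z : (1:ℝ) ≤ 2^Z := one_le_pow₀ (by norm_num)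
  have h3Z : (2:ℝ)^(3*Z) = 2^Z * 2^Z * 2^Z := by ring
  have hLS := h.numLS S hSN
  have hsm : 2 * (L * |Λ| * (2 * S)) ≤ 2^(3*Z) * |Λ| := by
    have h0 : 0 ≤ (L:ℝ) * S := by positivity
    have : 4 * L * S ≤ (2:ℝ)^(3*Z) := by linarith
    calc 2 * (L * |Λ| * (2 * S)) = (4 * L * S) * |Λ| := by ring
      _ ≤ _ := by gcongr
  have hLamW : 2^(3*Z) * |Λ| ≤ 1 := by
    have : (2:ℝ)^(3*Z) ≤ 2^(4*Z*(L*L*Lr)*Δ) := by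
      apply pow_le_pow_right₀ (by norm_num); omega
    nlinarith [abs_nonneg Λ]
  have hclose : ∀ m1 < T, ∀ m2 < T, ∀ l < 2 * S,
    ‖FF (fun i => (p i:ℝ)) (fun i => (gA b1 b3 i:ℝ)) (fun i => (gB b2 b3 i:ℝ)) (om l1 l2 l3) m1 m2 (l:ℂ) -
     FF (fun i => (p i:ℝ)) (fun i => (gA b1 b3 i:ℝ)) (fun i => (gB b2 b3 i:ℝ))
      (fun i => (gA b1 b3 i * l1 + gB b2 b3 i * l2) / b3) m1 m2 (l:ℂ)‖ ≤ 2^(D + 18*L*S + 3*Z) * |Λ| := by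
    intro m1 h1 m2 h2 l hl
    have hlr : (l:ℝ) ≤ 2 * S := by exact_mod_cast hl.le
    have := FF_close (fun i => (p i:ℝ)) (fun i => (gA b1 b3 i:ℝ)) (fun i => (gB b2 b3 i:ℝ)) (om l1 l2 l3)
      (fun i => (gA b1 b3 i * l1 + gB b2 b3 i * l2) / b3) m1 m2 l (2^D) (6*L) (L * |Λ| * (2*S)) homw (by positivity)
      (by nlinarith) (by
        intro i
        rw [abs_mul, Nat.abs_cast]
        have := hdl i
        gcongr) (h.sumB p hp m1 h1 m2 h2)
    refine this.trans ?_
    have e1 : Real.exp (6 * L * l) ≤ 2^(18*L*S) := by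
      have e := exp_two_mul_le (6 * L * S)
      refine le_trans (Real.exp_le_exp.mpr ?_) (e.trans (le_of_eq ?_))
      · push_cast
        have : 6 * (L:ℝ) * l ≤ 6 * L * (2 * S) := by gcongr
        linarith
      · congr 1; ring
    calc 2^D * Real.exp (6 * L * l) * (2 * (L * |Λ| * (2 * S))) ≤ 2^D * 2^(18*L*S) * (2^(3*Z) * |Λ|) := by gcongr
      _ = _ := by rw [pow_add, pow_add]; ring
  have hl1n : 0 ≤ l1 := Real.log_nonneg h.hα.h1.le
  have ha2 : (2:ℝ) ≤ A2 := by exact_mod_cast h.hA2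
  have hl2n : 0 ≤ l2 := Real.log_nonneg (by linarith)
  have hl12 : l1 + l2 ≤ 4 := by
    have a1 : l1 ≤ 1 := by
      have := Real.log_le_sub_one_of_pos (show 0 < α by linarith [h.hα.h1]); linarith [h.hα.h2]
    have a2 : l2 ≤ 3 := by
      have a10 : (A2:ℝ) ≤ 10 := by exact_mod_cast h.hA10
      rw [hl2, Real.log_le_iff_le_exp (by linarith)]
      refine a10.trans ?_
      have := Real.exp_one_gt_d9
      rw [show (3:ℝ) = 1 + 1 + 1 by norm_num, Real.exp_add, Real.exp_add]
      have e2 : (2.7:ℝ) * 2.7 ≤ Real.exp 1 * Real.exp 1 := by gcongr <;> linarith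
      nlinarith
    linarith
  have han := analytic_step (fun i => (p i:ℝ)) (fun i => (gA b1 b3 i:ℝ)) (fun i => (gB b2 b3 i:ℝ))
    (fun i : IX L Lr => (gA b1 b3 i * l1 + gB b2 b3 i * l2) / b3) l1 l2 b3 hb hl1n hl2n hl12 (fun i => rfl)
    T' Δ S hSpos (2^(D + 18*L*S + 3*Z) * |Λ|) (2^D) (6*L) (by positivity) homw
    (fun m1 h1 m2 h2 => h.sumB p hp m1 (by omega) m2 (by omega)) (by
      intro m1 h1 m2 h2 l hl
      have := hclose m1 (by omega) m2 (by omega) l (by omega)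
      rw [fs_FF, hv m1 h1 m2 h2 l hl] at this
      simpa using this) m1 m2 h1 h2 x hx
  have hc := hclose m1 (by omega) m2 (by omega) x hx
  rw [fs_FF] at hc
  refine num_step D L S Δ Z (4*Z*(L*L*Lr)*Δ) |Λ| _ (2^(D + 18*L*S + 3*Z) * |Λ|) (abs_nonneg _) hΛ rfl ?_ hB ?_ ?_
  · exact h.numA S hS
  · exact h.numQ S hSpos hSN
  · have t := norm_sub_norm_le ((fs b1 b2 b3 l1 l2 l3 p m1 m2 x : ℝ) : ℂ) (FF (fun i => (p i:ℝ)) (fun i => (gA b1 b3 i:ℝ)) (fun i => (gB b2 b3 i:ℝ))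
      (fun i => (gA b1 b3 i * l1 + gB b2 b3 i * l2) / b3) m1 m2 (x:ℂ))
    rw [Complex.norm_real, Real.norm_eq_abs] at t
    linarith
end


section
open Polynomial

variable {k Hh Z Lr L S0 Δ T D : ℕ} {α : ℝ} {A2 : ℕ} {G H : ℤ[X]} {b1 b2 b3 : ℤ}

lemma vand {ι : Type} [Fintype ι] (p : ι → ℝ) (u : ι → ℝ) (hu : Function.Injective u)
    (h : ∀ l < Fintype.card ι, ∑ i, p i * Real.exp (u i * l) = 0) : p = 0 := by
  let e := Fintype.equivFin ι
  have := Matrix.eq_zero_of_forall_pow_sum_mul_pow_eq_zero (f := fun j => Real.exp (u (e.symm j)))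
    (v := fun j => p (e.symm j)) (by
      intro x y hxy
      exact e.symm.injective (hu (Real.exp_injective hxy))) (by
      intro i
      have := h i.val i.isLt
      rw [← Equiv.sum_comp e.symm] at this
      rw [← this]
      apply Finset.sum_congr rfl
      intro j _
      rw [← Real.exp_nat_mul, mul_comm (i.val:ℝ)])
  funext i
  have h2 := congrFun this (e i)
  simpa using h2

lemma BD.om_inj (h : BD k Hh Z Lr L S0 Δ T D α A2 G H b1 b2 b3) : Function.Injective
    (fun i : IX L Lr => om (Real.log α) (Real.log A2) (Real.log (aeval α G / aeval α H)) i) := by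
  rintro ⟨x1, y1, z1⟩ ⟨x2, y2, z2⟩ hxy
  simp only [om] at hxy
  have := h.hind ((x1.val:ℤ) - x2.val) ((y1.val:ℤ) - y2.val) ((z1.val:ℤ) - z2.val) (by push_cast; linarith)
  obtain ⟨h1, h2, h3⟩ := this
  simp only [Prod.mk.injEq]
  refine ⟨Fin.ext (by omega), Fin.ext (by omega), Fin.ext (by omega)⟩

theorem BD.baker (h : BD k Hh Z Lr L S0 Δ T D α A2 G H b1 b2 b3) :
    1 ≤ |b1 * Real.log α + b2 * Real.log A2 + b3 * Real.log (aeval α G / aeval α H)| * 2^(4*Z*(L*L*Lr)*Δ) := by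
  by_contra hlt
  push Not at hlt
  obtain ⟨p, hp0, hp1, hp2⟩ := h.aux
  obtain ⟨hL1, hL2, hL3⟩ := h.L_ge
  have hZ := h.hZ
  have hS0 : 8192 ≤ S0 := by
    rw [h.hS0]
    have : 1 ≤ Z^2 := Nat.one_le_pow _ _ (by omega)
    omega
  have claim : ∀ J : ℕ, 2^J * S0 < 2 * (L * L * Lr) → ∀ m1, m1 + J * Δ < T → ∀ m2, m2 + J * Δ < T → ∀ l < 2^J * S0,
      fs b1 b2 b3 (Real.log α) (Real.log A2) (Real.log (aeval α G / aeval α H)) p m1 m2 l = 0 := by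
    intro J
    induction J with
    | zero =>
      intro _ m1 h1 m2 h2 l hl
      exact hp2 m1 (by omega) m2 (by omega) l (by omega)
    | succ J ih =>
      intro hJ m1 h1 m2 h2 l hl
      rw [pow_succ] at hJ hl
      have hmul : (J + 1) * Δ = J * Δ + Δ := by ring
      refine h.step p hp1 hlt (2^J * S0) ?_ (by linarith) (T - J * Δ) (Nat.sub_le _ _) ?_ m1 m2 (by omega) (by omega) l (by linarith)
      · have : 1 ≤ 2^J := Nat.one_le_two_pow
        nlinarith
      · intro n1 k1 n2 k2 x hx
        exact ih (by linarith) n1 (by omega) n2 (by omega) x hx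
  have hex : ∃ J : ℕ, L * L * Lr ≤ 2^J * S0 := ⟨Z, h.hN.trans (Nat.le_mul_of_pos_right _ (by omega))⟩
  classical
  set J := Nat.find hex with hJ
  have hJ1 : L * L * Lr ≤ 2^J * S0 := Nat.find_spec hex
  have hJZ : J ≤ Z := Nat.find_min' hex (h.hN.trans (Nat.le_mul_of_pos_right _ (by omega)))
  have hJ2 : 2^J * S0 < 2 * (L * L * Lr) := by
    rcases Nat.eq_zero_or_pos J with h0 | h0
    · rw [h0]
      have e : S0 ≤ Lr := by
        rw [h.hS0, h.hLr]
        have : Z^2 ≤ Z^4 := Nat.pow_le_pow_right (by omega) (by omega)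
        omega
      have e2 : 1 * 1 * Lr ≤ L * L * Lr := Nat.mul_le_mul_right _ (Nat.mul_le_mul (by omega) (by omega))
      omega
    · have := Nat.find_min hex (show J - 1 < J by omega)
      push Not at this
      have e : 2^J = 2^(J-1) * 2 := by rw [← pow_succ]; congr 1; omega
      rw [e]; linarith
  have hTJ : J * Δ < T := by
    have hΔ : 0 < Δ := by rw [h.hΔ]; have : 0 < L := by omega
                          positivity
    rw [h.hT]
    have : J * Δ ≤ Z * Δ := Nat.mul_le_mul_right _ hJZ
    have e3 : 0 < Z * Δ := by positivity
    nlinarith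
  have hz := claim J hJ2 0 (by omega) 0 (by omega)
  have := vand (fun i => (p i:ℝ)) _ h.om_inj (by
    intro l hl
    have hcardι : Fintype.card (IX L Lr) = L * L * Lr := by simp [IX, mul_assoc]
    have := hz l (by omega)
    unfold fs at this
    simpa using this)
  apply hp0
  funext i
  have := congrFun this i
  simpa using this

/-- clean form of the lower bound -/
theorem baker_lower {k : ℕ} {α : ℝ} (hα : IsAlpha k α) (hk : k ≤ 470) (Hh Z : ℕ) (A2 : ℕ) (G H : ℤ[X]) (b1 b2 b3 : ℤ)
    (hZ : 2048 ≤ Z) (hHh : 1 ≤ Hh) (hA2 : 2 ≤ A2) (hA10 : A2 ≤ 10) (hG : Dom G (2^Hh)) (hH : Dom H (2^Hh))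
    (hGp : 0 < aeval α G) (hHp : 0 < aeval α H) (hl3 : |Real.log (aeval α G / aeval α H)| ≤ Hh)
    (hb1 : |b1| ≤ 2^Z) (hb2 : |b2| ≤ 2^Z) (hb3 : b3 ≤ 2^Z) (hb3p : 1 ≤ b3)
    (hN : 2^141 * Hh^2 * Z^12 ≤ 2^Z)
    (hind : ∀ x y z : ℤ, x * Real.log α + y * Real.log A2 + z * Real.log (aeval α G / aeval α H) = 0 →
      x = 0 ∧ y = 0 ∧ z = 0) :
    1 ≤ |b1 * Real.log α + b2 * Real.log A2 + b3 * Real.log (aeval α G / aeval α H)| * 2^(2^201 * Hh^3 * Z^17) := by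
  have h : BD k Hh Z (2^47 * Z^4) (Hh * (2^47 * Z^4)) (2^13 * Z^2) (2^11 * (Hh * (2^47 * Z^4)))
      (2 * Z * (2^11 * (Hh * (2^47 * Z^4)))) _ α A2 G H b1 b2 b3 :=
    ⟨hα, hk, hZ, hHh, hA2, hA10, hG, hH, hGp, hHp, hl3, hb1, hb2, hb3, hb3p, rfl, rfl, rfl, rfl, rfl, rfl,
      by refine le_trans (le_of_eq ?_) hN
         ring, hind⟩
  have := h.baker
  rwa [show 4 * Z * (Hh * (2^47 * Z^4) * (Hh * (2^47 * Z^4)) * (2^47 * Z^4)) * (2^11 * (Hh * (2^47 * Z^4)))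
    = 2^201 * Hh^3 * Z^17 by ring] at this
end


section
open Polynomial

lemma psi_dvd {k : ℕ} {α : ℝ} (h : IsAlpha k α) (Q : ℤ[X]) (hQ : aeval α Q = 0) : Psi k ∣ Q := by
  have hm := Psi_monic k (by have := h.hk; omega)
  have hint : IsIntegral ℤ α := ⟨Psi k, hm, by simpa [aeval_def] using h.aeval_eq⟩
  have h1 : minpoly ℤ α ∣ Psi k := minpoly.isIntegrallyClosed_dvd hint h.aeval_eq
  have h2 : minpoly ℤ α ∣ Q := minpoly.isIntegrallyClosed_dvd hint hQ
  have h3 := (Psi_irreducible h).dvd_iff.mp h1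
  rcases h3 with h3 | h3
  · exact absurd h3 (minpoly.not_isUnit ℤ α)
  · exact h3.dvd.trans h2

lemma nrm_congr {k : ℕ} {α : ℝ} (h : IsAlpha k α) (P Q : ℤ[X]) (hPQ : aeval α P = aeval α Q) : nrm k P = nrm k Q := by
  have hk : 0 < k := by have := h.hk; omega
  obtain ⟨R, hR⟩ := psi_dvd h (P - Q) (by rw [map_sub, hPQ, sub_self])
  have : (nrm k P : ℂ) = nrm k Q := by
    rw [nrm_cast hk, nrm_cast hk]
    congr 1
    apply Multiset.map_congr rfl
    intro z hz
    have hz := (mem_rootsC hk z).mp hz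
    have : aeval z (P - Q) = 0 := by rw [hR, map_mul, hz, zero_mul]
    rw [map_sub] at this
    exact sub_eq_zero.mp this
  exact_mod_cast this

lemma nrm_pow {k : ℕ} (hk : 0 < k) (P : ℤ[X]) (n : ℕ) : nrm k (P^n) = nrm k P ^ n := by
  have : (nrm k (P^n) : ℂ) = (nrm k P : ℂ)^n := by
    rw [nrm_cast hk, nrm_cast hk, ← Multiset.prod_map_pow]
    simp
  exact_mod_cast this

lemma card_rootsC {k : ℕ} (hk : 0 < k) : Multiset.card ((Psi k).map (algebraMap ℤ ℂ)).roots = k := by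
  rw [← (IsAlgClosed.splits ((Psi k).map (algebraMap ℤ ℂ))).natDegree_eq_card_roots,
      (Psi_monic k hk).natDegree_map, Psi_natDegree k hk]

lemma nrm_C {k : ℕ} (hk : 0 < k) (c : ℤ) : nrm k (C c) = c^k := by
  have : (nrm k (C c) : ℂ) = (c:ℂ)^k := by
    rw [nrm_cast hk]
    simp only [aeval_C, Multiset.map_const', Multiset.prod_replicate, card_rootsC hk]
    simp
  exact_mod_cast this

lemma nrm_lin {k : ℕ} (hk : 0 < k) (a b : ℤ) (ha : a ≠ 0) :
    ∃ s : ℤ, (s = 1 ∨ s = -1) ∧ (b - a) * (s * nrm k (C a * X - C b)) = b^(k+1) - 2*a*b^k + a^(k+1) := by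
  refine ⟨(-1)^k, by rcases Nat.even_or_odd k with h | h <;> simp [h.neg_one_pow], ?_⟩
  have ha' : (a:ℂ) ≠ 0 := by exact_mod_cast ha
  have hm := (Psi_monic k hk).map (algebraMap ℤ ℂ)
  have e1 : ((-1)^k * nrm k (C a * X - C b) : ℂ) = (a:ℂ)^k * aeval ((b:ℂ)/a) (Psi k) := by
    rw [nrm_cast hk]
    have hs := (IsAlgClosed.splits ((Psi k).map (algebraMap ℤ ℂ))).eq_prod_roots_of_monic hm
    have : aeval ((b:ℂ)/a) (Psi k) = eval ((b:ℂ)/a) ((Psi k).map (algebraMap ℤ ℂ)) := by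
      rw [eval_map_algebraMap]
    rw [this]
    nth_rw 2 [hs]
    rw [eval_multiset_prod, Multiset.map_map]
    have c := card_rootsC hk
    set r := ((Psi k).map (algebraMap ℤ ℂ)).roots
    rw [← c]
    have p1 : ∀ (t : Multiset ℂ) (u : ℂ), u ^ (Multiset.card t) = (t.map (fun _ => u)).prod := by
      intro t u; simp
    rw [p1 r (-1), p1 r (a:ℂ), ← Multiset.prod_map_mul, ← Multiset.prod_map_mul]
    congr 1
    apply Multiset.map_congr rfl
    intro z _
    simp
    field_simp
  have e2 : ((b:ℂ)/a - 1) * aeval ((b:ℂ)/a) (Psi k) = ((b:ℂ)/a)^(k+1) - 2 * ((b:ℂ)/a)^k + 1 := by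
    have := congrArg (aeval ((b:ℂ)/a)) (Psi_mul k)
    have t : aeval ((b:ℂ)/a) (2:ℤ[X]) = 2 := map_ofNat _ 2
    simpa [t] using this
  have e3 : ((b:ℂ) - a) * ((-1)^k * nrm k (C a * X - C b)) = (b:ℂ)^(k+1) - 2*a*(b:ℂ)^k + (a:ℂ)^(k+1) := by
    rw [e1]
    have : ((b:ℂ) - a) * ((a:ℂ)^k * aeval ((b:ℂ)/a) (Psi k)) = (a:ℂ)^(k+1) * (((b:ℂ)/a - 1) * aeval ((b:ℂ)/a) (Psi k)) := by
      field_simp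
      ring
    rw [this, e2, div_pow, div_pow]
    field_simp
    ring
  exact_mod_cast e3

lemma nrm_X {k : ℕ} (hk : 0 < k) : (nrm k X).natAbs = 1 := by
  obtain ⟨s, hs, h⟩ := nrm_lin hk 1 0 (by norm_num)
  rcases hs with rfl | rfl <;> simp [hk.ne'] at h <;> omega

lemma nrm_X1 {k : ℕ} (hk : 2 ≤ k) : (nrm k (X - 1)).natAbs = k - 1 := by
  have hk' : 0 < k := by omega
  have : (nrm k (X - 1) : ℂ) * (-1)^k = aeval (1:ℂ) (Psi k) := by
    rw [nrm_cast hk']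
    have hm := (Psi_monic k hk').map (algebraMap ℤ ℂ)
    have hs := (IsAlgClosed.splits ((Psi k).map (algebraMap ℤ ℂ))).eq_prod_roots_of_monic hm
    have : aeval (1:ℂ) (Psi k) = eval (1:ℂ) ((Psi k).map (algebraMap ℤ ℂ)) := by
      rw [eval_map_algebraMap]
    rw [this]
    nth_rw 2 [hs]
    rw [eval_multiset_prod, Multiset.map_map]
    have c := card_rootsC hk'
    set r := ((Psi k).map (algebraMap ℤ ℂ)).roots
    rw [← c]
    have p1 : ∀ (t : Multiset ℂ) (u : ℂ), u ^ (Multiset.card t) = (t.map (fun _ => u)).prod := by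
      intro t u; simp
    rw [p1 r (-1), ← Multiset.prod_map_mul]
    congr 1
    apply Multiset.map_congr rfl
    intro z _
    simp
  have e : aeval (1:ℂ) (Psi k) = 1 - k := by simp [Psi]
  rw [e] at this
  have h2 : nrm k (X - 1) * (-1)^k = 1 - k := by exact_mod_cast this
  have h3 := congrArg Int.natAbs h2
  rw [Int.natAbs_mul, Int.natAbs_pow] at h3
  simp at h3
  omega

lemma nrm_2X1 {k : ℕ} (hk : 2 ≤ k) : (nrm k (C 2 * X - C 1)).natAbs = 2^(k+1) - 3 := by
  obtain ⟨s, hs, h⟩ := nrm_lin (show 0 < k by omega) 2 1 (by norm_num)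
  have h8 : (2:ℤ)^(k+1) ≥ 8 := by
    calc (8:ℤ) = 2^3 := by norm_num
      _ ≤ 2^(k+1) := pow_le_pow_right₀ (by norm_num) (by omega)
  have : (((2:ℕ)^(k+1) : ℕ) : ℤ) = (2:ℤ)^(k+1) := by push_cast; rfl
  rw [one_pow, one_pow] at h
  rcases hs with rfl | rfl <;> omega

/-- the norm of the denominator -/
lemma nrm_den {k : ℕ} (hk : 2 ≤ k) :
    (k-1) * (nrm k (C ((k:ℤ)+1) * X - C (2*(k:ℤ)))).natAbs = ((2^(k+1)*k^k : ℤ) - (k+1)^(k+1)).natAbs := by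
  obtain ⟨s, hs, h⟩ := nrm_lin (show 0 < k by omega) ((k:ℤ)+1) (2*(k:ℤ)) (by omega)
  have h2 := congrArg Int.natAbs h
  rw [Int.natAbs_mul, Int.natAbs_mul] at h2
  have hs' : s.natAbs = 1 := by rcases hs with rfl | rfl <;> rfl
  rw [hs', one_mul] at h2
  have h3 : (2 * (k:ℤ) - (k+1)).natAbs = k - 1 := by omega
  rw [h3] at h2
  rw [h2, ← Int.natAbs_neg]
  congr 1
  rw [mul_pow, mul_pow]
  ring

lemma hind_of_val {k : ℕ} {α : ℝ} (h : IsAlpha k α) (A2 : ℕ) (hA2 : 2 ≤ A2) (G H : ℤ[X]) (hG : 0 < aeval α G)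
    (hH : 0 < aeval α H) (p : ℕ) (hp : p.Prime) (hpA : ¬ p ∣ A2)
    (hv : padicValNat p (nrm k G).natAbs ≠ padicValNat p (nrm k H).natAbs) :
    ∀ x y z : ℤ, x * Real.log α + y * Real.log A2 + z * Real.log (aeval α G / aeval α H) = 0 →
      x = 0 ∧ y = 0 ∧ z = 0 := by
  intro x y z hxyz
  have hk : 0 < k := by have := h.hk; omega
  have := Fact.mk hp
  have hα0 : 0 < α := by linarith [h.h1]
  have hA0 : (0:ℝ) < A2 := by positivity
  let P := (X:ℤ[X])^x.toNat * (C (A2:ℤ))^y.toNat * (G^z.toNat * H^(-z).toNat)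
  let Q := (X:ℤ[X])^(-x).toNat * (C (A2:ℤ))^(-y).toNat * (G^(-z).toNat * H^(z).toNat)
  have hPQ : aeval α P = aeval α Q := by
    simp only [P, Q, map_mul, map_pow, aeval_X, aeval_C]
    have hA0' : (0:ℝ) < (algebraMap ℤ ℝ) (A2:ℤ) := by simpa using hA0
    apply Real.log_injOn_pos (by simp only [Set.mem_Ioi]; positivity) (by simp only [Set.mem_Ioi]; positivity)
    rw [Real.log_mul (by positivity) (by positivity), Real.log_mul (by positivity) (by positivity),
      Real.log_mul (by positivity) (by positivity),
      Real.log_mul (by positivity) (by positivity), Real.log_mul (by positivity) (by positivity),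
      Real.log_mul (by positivity) (by positivity)]
    simp only [Real.log_pow]
    rw [Real.log_div hG.ne' hH.ne'] at hxyz
    have t : ∀ w : ℤ, (w:ℝ) = (w.toNat:ℝ) - ((-w).toNat:ℝ) := by
      intro w
      have : w = (w.toNat:ℤ) - ((-w).toNat:ℤ) := by omega
      exact_mod_cast this
    rw [t x, t y, t z] at hxyz
    have : Real.log ((algebraMap ℤ ℝ) (A2:ℤ)) = Real.log A2 := by simp
    rw [this]
    linarith
  have hn := nrm_congr h P Q hPQ
  have hGn : (nrm k G).natAbs ≠ 0 := by simpa using nrm_ne_zero h G hG.ne'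
  have hHn : (nrm k H).natAbs ≠ 0 := by simpa using nrm_ne_zero h H hH.ne'
  have hA : A2 ≠ 0 := by omega
  simp only [P, Q, nrm_mul hk, nrm_pow hk, nrm_C hk] at hn
  have hn2 := congrArg Int.natAbs hn
  simp only [Int.natAbs_mul, Int.natAbs_pow, nrm_X hk, one_pow, one_mul, Int.natAbs_natCast] at hn2
  have hz : z = 0 := by
    have hn3 := congrArg (padicValNat p) hn2
    have hpv : padicValNat p A2 = 0 := padicValNat.eq_zero_of_not_dvd hpA
    rw [padicValNat.mul (by positivity) (by positivity), padicValNat.mul (by positivity) (by positivity),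
      padicValNat.mul (by positivity) (by positivity), padicValNat.mul (by positivity) (by positivity)] at hn3
    simp only [padicValNat.pow, hpv, mul_zero, zero_add] at hn3
    by_contra hz0
    rcases lt_or_gt_of_ne hz0 with h0 | h0
    · have : z.toNat = 0 := by omega
      rw [this] at hn3
      simp at hn3
      rcases hn3 with hn3 | hn3
      · exact hv hn3.symm
      · omega
    · have : (-z).toNat = 0 := by omega
      rw [this] at hn3
      simp at hn3
      rcases hn3 with hn3 | hn3
      · exact hv hn3
      · omega
  have hy : y = 0 := by
    rw [hz] at hn2
    simp at hn2
    rw [← pow_mul, ← pow_mul] at hn2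
    have := Nat.pow_right_injective hA2 hn2
    have := Nat.eq_of_mul_eq_mul_left hk this
    omega
  have hlog : 0 < Real.log α := Real.log_pos h.h1
  rw [hz, hy] at hxyz
  simp at hxyz
  rcases hxyz with hx | hx
  · exact ⟨hx, hy, hz⟩
  · have := h.h1; rcases hx with hx | hx | hx <;> linarith
end


section
open Polynomial

/-- polynomials for the leading coefficient -/
noncomputable def GG : ℤ[X] := C 9 * (X - 1) * (C 2 * X - C 1)
noncomputable def HH (k M : ℕ) : ℤ[X] := C (M:ℤ) * (C ((k:ℤ)+1) * X - C (2*(k:ℤ)))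

def gk (k : ℕ) : ℕ := 2^(k+1) - 3
def yk (k : ℕ) : ℕ := 5 * (k-1) * ((2^(k+1)*k^k : ℤ) - (k+1)^(k+1)).natAbs

def sqm (g : ℕ) : ℕ → ℕ → ℕ
  | 0, x => x % g
  | n+1, x => sqm g n (x * x % g)

lemma sqm_eq (g : ℕ) : ∀ n x, sqm g n x = x^(2^n) % g := by
  intro n
  induction n with
  | zero => intro x; simp [sqm]
  | succ n ih =>
    intro x
    rw [sqm, ih, pow_succ', pow_mul, ← Nat.pow_mod, sq]

def indCheck (k : ℕ) : Bool := k == 6 || sqm (gk k) 9 (yk k) != 0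

lemma indCheck_all : ∀ k ∈ Finset.Icc 3 470, indCheck k = true := by decide +kernel

lemma exists_prime_of_not_dvd (g y n : ℕ) (hg : g ≠ 0) (hy : y ≠ 0) (hgn : g < 2^(n+1)) (h : ¬ g ∣ y^n) :
    ∃ p, p.Prime ∧ p ∣ g ∧ ¬ p ∣ y := by
  by_contra hc
  push Not at hc
  apply h
  rw [← Nat.factorization_prime_le_iff_dvd hg (pow_ne_zero _ hy)]
  intro p hp
  by_cases hpg : p ∣ g
  · have h1 : 1 ≤ y.factorization p := (hp.dvd_iff_one_le_factorization hy).mp (hc p hp hpg)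
    have h2 : g.factorization p ≤ n := by
      have h3 : p ^ g.factorization p ≤ g := Nat.ordProj_le p hg
      have h4 : 2 ^ g.factorization p ≤ p ^ g.factorization p := Nat.pow_le_pow_left hp.two_le _
      have : 2 ^ g.factorization p < 2^(n+1) := by omega
      have := (Nat.pow_lt_pow_iff_right (by norm_num : 1 < 2)).mp this
      omega
    rw [Nat.factorization_pow]
    simp
    nlinarith
  · rw [Nat.factorization_eq_zero_of_not_dvd hpg]; omega

lemma nrm_GG {k : ℕ} (hk : 2 ≤ k) : (nrm k GG).natAbs = 9^k * (k-1) * gk k := by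
  have hk' : 0 < k := by omega
  rw [GG, nrm_mul hk', nrm_mul hk', nrm_C hk', Int.natAbs_mul, Int.natAbs_mul, nrm_X1 hk, nrm_2X1 hk, gk, Int.natAbs_pow]
  rfl

lemma nrm_HH {k : ℕ} (hk : 2 ≤ k) (M : ℕ) : (nrm k (HH k M)).natAbs = M^k * (nrm k (C ((k:ℤ)+1) * X - C (2*(k:ℤ)))).natAbs := by
  have hk' : 0 < k := by omega
  rw [HH, nrm_mul hk', nrm_C hk', Int.natAbs_mul, Int.natAbs_pow, Int.natAbs_natCast]

lemma GG_pos {k : ℕ} {α : ℝ} (h : IsAlpha k α) : 0 < aeval α GG := by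
  have := h.h1
  simp only [GG, map_mul, map_sub, aeval_C, aeval_X, map_one]
  simp
  apply mul_pos <;> linarith

lemma GG_eval (α : ℝ) : aeval α GG = 9 * (α - 1) * (2 * α - 1) := by
  have t9 : aeval α (9:ℤ[X]) = 9 := map_ofNat _ 9
  have t : aeval α (2:ℤ[X]) = 2 := map_ofNat _ 2
  simp [GG, t, t9]

lemma HH_eval (k M : ℕ) (α : ℝ) : aeval α (HH k M) = M * ((k+1) * α - 2 * k) := by
  have t : aeval α (2:ℤ[X]) = 2 := map_ofNat _ 2
  simp [HH, t]

lemma HH_pos {k M : ℕ} {α : ℝ} (h : IsAlpha k α) (hM : 1 ≤ M) : 0 < aeval α (HH k M) := by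
  rw [HH_eval]
  have := h.den_pos
  have : (1:ℝ) ≤ M := by exact_mod_cast hM
  apply mul_pos <;> linarith

lemma den_nrm_ne {k : ℕ} {α : ℝ} (h : IsAlpha k α) : (nrm k (C ((k:ℤ)+1) * X - C (2*(k:ℤ)))).natAbs ≠ 0 := by
  have h0 := nrm_ne_zero h _ (HH_pos (M := 1) h le_rfl).ne'
  have h1 := nrm_HH h.hk 1
  simp only [one_pow, one_mul] at h1
  rw [← h1]
  simpa using h0

lemma ind_6 {α : ℝ} (h : IsAlpha 6 α) (M : ℕ) (hM : 1 ≤ M) :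
    ∀ x y z : ℤ, x * Real.log α + y * Real.log (10:ℕ) + z * Real.log (aeval α GG / aeval α (HH 6 M)) = 0 →
      x = 0 ∧ y = 0 ∧ z = 0 := by
  have hden := nrm_den h.hk
  set dd := (nrm 6 (C (((6:ℕ):ℤ)+1) * X - C (2*((6:ℕ):ℤ)))).natAbs with hdd
  have hM0 : M ≠ 0 := by omega
  have e : dd = 1029685 := by norm_num at hden; omega
  have hp : Nat.Prime 205937 := by norm_num
  have := Fact.mk hp
  refine hind_of_val h 10 (by norm_num) GG (HH 6 M) (GG_pos h) (HH_pos h hM) 205937 hp (by norm_num) ?_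
  rw [nrm_GG h.hk, nrm_HH h.hk, ← hdd]
  have e0 : padicValNat 205937 (9^6*(6-1)*gk 6) = 0 := padicValNat.eq_zero_of_not_dvd (by decide)
  rw [e0]
  have e1 : dd ≠ 0 := by omega
  have e2 : padicValNat 205937 dd ≠ 0 := by
    rw [Ne, padicValNat.eq_zero_iff]
    push Not
    exact ⟨by norm_num, e1, ⟨5, e⟩⟩
  rw [padicValNat.mul (pow_ne_zero _ hM0) e1]
  omega

/-- independence, k at least 3 -/
lemma ind_ge3 {k : ℕ} {α : ℝ} (h : IsAlpha k α) (hk3 : 3 ≤ k) (hk : k ≤ 470) (M : ℕ) (hM : 1 ≤ M) :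
    ∀ x y z : ℤ, x * Real.log α + y * Real.log (10:ℕ) + z * Real.log (aeval α GG / aeval α (HH k M)) = 0 →
      x = 0 ∧ y = 0 ∧ z = 0 := by
  have hc := indCheck_all k (by simp; omega)
  have hden := nrm_den h.hk
  have hdn := den_nrm_ne h
  set dd := (nrm k (C ((k:ℤ)+1) * X - C (2*(k:ℤ)))).natAbs with hdd
  have hM0 : M ≠ 0 := by omega
  have h8 : 2^4 ≤ 2^(k+1) := Nat.pow_le_pow_right (by norm_num) (by omega)
  have hg0 : gk k ≠ 0 := by unfold gk; omega
  simp only [indCheck, Bool.or_eq_true, beq_iff_eq, bne_iff_ne] at hc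
  by_cases hk6 : k = 6
  · subst hk6; exact ind_6 h M hM
  · have hs : sqm (gk k) 9 (yk k) ≠ 0 := hc.resolve_left hk6
    rw [sqm_eq] at hs
    have hy0 : yk k ≠ 0 := by
      unfold yk
      rw [← hden]
      have : k - 1 ≠ 0 := by omega
      positivity
    obtain ⟨p, hp, hpg, hpy⟩ := exists_prime_of_not_dvd (gk k) (yk k) (2^9) hg0 hy0 (by
      unfold gk
      have : 2^(k+1) ≤ 2^(2^9+1) := Nat.pow_le_pow_right (by norm_num) (by omega)
      omega) (fun hd => hs (Nat.mod_eq_zero_of_dvd hd))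
    have := Fact.mk hp
    have hp2 : p ≠ 2 := by
      rintro rfl
      unfold gk at hpg
      have : 2 ∣ 2^(k+1) := dvd_pow_self _ (by omega)
      omega
    have hp3 : p ≠ 3 := by
      rintro rfl
      unfold gk at hpg
      have : 3 ∣ 2^(k+1) := by omega
      have := Nat.Prime.dvd_of_dvd_pow Nat.prime_three this
      omega
    have hpy2 : ¬ p ∣ 5 ∧ ¬ p ∣ (k-1) ∧ ¬ p ∣ dd := by
      unfold yk at hpy
      rw [← hden] at hpy
      refine ⟨fun hd => hpy ?_, fun hd => hpy ?_, fun hd => hpy ?_⟩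
      · exact Dvd.dvd.mul_right (Dvd.dvd.mul_right hd _) _
      · exact Dvd.dvd.mul_right (Dvd.dvd.mul_left hd _) _
      · exact Dvd.dvd.mul_left (Dvd.dvd.mul_left hd _) _
    obtain ⟨hp5, hpk, hpd⟩ := hpy2
    have hp10 : ¬ p ∣ 10 := by
      intro hd
      rw [show 10 = 2 * 5 by norm_num, hp.dvd_mul] at hd
      rcases hd with hd | hd
      · exact hp2 ((Nat.prime_dvd_prime_iff_eq hp Nat.prime_two).mp hd)
      · exact hp5 hd
    have hp4 : 4 ≤ p := by
      have := hp.two_le; omega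
    refine hind_of_val h 10 (by norm_num) GG (HH k M) (GG_pos h) (HH_pos h hM) p hp hp10 ?_
    rw [nrm_GG h.hk, nrm_HH h.hk, ← hdd]
    have hk1 : k - 1 ≠ 0 := by omega
    rw [padicValNat.mul (by positivity) hg0, padicValNat.mul (by positivity) hk1, padicValNat.mul (by positivity) hdn,
      padicValNat.eq_zero_of_not_dvd hpk, padicValNat.eq_zero_of_not_dvd hpd, padicValNat.pow, padicValNat.pow]
    have v1 : padicValNat p (gk k) ≠ 0 := by
      rw [Ne, padicValNat.eq_zero_iff]; push Not; exact ⟨hp.one_lt.ne', hg0, hpg⟩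
    have v2 : padicValNat p (gk k) < k := by
      have e1 : p ^ padicValNat p (gk k) ∣ gk k := pow_padicValNat_dvd
      have e2 := Nat.le_of_dvd (by omega) e1
      have e3 : 4 ^ padicValNat p (gk k) ≤ p ^ padicValNat p (gk k) := Nat.pow_le_pow_left hp4 _
      have e4 : 4 ^ padicValNat p (gk k) < 2^(k+1) := by unfold gk at *; omega
      rw [show 4 = 2^2 by norm_num, ← pow_mul] at e4
      have := (Nat.pow_lt_pow_iff_right (by norm_num : 1 < 2)).mp e4
      omega
    intro he
    have : k ∣ padicValNat p (gk k) := by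
      have : padicValNat p (gk k) = k * padicValNat p M - k * padicValNat p 9 := by omega
      rw [this, ← Nat.mul_sub]
      exact dvd_mul_right _ _
    have := Nat.le_of_dvd (by omega) this
    omega

/-- independence, k = 2 -/
lemma ind_2 {α : ℝ} (h : IsAlpha 2 α) (M : ℕ) (hM : 1 ≤ M) (p : ℕ) (hp : p.Prime) (hp2 : p ≠ 2) (hp5 : p ≠ 5)
    (hv : padicValNat p 9 ≠ padicValNat p M) :
    ∀ x y z : ℤ, x * Real.log α + y * Real.log (10:ℕ) + z * Real.log (aeval α GG / aeval α (HH 2 M)) = 0 →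
      x = 0 ∧ y = 0 ∧ z = 0 := by
  have hden := nrm_den h.hk
  set dd := (nrm 2 (C (((2:ℕ):ℤ)+1) * X - C (2*((2:ℕ):ℤ)))).natAbs with hdd
  have e : dd = 5 := by norm_num at hden; omega
  have := Fact.mk hp
  have h5 : ¬ p ∣ 5 := fun hd => hp5 ((Nat.prime_dvd_prime_iff_eq hp Nat.prime_five).mp hd)
  have hp10 : ¬ p ∣ 10 := by
    intro hd
    rw [show 10 = 2 * 5 by norm_num, hp.dvd_mul] at hd
    rcases hd with hd | hd
    · exact hp2 ((Nat.prime_dvd_prime_iff_eq hp Nat.prime_two).mp hd)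
    · exact h5 hd
  refine hind_of_val h 10 (by norm_num) GG (HH 2 M) (GG_pos h) (HH_pos h hM) p hp hp10 ?_
  rw [nrm_GG h.hk, nrm_HH h.hk, ← hdd, e, show gk 2 = 5 by rfl]
  rw [padicValNat.mul (by norm_num) (by norm_num), padicValNat.mul (by norm_num) (by norm_num),
    padicValNat.mul (by positivity) (by norm_num), padicValNat.eq_zero_of_not_dvd h5, padicValNat.pow, padicValNat.pow]
  simp
  exact hv

/-- independence for the pure power case -/
lemma ind_52 {α : ℝ} (h : IsAlpha 2 α) :
    ∀ x y z : ℤ, x * Real.log α + y * Real.log (5:ℕ) + z * Real.log (aeval α (C 2 : ℤ[X]) / aeval α (1:ℤ[X])) = 0 →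
      x = 0 ∧ y = 0 ∧ z = 0 := by
  refine hind_of_val h 5 (by norm_num) (C 2) 1 (by rw [aeval_C]; norm_num) (by simp) 2 Nat.prime_two (by norm_num) ?_
  have : (1:ℤ[X]) = C 1 := by simp
  rw [this, nrm_C (by norm_num), nrm_C (by norm_num)]
  have := Fact.mk Nat.prime_two
  have e : ((2:ℤ)^2).natAbs = 2^2 := by norm_num
  rw [e, padicValNat.prime_pow]
  simp

/-- a prime away from 10 -/
lemma exists_prime_not_10 (n : ℕ) (h16 : ¬ 16 ∣ n) (h25 : ¬ 25 ∣ n) (h40 : 40 < n) :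
    ∃ p, p.Prime ∧ p ≠ 2 ∧ p ≠ 5 ∧ p ∣ n := by
  obtain ⟨i, m, hm, rfl⟩ := Nat.exists_eq_pow_mul_and_not_dvd (show n ≠ 0 by omega) 2 (by norm_num)
  have hm0 : m ≠ 0 := by rintro rfl; simp at hm
  obtain ⟨j, t, ht, rfl⟩ := Nat.exists_eq_pow_mul_and_not_dvd hm0 5 (by norm_num)
  have hi : i < 4 := by
    by_contra hi
    apply h16
    have : 2^4 ∣ 2^i := pow_dvd_pow _ (by omega)
    exact Dvd.dvd.mul_right (by simpa using this) _
  have hj : j < 2 := by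
    by_contra hj
    apply h25
    have : 5^2 ∣ 5^j := pow_dvd_pow _ (by omega)
    exact Dvd.dvd.mul_left (Dvd.dvd.mul_right (by simpa using this) _) _
  have ht1 : t ≠ 1 := by
    rintro rfl
    have a1 : 2^i ≤ 2^3 := Nat.pow_le_pow_right (by norm_num) (by omega)
    have a2 : 5^j ≤ 5^1 := Nat.pow_le_pow_right (by norm_num) (by omega)
    have := Nat.mul_le_mul a1 a2
    simp at h40
    omega
  refine ⟨t.minFac, Nat.minFac_prime ht1, ?_, ?_, ?_⟩
  · intro h2
    apply hm
    rw [← h2]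
    exact Dvd.dvd.mul_left (Nat.minFac_dvd t) _
  · intro h5
    apply ht
    rw [← h5]
    exact Nat.minFac_dvd t
  · exact Dvd.dvd.mul_left (Dvd.dvd.mul_left (Nat.minFac_dvd t) _) _
end


infixl:65 " ⊹ " => Nat.add
infixl:65 " ⊖ " => Nat.sub
infixl:70 " ⊠ " => Nat.mul
infixl:70 " ⊘ " => Nat.div
infixl:70 " ⊛ " => Nat.mod
infixr:75 " ⋏ " => Nat.pow

/-- evaluate the first argument before passing it on -/
def force {β : Type} (x : ℕ) (f : ℕ → β) : β := Nat.rec (f 0) (fun n _ => f (Nat.succ n)) x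

/-- partial Euclidean algorithm -/
def cfa (thr f : ℕ) : ℕ → ℕ → ℕ :=
  Nat.rec (fun _ y => y) (fun _ ih x y =>
    Nat.rec (x ⊛ y) (fun _ _ => force (x ⊛ y) fun u => force (y ⊛ u) fun v => force (u ⊛ v) fun w =>
      force (v ⊛ w) fun z => ih w z) (y ⊖ thr)) f

/-- denominators of convergents -/
def cfl (bd T La : ℕ) : ℕ :=
  force T fun T =>
  force (bd ⊠ 2 ⋏ 100) fun S =>
  force (((T ⊹ La) ⊛ 2 ⋏ 64) ⊠ 2 ⊹ 1) fun G =>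
  force (T ⊠ S ⊠ G) fun x =>
  force (x ⊘ bd) fun thr =>
  force (cfa thr 3000 x ((La ⊠ S ⊹ 1) ⊠ G)) fun y =>
  force ((y ⊘ G) ⊛ S) fun q => bif Nat.ble (q ⊠ 2) S then q else S ⊖ q

/-- scaled value of `-log (1 - X / 2 ^ P)`; `S = 2 ^ P` -/
def serL (P S X j : ℕ) : ℕ → ℕ :=
  Nat.rec (fun h => Nat.shiftRight (X ⊠ h) P)
    (fun j ih h => force (S ⊘ Nat.succ j ⊹ Nat.shiftRight (X ⊠ h) P) ih) j

def tpow (P S B f : ℕ) : ℕ → ℕ :=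
  Nat.rec (fun _ => S) (fun _ ih k => Nat.rec S (fun _ _ =>
      force (ih (k ⊘ 2)) fun u => force (Nat.shiftRight (u ⊠ u) P) fun v =>
        Nat.rec v (fun _ _ => Nat.shiftRight (v ⊠ B) P) (k ⊛ 2)) k) f

def newt (P S k f : ℕ) : ℕ → ℕ :=
  Nat.rec (fun X => X) (fun _ ih X => force (tpow P S (S ⊖ X) 10 k) fun u =>
      force (X ⊹ (S ⊠ S ⊖ 2 ⋏ Nat.succ k ⊠ X ⊠ u) ⊠ (S ⊖ X) ⊘
        (2 ⋏ Nat.succ k ⊠ u ⊠ (S ⊖ Nat.succ k ⊠ X))) ih) f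

def getX (P k : ℕ) : ℕ :=
  force (P ⊹ 32) fun P' =>
  Nat.succ (Nat.shiftRight (newt P' (2 ⋏ P') k (bif Nat.ble 40 k then 7 else 13) (2 ⋏ (P ⊹ 31 ⊖ k))) 32)

def dst (r T : ℕ) : ℕ := force (r ⊛ T) fun s => bif Nat.ble s (T ⊖ s) then s else T ⊖ s

/-- logs of 2 3 5 7 -/
def lg (P : ℕ) (f : ℕ → ℕ → ℕ → ℕ → ℕ → Bool) : Bool :=
  force (2 ⋏ P) fun S =>
  force (serL P S (S ⊘ 4) P 0) fun s4 =>
  force (2 ⊠ s4 ⊹ serL P S (S ⊘ 9) P 0) fun L2 =>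
  force (2 ⊠ L2 ⊖ s4) fun L3 =>
  force (2 ⊠ L2 ⊹ serL P S (S ⊘ 5) P 0) fun L5 =>
  force (3 ⊠ L2 ⊖ serL P S (S ⊘ 8) P 0) fun L7 => f S L2 L3 L5 L7

/-- scaled log of a digit -/
def lga (L2 L3 L5 L7 : ℕ) (a : ℕ) : ℕ :=
  bif Nat.beq a 1 then 0 else
  bif Nat.beq a 2 then L2 else
  bif Nat.beq a 3 then L3 else
  bif Nat.beq a 4 then 2 ⊠ L2 else
  bif Nat.beq a 5 then L5 else
  bif Nat.beq a 6 then L2 ⊹ L3 else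
  bif Nat.beq a 7 then L7 else
  bif Nat.beq a 8 then 3 ⊠ L2 else 2 ⊠ L3

/-- data for `k`: passes `La`, `U` (approximations of log α, log 9C + log 10) -/
def dat (P S k L2 L3 L5 : ℕ) (f : ℕ → ℕ → Bool) : Bool :=
  force (getX P k) fun X =>
  force (S ⊖ X) fun B =>
  force (6 ⊠ B ⊠ (2 ⊠ Nat.succ k ⊠ B ⊖ 2 ⊠ k ⊠ S) ⊠ S ⊘
    (4 ⊠ (2 ⊠ B ⊖ S) ⊠ (4 ⊠ B ⊖ S))) fun Y =>
  force (S ⊖ Y) fun V =>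
  force (Nat.succ (k ⊖ 10)) fun m =>
  force (2 ⋏ (P ⊠ Nat.succ k)) fun W =>
  Nat.ble W (2 ⋏ Nat.succ k ⊠ B ⋏ k ⊠ X) &&
  (Nat.ble (2 ⋏ Nat.succ k ⊠ (Nat.succ B) ⋏ k ⊠ (X ⊖ 1)) W &&
  (Nat.ble (k ⊠ S) (Nat.succ k ⊠ B) &&
  (Nat.ble X (2 ⋏ (P ⊖ k)) &&
  (Nat.ble Y S &&
  (Nat.ble V (2 ⋏ (P ⊖ m)) && (Nat.ble 1 X &&
  (force (L2 ⊖ serL P S X (Nat.succ (P ⊘ k)) 0) fun La =>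
   force (L5 ⊹ 3 ⊠ L3 ⊖ L2 ⊹ serL P S V (Nat.succ (P ⊘ m)) 0) fun U => f La U)))))))

/-- all `i < n` -/
def allb (f : ℕ → Bool) (n : ℕ) : Bool :=
  Nat.rec true (fun i ih => f i && ih) n

/-- reduction test -/
def tst (S N E q La T U : ℕ) : Bool :=
  force (N ⊠ dst (q ⊠ La) T ⊹ q ⊠ ((2 ⊠ N ⊹ 1) ⊠ 8192 ⊹ S ⊠ 216 ⊘ 10 ⋏ E ⊹ 1)) fun M =>
  Nat.ble (Nat.succ M) (dst (q ⊠ U) T)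

def chkC (S N Q E na : ℕ) (L2 L3 L5 L7 La U : ℕ) : Bool :=
  force (L2 ⊹ L5) fun T =>
  force (cfl Q T La) fun q =>
  allb (fun a => tst S N E q La T (U ⊖ lga L2 L3 L5 L7 (Nat.succ a))) na

/-- packing -/
def pk (g : ℕ → ℕ) (n : ℕ) : ℕ :=
  Nat.rec 0 (fun n ih => force (Nat.shiftLeft ih 1024 ⊹ g n) fun v => v) n

/-- the slot values -/
def slot (FS F T a b i : ℕ) : ℕ :=
  force (a ⊠ 10 ⋏ (65 ⊹ i)) fun v =>
  bif Nat.ble a b then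
    F ⊖ FS ⊠ (9 ⊠ (b ⊖ a)) ⊠ (2 ⊠ v ⊖ 9 ⊠ (b ⊖ a)) ⊘ (2 ⊠ v ⊠ v ⊠ T)
  else
    F ⊹ FS ⊠ (9 ⊠ (a ⊖ b)) ⊠ (2 ⊠ v ⊹ 9 ⊠ (a ⊖ b)) ⊘ (2 ⊠ v ⊠ v ⊠ T)

def mkL (V : ℕ → ℕ) (f : List ℕ → Bool) (n : ℕ) : List ℕ → Bool :=
  Nat.rec f (fun n ih l => force (V n) fun v => ih (v :: l)) n

def one (q c ones m1 m2 m3 V : ℕ) : Bool :=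
  Nat.beq (Nat.land (Nat.land (q ⊠ V ⊹ c ⊠ ones) m1 ⊹ m2) m3) m3

def chkl (h : ℕ → ℕ → Bool) (l : List ℕ) : ℕ → Bool :=
  List.rec (fun _ => true) (fun v _ ih j => h j v && ih (Nat.succ j)) l

def chkB (S F N N' na : ℕ) (L2 L3 L5 L7 La U : ℕ) (ones m1 m2 m3 : ℕ) (l : List ℕ) (j0 : ℕ) : Bool :=
  force (L2 ⊹ L5) fun T =>
  force (cfl (2 ⋏ 466) T La) fun q =>
  force (cfl (2 ⋏ 60) T La) fun qA =>
  allb (fun a => tst S N 160 q La T (U ⊖ lga L2 L3 L5 L7 (Nat.succ a))) na &&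
  (allb (fun a => tst S N' 65 qA La T (U ⊖ lga L2 L3 L5 L7 (Nat.succ a))) na &&
  (Nat.ble q (2 ⋏ 486) &&
  (Nat.ble (q ⊠ (S ⊠ 108 ⊘ 10 ⋏ 160 ⊹ 1) ⊹ N ⊠ (dst (q ⊠ La) T ⊹ 2 ⊠ q ⊠ 8192)) (S ⊘ 2 ⋏ 35) &&
  chkl (fun j V => force ((q ⊠ ((U ⊖ lga L2 L3 L5 L7 (Nat.succ (j ⊘ 10))) ⊠ F ⊘ T)) ⊛ F ⊹ 2 ⋏ 496)
    fun c => one q c ones m1 m2 m3 V) l j0)))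

def runB (P ne j0 nj na k0 nk : ℕ) : Bool :=
  lg P fun S L2 L3 L5 L7 =>
  force (L2 ⊹ L5) fun T =>
  force (2 ⋏ 530) fun F =>
  force (F ⊠ S) fun FS =>
  force (2 ⋏ 425) fun N =>
  force (2 ⋏ 20) fun N' =>
  force (pk (fun _ => 1) ne) fun ones =>
  force ((F ⊖ 1) ⊠ ones) fun m1 =>
  force ((F ⊖ 2 ⋏ 497) ⊠ ones) fun m2 =>
  force (F ⊠ ones) fun m3 =>
  mkL (fun j => pk (slot FS F T (Nat.succ ((j0 ⊹ j) ⊘ 10)) ((j0 ⊹ j) ⊛ 10)) ne)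
    (fun l => allb (fun k => dat P S (k0 ⊹ k) L2 L3 L5 fun La U =>
        chkB S F N N' na L2 L3 L5 L7 La U ones m1 m2 m3 l j0) nk) nj []

def runC (P na k0 nk : ℕ) : Bool :=
  force (2 ⋏ 1601) fun N => force (2 ⋏ 1640) fun Q =>
  lg P fun S L2 L3 L5 L7 => allb (fun k => dat P S (k0 ⊹ k) L2 L3 L5 fun La U =>
    chkC S N Q 512 na L2 L3 L5 L7 La U) nk

/-- the case `k = 2`, `a = 9` -/
def tst9 (S N E La T : ℕ) : Bool :=
  force (cfl (2 ⊠ N) T La) fun q =>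
  force ((q ⊠ La ⊹ T ⊘ 2) ⊘ T) fun p =>
  force ((q ⊠ La ⊖ p ⊠ T) ⊹ (p ⊠ T ⊖ q ⊠ La)) fun rp =>
  Nat.beq (Nat.gcd q p) 1 && (Nat.ble (Nat.succ N) q &&
  Nat.ble (N ⊠ rp ⊹ q ⊠ ((2 ⊠ N ⊹ 1) ⊠ 8192 ⊹ S ⊠ 216 ⊘ 10 ⋏ E ⊹ 1) ⊹ 1) T)

def run9 (P N E : ℕ) : Bool :=
  lg P fun S L2 L3 L5 _ => force (L2 ⊹ L5) fun T => dat P S 2 L2 L3 L5 fun La _ =>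
    force N fun N => tst9 S N E La T


theorem force_eq {β : Type} (x : ℕ) (f : ℕ → β) : force x f = f x := by
  cases x <;> rfl

theorem serL_zero (P S X h : ℕ) : serL P S X 0 h = X * h / 2 ^ P := by
  show Nat.shiftRight (X * h) P = _
  exact Nat.shiftRight_eq_div_pow _ _

theorem serL_succ (P S X j h : ℕ) :
    serL P S X (j + 1) h = serL P S X j (S / (j + 1) + X * h / 2 ^ P) := by
  show force (S / (j + 1) + Nat.shiftRight (X * h) P) (serL P S X j) = _
  rw [force_eq]
  congr 2
  exact Nat.shiftRight_eq_div_pow _ _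

theorem fl_bd (a b : ℕ) (hb : 0 < b) : (a:ℝ) / b - 1 ≤ ((a / b : ℕ) : ℝ) ∧ ((a / b : ℕ) : ℝ) ≤ (a:ℝ) / b := by
  refine ⟨?_, Nat.cast_div_le⟩
  have h : a < (a / b + 1) * b := by
    have := Nat.lt_div_mul_add (a := a) hb
    nlinarith
  have hb' : (0:ℝ) < b := by exact_mod_cast hb
  have : (a:ℝ) < ((a / b : ℕ) + 1) * b := by exact_mod_cast h
  rw [sub_le_iff_le_add, div_le_iff₀ hb']
  exact this.le

theorem serL_bd (P X : ℕ) (hX : 2 * X ≤ 2 ^ P) (j : ℕ) : ∀ (h : ℕ) (η : ℝ),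
    (2:ℝ) ^ P * η - 4 ≤ h → (h:ℝ) ≤ 2 ^ P * η →
    (2:ℝ) ^ P * (∑ i ∈ Finset.range j, ((X:ℝ) / 2 ^ P) ^ (i + 1) / (i + 1) +
        ((X:ℝ) / 2 ^ P) ^ (j + 1) * η) - 4 ≤ serL P (2 ^ P) X j h ∧
    (serL P (2 ^ P) X j h : ℝ) ≤ 2 ^ P * (∑ i ∈ Finset.range j, ((X:ℝ) / 2 ^ P) ^ (i + 1) / (i + 1) +
        ((X:ℝ) / 2 ^ P) ^ (j + 1) * η) := by
  have hS : (0:ℝ) < 2 ^ P := by positivity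
  obtain ⟨x, hx⟩ : ∃ x : ℝ, (X:ℝ) / 2 ^ P = x := ⟨_, rfl⟩
  have hXx : (X:ℝ) = 2 ^ P * x := by rw [← hx]; field_simp
  have hx0 : 0 ≤ x := by rw [← hx]; positivity
  have hx1 : x ≤ 1 / 2 := by
    rw [← hx, div_le_iff₀ hS]
    have : (2:ℝ) * X ≤ 2 ^ P := by exact_mod_cast hX
    linarith
  rw [hx]
  have key : ∀ (h : ℕ) (η : ℝ), (2:ℝ) ^ P * η - 4 ≤ h → (h:ℝ) ≤ 2 ^ P * η →
      (2:ℝ) ^ P * (x * η) - 3 ≤ ((X * h / 2 ^ P : ℕ) : ℝ) ∧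
      ((X * h / 2 ^ P : ℕ) : ℝ) ≤ 2 ^ P * (x * η) := by
    intro h η h1 h2
    obtain ⟨e1, e2⟩ := fl_bd (X * h) (2 ^ P) (by positivity)
    have e3 : (((X * h : ℕ) : ℝ) / ((2 ^ P : ℕ) : ℝ)) = x * h := by
      push_cast; rw [hXx]; field_simp
    rw [e3] at e1 e2
    constructor <;> nlinarith
  induction j with
  | zero =>
    intro h η h1 h2
    obtain ⟨a1, a2⟩ := key h η h1 h2
    rw [serL_zero]
    simp only [Finset.range_zero, Finset.sum_empty, zero_add, pow_one]
    constructor <;> linarith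
  | succ j ih =>
    intro h η h1 h2
    obtain ⟨a1, a2⟩ := key h η h1 h2
    rw [serL_succ]
    obtain ⟨e1, e2⟩ := fl_bd (2 ^ P) (j + 1) (by positivity)
    push_cast at e1 e2
    have e4 : (2:ℝ) ^ P * (1 / ((j:ℝ) + 1) + x * η) = 2 ^ P / ((j:ℝ) + 1) + 2 ^ P * (x * η) := by ring
    have := ih (2 ^ P / (j + 1) + X * h / 2 ^ P) (1 / ((j:ℝ) + 1) + x * η)
      (by push_cast; rw [e4]; push_cast at a1; linarith)
      (by push_cast; rw [e4]; push_cast at a2; linarith)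
    rw [Finset.sum_range_succ]
    have e5 : x ^ (j + 1) * (1 / ((j:ℝ) + 1) + x * η) =
      x ^ (j + 1) / ((j:ℝ) + 1) + x ^ (j + 1 + 1) * η := by ring
    rw [e5, ← add_assoc] at this
    exact this

theorem ser_spec (P X m f : ℕ) (hm : 1 ≤ m) (hmP : m ≤ P) (hX : X ≤ 2 ^ (P - m)) (hf : P ≤ f * m) :
    |(2:ℝ) ^ P * (-Real.log (1 - (X:ℝ) / 2 ^ P)) - serL P (2 ^ P) X f 0| ≤ 5 := by
  have hS : (0:ℝ) < 2 ^ P := by positivity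
  have hX2 : 2 * X ≤ 2 ^ P := by
    calc 2 * X ≤ 2 ^ 1 * 2 ^ (P - m) := by omega
      _ = 2 ^ (1 + (P - m)) := (pow_add _ _ _).symm
      _ ≤ 2 ^ P := Nat.pow_le_pow_right (by norm_num) (by omega)
  obtain ⟨a1, a2⟩ := serL_bd P X hX2 f 0 0 (by norm_num) (by norm_num)
  rw [mul_zero, add_zero] at a1 a2
  have hx0 : 0 ≤ (X:ℝ) / 2 ^ P := by positivity
  have hx1 : (X:ℝ) / 2 ^ P ≤ 1 / 2 := by
    rw [div_le_iff₀ hS]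
    have : (2:ℝ) * X ≤ 2 ^ P := by exact_mod_cast hX2
    linarith
  have hxm : (X:ℝ) / 2 ^ P ≤ (1 / 2) ^ m := by
    rw [div_le_iff₀ hS]
    have h1 : (X:ℝ) ≤ 2 ^ (P - m) := by exact_mod_cast hX
    have h2 : (2:ℝ) ^ P = 2 ^ (P - m) * 2 ^ m := by rw [← pow_add]; congr 1; omega
    rw [h2, one_div, inv_pow]
    field_simp
    exact h1
  obtain ⟨x, hx⟩ : ∃ x : ℝ, (X:ℝ) / 2 ^ P = x := ⟨_, rfl⟩
  rw [hx] at a1 a2 hx0 hx1 hxm ⊢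
  have t := Real.abs_log_sub_add_sum_range_le (x := x) (by rw [abs_of_nonneg hx0]; linarith) f
  rw [abs_of_nonneg hx0] at t
  have t2 : x ^ (f + 1) / (1 - x) ≤ (1 / 2) ^ P := by
    rw [div_le_iff₀ (by linarith)]
    have h1 : x ^ f ≤ (1 / 2) ^ P := by
      calc x ^ f ≤ ((1 / 2) ^ m) ^ f := pow_le_pow_left₀ hx0 hxm f
        _ = (1 / 2) ^ (f * m) := by rw [← pow_mul, mul_comm]
        _ ≤ (1 / 2) ^ P := pow_le_pow_of_le_one (by norm_num) (by norm_num) hf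
    have h2 : (0:ℝ) < (1 / 2) ^ P := by positivity
    rw [pow_succ]
    nlinarith [pow_nonneg hx0 f]
  have t3 : (2:ℝ) ^ P * (1 / 2) ^ P = 1 := by rw [← mul_pow]; norm_num
  have t4 := t.trans t2
  rw [abs_le] at t4 ⊢
  obtain ⟨b1, b2⟩ := t4
  have c1 := mul_le_mul_of_nonneg_left b1 hS.le
  have c2 := mul_le_mul_of_nonneg_left b2 hS.le
  constructor <;> nlinarith

theorem log_lip (u v c : ℝ) (hc : 0 < c) (hu : c ≤ u) (hv : c ≤ v) :
    |Real.log u - Real.log v| ≤ |u - v| / c := by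
  have key : ∀ u v : ℝ, c ≤ u → c ≤ v → Real.log u - Real.log v ≤ |u - v| / c := by
    intro u v hu hv
    have hu0 : 0 < u := by linarith
    have hv0 : 0 < v := by linarith
    rw [← Real.log_div hu0.ne' hv0.ne']
    have h1 := Real.log_le_sub_one_of_pos (div_pos hu0 hv0)
    have h2 : u / v - 1 = (u - v) / v := by field_simp
    rw [h2] at h1
    refine h1.trans ?_
    calc (u - v) / v ≤ |u - v| / v := by gcongr; exact le_abs_self _
      _ ≤ |u - v| / c := by gcongr
  rw [abs_le]
  refine ⟨?_, key u v hu hv⟩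
  have := key v u hv hu
  rw [abs_sub_comm] at this
  linarith

/-- approximate equality with scaled error -/
def Ap (S x X e : ℝ) : Prop := |S * x - X| ≤ e

theorem Ap.add {S x X e y Y f : ℝ} (h : Ap S x X e) (h' : Ap S y Y f) :
    Ap S (x + y) (X + Y) (e + f) := by
  unfold Ap at *; rw [abs_le] at *; constructor <;> linarith [h.1, h.2, h'.1, h'.2]

theorem Ap.sub {S x X e y Y f : ℝ} (h : Ap S x X e) (h' : Ap S y Y f) :
    Ap S (x - y) (X - Y) (e + f) := by
  unfold Ap at *; rw [abs_le] at *; constructor <;> linarith [h.1, h.2, h'.1, h'.2]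

theorem Ap.mul {S x X e c : ℝ} (h : Ap S x X e) (hc : 0 ≤ c) :
    Ap S (c * x) (c * X) (c * e) := by
  unfold Ap at *
  rw [show S * (c * x) - c * X = c * (S * x - X) by ring, abs_mul, abs_of_nonneg hc]
  exact mul_le_mul_of_nonneg_left h hc

theorem Ap.mono {S x X e y f : ℝ} (h : Ap S x X e) (hx : S * |x - y| ≤ f) (hS : 0 ≤ S) :
    Ap S y X (e + f) := by
  unfold Ap at *
  have : S * |x - y| = |S * x - S * y| := by rw [← mul_sub, abs_mul, abs_of_nonneg hS]
  rw [this] at hx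
  rw [abs_le] at *; constructor <;> linarith [h.1, h.2, hx.1, hx.2]

theorem Ap.le {S x X e f : ℝ} (h : Ap S x X e) (hf : e ≤ f) : Ap S x X f := le_trans h hf

theorem Ap.natsub {S x e y f : ℝ} {X Y : ℕ} (h : Ap S x X e) (h' : Ap S y Y f)
    (hp : e + f ≤ S * (x - y)) : Ap S (x - y) ((X - Y : ℕ) : ℝ) (e + f) := by
  have hle : Y ≤ X := by
    have : (Y:ℝ) ≤ X := by
      unfold Ap at *; rw [abs_le] at *; linarith [h.1, h.2, h'.1, h'.2]
    exact_mod_cast this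
  rw [Nat.cast_sub hle]
  exact h.sub h'

theorem ser_const (P r : ℕ) (hP : 1 ≤ P) (hr : 2 ≤ r) :
    Ap (2 ^ P) (-Real.log (1 - 1 / (r:ℝ))) (serL P (2 ^ P) (2 ^ P / r) P 0) 7 := by
  have hS : (0:ℝ) < 2 ^ P := by positivity
  have hX : 2 ^ P / r ≤ 2 ^ (P - 1) := by
    calc 2 ^ P / r ≤ 2 ^ P / 2 := Nat.div_le_div_left hr (by norm_num)
      _ = 2 ^ (P - 1) := by
        rw [show 2 ^ P = 2 ^ (P - 1) * 2 by rw [← pow_succ]; congr 1; omega]; simp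
  have h := ser_spec P (2 ^ P / r) 1 P le_rfl hP hX (by omega)
  have hr' : (2:ℝ) ≤ r := by exact_mod_cast hr
  obtain ⟨e1, e2⟩ := fl_bd (2 ^ P) r (by omega)
  push_cast at e1 e2
  have hX' : (((2 ^ P / r : ℕ)) : ℝ) ≤ 2 ^ (P - 1) := by exact_mod_cast hX
  have h2 : (2:ℝ) ^ P = 2 ^ (P - 1) * 2 := by rw [← pow_succ]; congr 1; omega
  have h1r : 1 / (r:ℝ) ≤ 1 / 2 := by gcongr
  have b1 : (((2 ^ P / r : ℕ)) : ℝ) / 2 ^ P ≤ 1 / 2 := by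
    rw [div_le_iff₀ hS]; linarith
  have b2 : |(1 - (((2 ^ P / r : ℕ)) : ℝ) / 2 ^ P) - (1 - 1 / (r:ℝ))| ≤ 1 / 2 ^ P := by
    have : (1 - (((2 ^ P / r : ℕ)) : ℝ) / 2 ^ P) - (1 - 1 / (r:ℝ)) =
      (2 ^ P / r - ((2 ^ P / r : ℕ) : ℝ)) / 2 ^ P := by field_simp; ring
    rw [this, abs_div, abs_of_pos hS]
    gcongr
    rw [abs_le]; push_cast; constructor <;> linarith
  have l := log_lip (1 - (((2 ^ P / r : ℕ)) : ℝ) / 2 ^ P) (1 - 1 / (r:ℝ)) (1 / 2) (by norm_num)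
    (by linarith) (by linarith)
  have h' : Ap (2 ^ P) (-Real.log (1 - (((2 ^ P / r : ℕ)) : ℝ) / 2 ^ P)) (serL P (2 ^ P) (2 ^ P / r) P 0) 5 := h
  refine (h'.mono (f := 2) ?_ hS.le).le (by norm_num)
  rw [show ∀ u v : ℝ, -u - -v = -(u - v) by intros; ring, abs_neg]
  calc (2:ℝ) ^ P * _ ≤ 2 ^ P * (1 / 2 ^ P / (1 / 2)) := by
        gcongr; exact l.trans (by gcongr)
    _ = 2 := by field_simp


theorem log_facts : (0.69:ℝ) ≤ Real.log 2 ∧ Real.log 2 ≤ 0.7 ∧ 1 ≤ Real.log 3 ∧ 1 ≤ Real.log 5 := by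
  have h1 := Real.log_two_gt_d9
  have h2 := Real.log_two_lt_d9
  have h3 : 1 ≤ Real.log 3 := by
    rw [Real.le_log_iff_exp_le (by norm_num)]
    have := Real.exp_one_lt_d9; linarith
  have h4 : Real.log 3 ≤ Real.log 5 := Real.log_le_log (by norm_num) (by norm_num)
  refine ⟨?_, ?_, ?_, ?_⟩ <;> norm_num at * <;> linarith

theorem lg_sound {P : ℕ} {f : ℕ → ℕ → ℕ → ℕ → ℕ → Bool} (hP : 16 ≤ P) (h : lg P f = true) :
    ∃ L2 L3 L5 L7 : ℕ, Ap (2 ^ P) (Real.log 2) L2 21 ∧ Ap (2 ^ P) (Real.log 3) L3 49 ∧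
      Ap (2 ^ P) (Real.log 5) L5 49 ∧ Ap (2 ^ P) (Real.log 7) L7 70 ∧ f (2 ^ P) L2 L3 L5 L7 = true := by
  unfold lg at h
  simp only [force_eq] at h
  have hS : (65536:ℝ) ≤ 2 ^ P := by
    calc (65536:ℝ) = 2 ^ 16 := by norm_num
      _ ≤ 2 ^ P := pow_le_pow_right₀ (by norm_num) hP
  obtain ⟨g1, g2, g3, g4⟩ := log_facts
  have s4 := ser_const P 4 (by omega) (by norm_num)
  have s9 := ser_const P 9 (by omega) (by norm_num)
  have s5 := ser_const P 5 (by omega) (by norm_num)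
  have s8 := ser_const P 8 (by omega) (by norm_num)
  have l4 : Real.log 4 = 2 * Real.log 2 := by
    rw [show (4:ℝ) = 2 ^ 2 by norm_num, Real.log_pow]; norm_num
  have l8 : Real.log 8 = 3 * Real.log 2 := by
    rw [show (8:ℝ) = 2 ^ 3 by norm_num, Real.log_pow]; norm_num
  have l9 : Real.log 9 = 2 * Real.log 3 := by
    rw [show (9:ℝ) = 3 ^ 2 by norm_num, Real.log_pow]; norm_num
  have e4 : -Real.log (1 - 1 / ((4:ℕ):ℝ)) = 2 * Real.log 2 - Real.log 3 := by
    rw [show (1 - 1 / ((4:ℕ):ℝ)) = 3 / 4 by norm_num, Real.log_div (by norm_num) (by norm_num), l4]; ring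
  have e9 : -Real.log (1 - 1 / ((9:ℕ):ℝ)) = 2 * Real.log 3 - 3 * Real.log 2 := by
    rw [show (1 - 1 / ((9:ℕ):ℝ)) = 8 / 9 by norm_num, Real.log_div (by norm_num) (by norm_num), l8, l9]; ring
  have e5 : -Real.log (1 - 1 / ((5:ℕ):ℝ)) = Real.log 5 - 2 * Real.log 2 := by
    rw [show (1 - 1 / ((5:ℕ):ℝ)) = 4 / 5 by norm_num, Real.log_div (by norm_num) (by norm_num), l4]; ring
  have e8 : -Real.log (1 - 1 / ((8:ℕ):ℝ)) = 3 * Real.log 2 - Real.log 7 := by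
    rw [show (1 - 1 / ((8:ℕ):ℝ)) = 7 / 8 by norm_num, Real.log_div (by norm_num) (by norm_num), l8]; ring
  rw [e4] at s4
  rw [e9] at s9
  rw [e5] at s5
  rw [e8] at s8
  have l7 : 1 ≤ Real.log 7 := g4.trans (Real.log_le_log (by norm_num) (by norm_num))
  have A2 : Ap (2 ^ P) (Real.log 2)
    ((2 * serL P (2 ^ P) (2 ^ P / 4) P 0 + serL P (2 ^ P) (2 ^ P / 9) P 0 : ℕ) : ℝ) 21 := by
    have := (s4.mul (c := 2) (by norm_num)).add s9
    push_cast
    convert this using 1 <;> ring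
  obtain ⟨L2, hL2⟩ : ∃ L2 : ℕ, 2 * serL P (2 ^ P) (2 ^ P / 4) P 0 + serL P (2 ^ P) (2 ^ P / 9) P 0 = L2 := ⟨_, rfl⟩
  rw [hL2] at A2
  have D2 : Ap (2 ^ P) (2 * Real.log 2) ((2 * L2 : ℕ) : ℝ) 42 := by
    push_cast; exact (A2.mul (c := 2) (by norm_num)).le (by norm_num)
  have D3 : Ap (2 ^ P) (3 * Real.log 2) ((3 * L2 : ℕ) : ℝ) 63 := by
    push_cast; exact (A2.mul (c := 3) (by norm_num)).le (by norm_num)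
  refine ⟨L2, 2 * L2 - serL P (2 ^ P) (2 ^ P / 4) P 0, 2 * L2 + serL P (2 ^ P) (2 ^ P / 5) P 0,
    3 * L2 - serL P (2 ^ P) (2 ^ P / 8) P 0, A2, ?_, ?_, ?_, ?_⟩
  · have := D2.natsub s4 (by nlinarith)
    convert this using 1 <;> ring
  · have := D2.add s5
    push_cast at this ⊢
    convert this using 1 <;> ring
  · have := D3.natsub s8 (by nlinarith)
    convert this using 1 <;> ring
  · rw [← hL2]; exact h

theorem lga_sound {S : ℝ} {L2 L3 L5 L7 : ℕ} (h2 : Ap S (Real.log 2) L2 21) (h3 : Ap S (Real.log 3) L3 49)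
    (h5 : Ap S (Real.log 5) L5 49) (h7 : Ap S (Real.log 7) L7 70) (a : ℕ) (ha : 1 ≤ a) (ha9 : a ≤ 9) :
    Ap S (Real.log a) (lga L2 L3 L5 L7 a) 98 := by
  interval_cases a
  · show Ap S _ ((0:ℕ):ℝ) _
    simp [Ap]
  · exact h2.le (by norm_num)
  · exact h3.le (by norm_num)
  · show Ap S _ ((2 * L2 : ℕ):ℝ) _
    rw [show ((4:ℕ):ℝ) = 2 ^ 2 by norm_num, Real.log_pow]
    push_cast
    exact (h2.mul (c := 2) (by norm_num)).le (by norm_num)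
  · exact h5.le (by norm_num)
  · show Ap S _ ((L2 + L3 : ℕ):ℝ) _
    rw [show ((6:ℕ):ℝ) = 2 * 3 by norm_num, Real.log_mul (by norm_num) (by norm_num)]
    push_cast
    exact (h2.add h3).le (by norm_num)
  · exact h7.le (by norm_num)
  · show Ap S _ ((3 * L2 : ℕ):ℝ) _
    rw [show ((8:ℕ):ℝ) = 2 ^ 3 by norm_num, Real.log_pow]
    push_cast
    exact (h2.mul (c := 3) (by norm_num)).le (by norm_num)
  · show Ap S _ ((2 * L3 : ℕ):ℝ) _
    rw [show ((9:ℕ):ℝ) = 3 ^ 2 by norm_num, Real.log_pow]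
    push_cast
    exact (h3.mul (c := 2) (by norm_num)).le (by norm_num)

theorem f_anti (k : ℕ) (u v : ℝ) (hu : 2 * k ≤ (k + 1) * u) (huv : u < v) (hu2 : u < 2) (hk : 1 ≤ k) :
    v ^ k * (2 - v) < u ^ k * (2 - u) := by
  have hk' : (1:ℝ) ≤ k := by exact_mod_cast hk
  have hu0 : 0 < u := by
    by_contra h
    push Not at h
    nlinarith
  have hv0 : 0 < v := by linarith
  have hb := one_add_mul_le_pow (a := u / v - 1) (by have := div_pos hu0 hv0; linarith) k
  rw [add_sub_cancel] at hb
  have hvk : 0 < v ^ k := pow_pos hv0 k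
  rw [div_pow] at hb
  have h1 : v ^ k * (1 + k * (u / v - 1)) ≤ u ^ k := by
    calc _ ≤ v ^ k * (u ^ k / v ^ k) := by gcongr
      _ = u ^ k := by field_simp
  have h2 : (2 - v) < (1 + k * (u / v - 1)) * (2 - u) := by
    have h3 : (1 + k * (u / v - 1)) * (2 - u) - (2 - v) = (v - u) * (v - k * (2 - u)) / v := by
      field_simp; ring
    have h4 : 0 < (v - u) * (v - k * (2 - u)) / v := by
      apply div_pos (mul_pos (by linarith) _) hv0
      nlinarith
    linarith
  calc v ^ k * (2 - v) < v ^ k * ((1 + k * (u / v - 1)) * (2 - u)) := by gcongr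
    _ = v ^ k * (1 + k * (u / v - 1)) * (2 - u) := by ring
    _ ≤ u ^ k * (2 - u) := by gcongr


theorem alpha_brk {S B X k : ℕ} {α z : ℝ} (hα : IsAlpha k α) (hk : 2 ≤ k) (hS0 : (0:ℝ) < S)
    (c1 : S ^ (k + 1) ≤ 2 ^ (k + 1) * B ^ k * X)
    (c2 : 2 ^ (k + 1) * (B + 1) ^ k * (X - 1) ≤ S ^ (k + 1)) (c7 : 1 ≤ X)
    (hBz : (B:ℝ) = S * z / 2) (hXr : (X:ℝ) = S * (2 - z) / 2) (hzlow : 2 * k ≤ (k + 1) * z) :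
    |z - α| ≤ 2 / S := by
  have hden := hα.den_pos
  have hk1 : 1 ≤ k := by omega
  have hSk : (0:ℝ) < (S:ℝ) ^ (k + 1) := by positivity
  have h2S : (0:ℝ) < 2 / S := by positivity
  have hzα : z ≤ α := by
    by_contra hlt
    push Not at hlt
    have h1 := f_anti k α z (by linarith only [hden]) hlt hα.h2 hk1
    rw [hα.h3] at h1
    have h2 : ((S:ℝ)) ^ (k + 1) ≤ 2 ^ (k + 1) * B ^ k * X := by exact_mod_cast c1
    rw [hXr, hBz] at h2
    have h3 : (2:ℝ) ^ (k + 1) * (S * z / 2) ^ k * (S * (2 - z) / 2) = S ^ (k + 1) * (z ^ k * (2 - z)) := by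
      rw [div_pow, mul_pow]; field_simp; ring
    rw [h3] at h2
    have h4 := mul_lt_mul_of_pos_left h1 hSk
    linarith only [h2, h4]
  have hαz : α ≤ z + 2 / S := by
    by_contra hlt
    push Not at hlt
    have hz' : 2 * (k:ℝ) ≤ (k + 1) * (z + 2 / S) := by
      have : 0 ≤ ((k:ℝ) + 1) * (2 / S) := by positivity
      linarith only [this, hzlow]
    have h1 := f_anti k (z + 2 / S) α hz' hlt (by linarith only [hα.h2, hlt]) hk1
    rw [hα.h3] at h1
    have h2 : (2:ℝ) ^ (k + 1) * (B + 1) ^ k * ((X - 1 : ℕ) : ℝ) ≤ (S:ℝ) ^ (k + 1) := by exact_mod_cast c2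
    rw [Nat.cast_sub c7, hXr, hBz] at h2
    have h3 : (2:ℝ) ^ (k + 1) * (S * z / 2 + 1) ^ k * (S * (2 - z) / 2 - (1:ℕ)) =
        S ^ (k + 1) * ((z + 2 / S) ^ k * (2 - (z + 2 / S))) := by
      rw [show (S:ℝ) * z / 2 + 1 = (S / 2) * (z + 2 / S) by field_simp,
        show (S:ℝ) * (2 - z) / 2 - (1:ℕ) = (S / 2) * (2 - (z + 2 / S)) by push_cast; field_simp; ring,
        mul_pow, div_pow]
      field_simp
      ring
    rw [h3] at h2
    have h4 := mul_lt_mul_of_pos_left h1 hSk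
    linarith only [h2, h4]
  rw [abs_le]; constructor <;> linarith only [hzα, hαz, h2S]

theorem lip2 {S : ℝ} (u v c r : ℝ) (hc : 0 < c) (hu : c ≤ u) (hv : c ≤ v) (hr : |u - v| ≤ r * (2 / S)) :
    |Real.log u - Real.log v| ≤ 2 * r / c / S := by
  refine (log_lip u v c hc hu hv).trans ?_
  calc |u - v| / c ≤ r * (2 / S) / c := by gcongr
    _ = _ := by ring

theorem logC_lip {k : ℕ} {S α z D r : ℝ} (hα : IsAlpha k α) (hk : k ≤ 470) (hS : 65536 ≤ S)
    (hdz : |z - α| ≤ 2 / S) (hz : 4 / 3 ≤ z) (hD : D = (k + 1) * z - 2 * k) 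
    (hr : r = 3 * z * D / (4 * (z - 1) * (2 * z - 1))) (hD4 : 1 / 4 ≤ D)
    (hDz : |D - ((k + 1) * α - 2 * k)| ≤ (k + 1) * (2 / S)) :
    |Real.log 5 + 3 * Real.log 3 - Real.log 2 + -Real.log r - (Real.log (9 * Cc k α) + Real.log 10)|
      ≤ 3780 / S := by
  have hα85 := hα.ge
  have hden := hα.den_pos
  have hS0 : 0 < S := by linarith only [hS]
  have hkr' : (k:ℝ) ≤ 470 := by exact_mod_cast hk
  have hz1 : 0 < z - 1 := by linarith only [hz]
  have hz21 : 0 < 2 * z - 1 := by linarith only [hz]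
  have hz0 : 0 < z := by linarith only [hz]
  have hD0 : 0 < D := by linarith only [hD4]
  have q1 := lip2 (S := S) (z - 1) (α - 1) (1 / 3) 1 (by norm_num) (by linarith only [hz]) (by linarith only [hα85])
    (by rw [show z - 1 - (α - 1) = z - α by ring]; linarith only [hdz])
  have q2 := lip2 (S := S) (2 * z - 1) (2 * α - 1) 1 2 (by norm_num) (by linarith only [hz]) (by linarith only [hα85])
    (by rw [show 2 * z - 1 - (2 * α - 1) = 2 * (z - α) by ring, abs_mul, abs_two]; linarith only [hdz])
  have q3 := lip2 (S := S) z α 1 1 (by norm_num) (by linarith only [hz]) (by linarith only [hα85]) (by linarith only [hdz])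
  have q4 := lip2 (S := S) D ((k + 1) * α - 2 * k) (1 / 4) (k + 1) (by norm_num) hD4 (by linarith only [hden]) hDz
  have w1 : Real.log r = Real.log 3 + Real.log z + Real.log D - (2 * Real.log 2 + Real.log (z - 1) + Real.log (2 * z - 1)) := by
    rw [hr, Real.log_div (by positivity) (by positivity), Real.log_mul (by positivity) (by positivity),
      Real.log_mul (by positivity) (by positivity), Real.log_mul (by positivity) (by positivity),
      Real.log_mul (by positivity) (by positivity), show (4:ℝ) = 2 ^ 2 by norm_num, Real.log_pow]
    norm_num
  have a1 : 0 < α - 1 := by linarith only [hα85]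
  have a2 : 0 < 2 * α - 1 := by linarith only [hα85]
  have a3 : 0 < α := by linarith only [hα85]
  have a4 : 0 < (k + 1) * α - 2 * k := by linarith only [hden]
  have w2 : Real.log (9 * Cc k α) = 2 * Real.log 3 + (Real.log (α - 1) + Real.log (2 * α - 1) -
      (Real.log α + Real.log ((k + 1) * α - 2 * k))) := by
    unfold Cc
    rw [Real.log_mul (by norm_num) (by positivity), Real.log_div (by positivity) (by positivity),
      Real.log_mul (by positivity) (by positivity), Real.log_mul (by positivity) (by positivity),
      show (9:ℝ) = 3 ^ 2 by norm_num, Real.log_pow]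
    norm_num
  have w3 : Real.log 10 = Real.log 2 + Real.log 5 := by
    rw [← Real.log_mul (by norm_num) (by norm_num)]; norm_num
  rw [w1, w2, w3]
  have fin : |Real.log (z - 1) - Real.log (α - 1) + (Real.log (2 * z - 1) - Real.log (2 * α - 1)) -
      (Real.log z - Real.log α) - (Real.log D - Real.log ((k + 1) * α - 2 * k))| ≤ 3780 / S := by
    refine (abs_sub _ _).trans ?_
    have t1 := abs_sub (Real.log (z - 1) - Real.log (α - 1) + (Real.log (2 * z - 1) - Real.log (2 * α - 1))) (Real.log z - Real.log α)
    have t2 := abs_add_le (Real.log (z - 1) - Real.log (α - 1)) (Real.log (2 * z - 1) - Real.log (2 * α - 1))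
    have t3 : (2 * 1 / (1 / 3) / S + 2 * 2 / 1 / S + 2 * 1 / 1 / S + 2 * (k + 1) / (1 / 4) / S : ℝ) ≤ 3780 / S := by
      rw [← add_div, ← add_div, ← add_div]
      gcongr
      linarith only [hkr']
    linarith only [t1, t2, t3, q1, q2, q3, q4]
  refine le_of_eq_of_le ?_ fin
  congr 1
  ring

theorem Y_bd {S B k Y : ℕ} {z D r : ℝ} (hS0 : (0:ℝ) < S) (hBz : (B:ℝ) = S * z / 2) (hz : 4 / 3 ≤ z)
    (c3 : k * S ≤ (k + 1) * B) (hD : D = (k + 1) * z - 2 * k)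
    (hr : r = 3 * z * D / (4 * (z - 1) * (2 * z - 1)))
    (hY : 6 * B * (2 * (k + 1) * B - 2 * k * S) * S / (4 * (2 * B - S) * (4 * B - S)) = Y) :
    S * r - 1 ≤ Y ∧ (Y:ℝ) ≤ S * r := by
  have hz1 : 0 < z - 1 := by linarith only [hz]
  have hz21 : 0 < 2 * z - 1 := by linarith only [hz]
  have n1 : 2 * k * S ≤ 2 * (k + 1) * B := by linarith only [c3]
  have n2 : S < 2 * B := by
    have : (S:ℝ) < 2 * B := by
      rw [hBz]
      have := mul_pos hS0 hz1
      linarith only [this]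
    exact_mod_cast this
  have := fl_bd (6 * B * (2 * (k + 1) * B - 2 * k * S) * S) (4 * (2 * B - S) * (4 * B - S))
    (by apply Nat.mul_pos (Nat.mul_pos (by norm_num) (by omega)) (by omega))
  rw [hY] at this
  have e : ((6 * B * (2 * (k + 1) * B - 2 * k * S) * S : ℕ) : ℝ) / ((4 * (2 * B - S) * (4 * B - S) : ℕ) : ℝ) = S * r := by
    push_cast [Nat.cast_sub n1, Nat.cast_sub n2.le, Nat.cast_sub (show S ≤ 4 * B by omega)]
    rw [hBz, hr, hD]
    rw [show 2 * ((S:ℝ) * z / 2) - S = S * (z - 1) by ring, show 4 * ((S:ℝ) * z / 2) - S = S * (2 * z - 1) by ring]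
    field_simp
    ring
  rw [e] at this
  exact this

set_option maxHeartbeats 4000000 in
theorem dat_sound {P k L2 L3 L5 : ℕ} {f : ℕ → ℕ → Bool} {α : ℝ} (hα : IsAlpha k α) (hk : k ≤ 470)
    (hP : 500 ≤ P) (h2 : Ap (2 ^ P) (Real.log 2) L2 21) (h3 : Ap (2 ^ P) (Real.log 3) L3 49)
    (h5 : Ap (2 ^ P) (Real.log 5) L5 49) (h : dat P (2 ^ P) k L2 L3 L5 f = true) :
    ∃ La U : ℕ, Ap (2 ^ P) (Real.log α) La 28 ∧
      Ap (2 ^ P) (Real.log (9 * Cc k α) + Real.log 10) U 4100 ∧ f La U = true := by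
  have hk2 := hα.hk
  unfold dat at h
  simp only [force_eq, Bool.and_eq_true, Nat.ble_eq] at h
  generalize getX P k = X at h
  obtain ⟨c1, c2, c3, c4, c5, c6, c7, hf⟩ := h
  change 2 ^ (P * (k + 1)) ≤ 2 ^ (k + 1) * (2 ^ P - X) ^ k * X at c1
  change 2 ^ (k + 1) * (2 ^ P - X + 1) ^ k * (X - 1) ≤ 2 ^ (P * (k + 1)) at c2
  change k * 2 ^ P ≤ (k + 1) * (2 ^ P - X) at c3
  change X ≤ 2 ^ (P - k) at c4
  change 6 * (2 ^ P - X) * (2 * (k + 1) * (2 ^ P - X) - 2 * k * 2 ^ P) * 2 ^ P /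
    (4 * (2 * (2 ^ P - X) - 2 ^ P) * (4 * (2 ^ P - X) - 2 ^ P)) ≤ 2 ^ P at c5
  change 2 ^ P - 6 * (2 ^ P - X) * (2 * (k + 1) * (2 ^ P - X) - 2 * k * 2 ^ P) * 2 ^ P /
    (4 * (2 * (2 ^ P - X) - 2 ^ P) * (4 * (2 ^ P - X) - 2 ^ P)) ≤ 2 ^ (P - (k - 10 + 1)) at c6
  change f (L2 - serL P (2 ^ P) X (P / k + 1) 0) (L5 + 3 * L3 - L2 + serL P (2 ^ P) (2 ^ P - 6 * (2 ^ P - X) * (2 * (k + 1) * (2 ^ P - X) - 2 * k * 2 ^ P) * 2 ^ P /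
    (4 * (2 * (2 ^ P - X) - 2 ^ P) * (4 * (2 ^ P - X) - 2 ^ P))) (P / (k - 10 + 1) + 1) 0) = true at hf
  generalize hY : 6 * (2 ^ P - X) * (2 * (k + 1) * (2 ^ P - X) - 2 * k * 2 ^ P) * 2 ^ P /
    (4 * (2 * (2 ^ P - X) - 2 ^ P) * (4 * (2 ^ P - X) - 2 ^ P)) = Y at *
  have hSn : 65536 ≤ 2 ^ P := by
    calc 65536 = 2 ^ 16 := by norm_num
      _ ≤ 2 ^ P := Nat.pow_le_pow_right (by norm_num) (by omega)
  have hS : (65536:ℝ) ≤ 2 ^ P := by exact_mod_cast hSn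
  have hS0 : (0:ℝ) < 2 ^ P := by positivity
  have hXS : X ≤ 2 ^ P := c4.trans (Nat.pow_le_pow_right (by norm_num) (by omega))
  have hser1 := ser_spec P X k (P / k + 1) (by omega) (by omega) c4
    (by have := Nat.lt_div_mul_add (a := P) (b := k) (by omega); rw [add_mul, one_mul]; exact this.le)
  have hser2 := ser_spec P (2 ^ P - Y) (k - 10 + 1) (P / (k - 10 + 1) + 1) (by omega) (by omega) c6
    (by have := Nat.lt_div_mul_add (a := P) (b := k - 10 + 1) (by omega); rw [add_mul, one_mul]; exact this.le)
  obtain ⟨B, hB⟩ : ∃ B, 2 ^ P - X = B := ⟨_, rfl⟩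
  rw [hB] at c1 c2 c3 hY
  have hXB : X = 2 ^ P - B := by omega
  have hBS : B < 2 ^ P := by omega
  obtain ⟨S, hSdef⟩ : ∃ S : ℕ, 2 ^ P = S := ⟨_, rfl⟩
  have hSr : (2:ℝ) ^ P = (S:ℝ) := by rw [← hSdef]; push_cast; rfl
  rw [pow_mul] at c1 c2
  rw [hSdef] at hY c1 c2 c3 c5 hBS hXB hSn
  rw [hSr] at hS hS0
  have hkr : (2:ℝ) ≤ k := by exact_mod_cast hk2
  have hkr' : (k:ℝ) ≤ 470 := by exact_mod_cast hk
  obtain ⟨z, hz⟩ : ∃ z : ℝ, z = 2 * B / S := ⟨_, rfl⟩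
  have hBz : (B:ℝ) = S * z / 2 := by rw [hz]; field_simp
  have hzlow : 2 * k ≤ (k + 1) * z := by
    have : (k:ℝ) * S ≤ (k + 1) * B := by exact_mod_cast c3
    rw [hz, ← mul_div_assoc, le_div_iff₀ hS0]; linarith
  have hz43 : 4 / 3 ≤ z := by
    by_contra hc
    push Not at hc
    have := mul_lt_mul_of_pos_left hc (show (0:ℝ) < k + 1 by linarith only [hkr])
    linarith only [this, hzlow, hkr]
  have hz2 : z < 2 := by
    rw [hz, div_lt_iff₀ hS0]
    have : (B:ℝ) < S := by exact_mod_cast hBS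
    linarith
  have hα85 := hα.ge
  have hden := hα.den_pos
  have hXr : (X:ℝ) = S * (2 - z) / 2 := by
    rw [hXB, Nat.cast_sub hBS.le, hBz]; ring
  have hdz := alpha_brk hα hk2 hS0 c1 c2 c7 hBz hXr hzlow
  clear c1 c2
  obtain ⟨g1, g2, g3, g4⟩ := log_facts
  rw [hSr] at h2 h3 h5 hser1 hser2
  rw [hSr]
  refine ⟨_, _, ?_, ?_, hf⟩
  · have e1 : 1 - (X:ℝ) / S = z / 2 := by rw [hXr]; field_simp; ring
    rw [e1, Real.log_div (by linarith) (by norm_num)] at hser1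
    have hlz : 1 / 4 ≤ Real.log z := by
      have := Real.one_sub_inv_le_log_of_pos (x := z) (by linarith)
      have : z⁻¹ ≤ (4 / 3)⁻¹ := by gcongr
      norm_num at this
      linarith
    have hA : Ap S _ _ 5 := hser1
    have := h2.natsub hA (by
      have := mul_le_mul_of_nonneg_left hlz hS0.le
      linarith only [this, hS])
    refine (this.mono (f := 2) ?_ hS0.le).le (by norm_num)
    rw [show Real.log 2 - -(Real.log z - Real.log 2) = Real.log z by ring]
    have := lip2 (S := S) z α 1 1 (by norm_num) (by linarith) (by linarith) (by linarith)
    calc (S:ℝ) * _ ≤ S * (2 * 1 / 1 / S) := by gcongr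
      _ = 2 := by field_simp
  · obtain ⟨D, hD⟩ : ∃ D : ℝ, D = (k + 1) * z - 2 * k := ⟨_, rfl⟩
    have hDz : |D - ((k + 1) * α - 2 * k)| ≤ (k + 1) * (2 / S) := by
      rw [hD, show (k + 1) * z - 2 * k - ((k + 1) * α - 2 * k) = (k + 1) * (z - α) by ring, abs_mul,
        abs_of_pos (by linarith)]
      gcongr
    have hkS : (k + 1) * (2 / S) ≤ (1:ℝ) / 4 := by
      rw [← mul_div_assoc, div_le_iff₀ hS0]; linarith
    have hD4 : 1 / 4 ≤ D := by
      have := (abs_le.1 hDz).1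
      linarith
    obtain ⟨r, hr⟩ : ∃ r : ℝ, r = 3 * z * D / (4 * (z - 1) * (2 * z - 1)) := ⟨_, rfl⟩
    have hYr := Y_bd hS0 hBz hz43 c3 hD hr hY
    have hV2 : 2 * (2 ^ P - Y) ≤ 2 ^ P := by
      calc 2 * (2 ^ P - Y) ≤ 2 ^ 1 * 2 ^ (P - (k - 10 + 1)) := by omega
        _ = 2 ^ (1 + (P - (k - 10 + 1))) := (pow_add _ _ _).symm
        _ ≤ 2 ^ P := Nat.pow_le_pow_right (by norm_num) (by omega)
    rw [hSdef] at hV2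
    have hY2 : S ≤ 2 * Y := by omega
    have hY2r : (S:ℝ) ≤ 2 * Y := by exact_mod_cast hY2
    have e1 : 1 - ((2 ^ P - Y : ℕ) : ℝ) / S = Y / S := by
      rw [hSdef, Nat.cast_sub c5]; field_simp; ring
    rw [e1] at hser2
    have hA : Ap S _ _ 5 := hser2
    have hA2 := hA.mono (y := - Real.log r) (f := 2) (by
      rw [show ∀ u v : ℝ, -u - -v = -(u - v) by intros; ring, abs_neg]
      have := log_lip (Y / S) r (1 / 2) (by norm_num) (by rw [le_div_iff₀ hS0]; linarith)
        (by
          have : (S:ℝ) * (1 / 2) ≤ S * r := by linarith only [hY2r, hYr.2]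
          exact le_of_mul_le_mul_left this hS0)
      have h4 : |(Y:ℝ) / S - r| ≤ 1 / S := by
        rw [show (Y:ℝ) / S - r = (Y - S * r) / S by field_simp, abs_div, abs_of_pos hS0]
        gcongr
        rw [abs_le]; constructor <;> linarith
      calc (S:ℝ) * _ ≤ S * (1 / S / (1 / 2)) := by gcongr; exact this.trans (by gcongr)
        _ = 2 := by field_simp) hS0.le
    have hM : Ap S (Real.log 5 + 3 * Real.log 3) ((L5 + 3 * L3 : ℕ) : ℝ) (49 + 3 * 49) := by
      push_cast
      exact h5.add (h3.mul (by norm_num))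
    have hM2 := (hM.natsub h2 (by
      have : (3:ℝ) ≤ Real.log 5 + 3 * Real.log 3 - Real.log 2 := by linarith only [g2, g3, g4]
      have := mul_le_mul_of_nonneg_left this hS0.le
      linarith only [this, hS])).add hA2
    have hU : Ap S (Real.log 5 + 3 * Real.log 3 - Real.log 2 + -Real.log r) ((L5 + 3 * L3 - L2 + serL P (2 ^ P) (2 ^ P - Y) (P / (k - 10 + 1) + 1) 0 : ℕ) : ℝ) (49 + 3 * 49 + 21 + (5 + 2)) := by
      push_cast at hM2 ⊢
      exact hM2
    refine (hU.mono (f := 3780) ?_ hS0.le).le (by norm_num)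
    have fin := logC_lip hα hk hS hdz hz43 hD hr hD4 hDz
    calc (S:ℝ) * _ ≤ S * (3780 / S) := by gcongr
      _ = 3780 := by field_simp


theorem allb_spec (f : ℕ → Bool) (n : ℕ) (h : allb f n = true) : ∀ i < n, f i = true := by
  induction n with
  | zero => intro i hi; omega
  | succ n ih =>
    have h' : (f n && allb f n) = true := h
    rw [Bool.and_eq_true] at h'
    intro i hi
    rcases Nat.lt_succ_iff_lt_or_eq.mp hi with h1 | h1
    · exact ih h'.2 i h1
    · rw [h1]; exact h'.1

theorem dst_eq (r T : ℕ) : dst r T = min (r % T) (T - r % T) := by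
  unfold dst
  rw [force_eq]
  change (bif Nat.ble (r % T) (T - r % T) then r % T else T - r % T) = _
  by_cases h : r % T ≤ T - r % T
  · rw [min_eq_left h, Nat.ble_eq_true_of_le h]; rfl
  · have : Nat.ble (r % T) (T - r % T) = false := by
      by_contra hc
      exact h (Nat.le_of_ble_eq_true (by simpa using hc))
    rw [min_eq_right (by omega), this]; rfl

theorem dst_ex (r T : ℕ) (hT : 0 < T) : ∃ p : ℤ, |(r:ℤ) - p * T| = dst r T := by
  rw [dst_eq]
  have h : ((r % T : ℕ):ℤ) + T * ((r / T : ℕ):ℤ) = r := by exact_mod_cast Nat.mod_add_div r T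
  have h2 := Nat.mod_lt r hT
  rcases le_total (r % T) (T - r % T) with h1 | h1
  · refine ⟨(r / T : ℕ), ?_⟩
    rw [min_eq_left h1]
    have : (r:ℤ) - ((r / T : ℕ):ℤ) * T = ((r % T : ℕ):ℤ) := by linarith
    rw [this, abs_of_nonneg (by positivity)]
  · refine ⟨(r / T : ℕ) + 1, ?_⟩
    rw [min_eq_right h1]
    have : (r:ℤ) - (((r / T : ℕ):ℤ) + 1) * T = -((T - r % T : ℕ):ℤ) := by
      rw [Nat.cast_sub h2.le]
      linarith
    rw [this, abs_neg, abs_of_nonneg (by positivity)]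

theorem dst_le (r T : ℕ) (hT : 0 < T) (m : ℤ) : (dst r T : ℤ) ≤ |(r:ℤ) - m * T| := by
  rw [dst_eq]
  have h : ((r % T : ℕ):ℤ) + T * ((r / T : ℕ):ℤ) = r := by exact_mod_cast Nat.mod_add_div r T
  have h2 := Nat.mod_lt r hT
  have hT' : (0:ℤ) < T := by exact_mod_cast hT
  have e : (r:ℤ) - m * T = ((r % T : ℕ):ℤ) + ((r / T : ℕ) - m) * T := by rw [← h]; push_cast; ring
  rw [e]
  push_cast [h2.le]
  generalize hu : ((r / T : ℕ):ℤ) - m = u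
  have hu' : ((r:ℤ) / T) - m = u := by rw [← hu]; push_cast; rfl
  try rw [hu']
  have hs0 : (0:ℤ) ≤ (r:ℤ) % T := Int.emod_nonneg _ hT'.ne'
  rcases le_or_gt 0 u with h0 | h0
  · refine le_trans (min_le_left _ _) (le_trans ?_ (le_abs_self _))
    have := mul_nonneg h0 hT'.le
    linarith
  · refine le_trans (min_le_right _ _) (le_trans ?_ (neg_le_abs _))
    have : (u + 1) * T ≤ 0 := mul_nonpos_of_nonpos_of_nonneg (by omega) hT'.le
    linarith

/-- common real estimate -/
theorem comb_bd {S l t v n d q e c1 c3 La T U : ℝ} (hS : 0 ≤ S) (h1 : Ap S l La e) (h2 : Ap S t T e)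
    (h3 : Ap S v U e) (hn : 0 ≤ n) (hd : 0 ≤ d) (hq : 0 ≤ q)
    (hL : |n * l - d * t + v| ≤ c3) (p : ℝ) (hp : |q * La - p * T| ≤ c1) :
    |q * U - (q * d - n * p) * T| ≤ n * c1 + q * ((n + d + 1) * e + S * c3) := by
  have h1' := (h1.mul hn).sub (h2.mul hd)
  have h4 := ((h1'.add h3).mul hq)
  unfold Ap at h4
  have h5 : |S * (q * (n * l - d * t + v))| ≤ q * (S * c3) := by
    rw [show S * (q * (n * l - d * t + v)) = q * (S * (n * l - d * t + v)) by ring, abs_mul, abs_mul,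
      abs_of_nonneg hq, abs_of_nonneg hS]
    gcongr
  have h6 : |n * (q * La - p * T)| ≤ n * c1 := by
    rw [abs_mul, abs_of_nonneg hn]; gcongr
  rw [abs_le] at *
  constructor <;> nlinarith only [h4.1, h4.2, h5.1, h5.2, h6.1, h6.2]

theorem tst_sound {S N E q La T U n d : ℕ} {l t v : ℝ} (h : tst S N E q La T U = true)
    (h1 : Ap S l La 8192) (h2 : Ap S t T 8192) (h3 : Ap S v U 8192) (hT : 0 < T)
    (hn : n ≤ N) (hd : d ≤ N) (hL : |n * l - d * t + v| ≤ 216 / 10 ^ E) : False := by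
  unfold tst at h
  rw [force_eq] at h
  have h := Nat.le_of_ble_eq_true h
  change N * dst (q * La) T + q * ((2 * N + 1) * 8192 + S * 216 / 10 ^ E + 1) + 1 ≤ dst (q * U) T at h
  obtain ⟨p, hp⟩ := dst_ex (q * La) T hT
  have hm := dst_le (q * U) T hT (q * d - n * p)
  have hp' : |(q:ℝ) * La - p * T| ≤ dst (q * La) T := by
    exact_mod_cast hp.le
  have hm' : (dst (q * U) T : ℝ) ≤ |(q:ℝ) * U - (q * d - n * p) * T| := by
    exact_mod_cast hm
  have hb := comb_bd (Nat.cast_nonneg S) h1 h2 h3 (Nat.cast_nonneg n) (Nat.cast_nonneg d)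
    (Nat.cast_nonneg q) hL (p:ℝ) hp'
  have hf := (fl_bd (S * 216) (10 ^ E) (by positivity)).1
  have h' : (N:ℝ) * dst (q * La) T + q * ((2 * N + 1) * 8192 + ((S * 216 / 10 ^ E : ℕ):ℝ) + 1) + 1
      ≤ dst (q * U) T := by exact_mod_cast h
  have hn' : (n:ℝ) ≤ N := by exact_mod_cast hn
  have hd' : (d:ℝ) ≤ N := by exact_mod_cast hd
  have e1 : (n:ℝ) * dst (q * La) T ≤ N * dst (q * La) T := by gcongr
  have e2 : (q:ℝ) * ((n + d + 1) * 8192 + S * (216 / 10 ^ E)) ≤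
      q * ((2 * N + 1) * 8192 + ((S * 216 / 10 ^ E : ℕ):ℝ) + 1) := by
    refine mul_le_mul_of_nonneg_left ?_ (Nat.cast_nonneg q)
    push_cast at hf ⊢
    rw [show (S:ℝ) * (216 / 10 ^ E) = S * 216 / 10 ^ E by ring]
    linarith
  linarith

theorem tst9_sound {S N E La T n d : ℕ} {l t : ℝ} (h : tst9 S N E La T = true)
    (h1 : Ap S l La 8192) (h2 : Ap S t T 8192) (hT : 0 < T) (hn0 : 1 ≤ n)
    (hn : n ≤ N) (hd : d ≤ N) (hL : |n * l - d * t| ≤ 216 / 10 ^ E) : False := by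
  unfold tst9 at h
  rw [force_eq, force_eq, force_eq] at h
  generalize cfl (2 ⊠ N) T La = q at h
  generalize (q ⊠ La ⊹ T ⊘ 2) ⊘ T = p at h
  rw [Bool.and_eq_true, Bool.and_eq_true] at h
  obtain ⟨g1, g2, g3⟩ := h
  have g1 := Nat.eq_of_beq_eq_true g1
  have g2 : N + 1 ≤ q := Nat.le_of_ble_eq_true g2
  have g3 := Nat.le_of_ble_eq_true g3
  change N * ((q * La - p * T) + (p * T - q * La)) + q * ((2 * N + 1) * 8192 + S * 216 / 10 ^ E + 1) + 1 ≤ T at g3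
  have hp' : |(q:ℝ) * La - p * T| ≤ ((q * La - p * T) + (p * T - q * La) : ℕ) := by
    rcases le_total (q * La) (p * T) with h0 | h0
    · rw [Nat.sub_eq_zero_of_le h0, zero_add, Nat.cast_sub h0, abs_of_nonpos]
      · push_cast; linarith
      · have : ((q * La : ℕ):ℝ) ≤ (p * T : ℕ) := by exact_mod_cast h0
        push_cast at this; linarith
    · rw [Nat.sub_eq_zero_of_le h0, add_zero, Nat.cast_sub h0, abs_of_nonneg]
      · push_cast; linarith
      · have : ((p * T : ℕ):ℝ) ≤ (q * La : ℕ) := by exact_mod_cast h0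
        push_cast at this; linarith
  generalize (q * La - p * T) + (p * T - q * La) = rp at g3 hp'
  have hb := comb_bd (v := 0) (U := 0) (Nat.cast_nonneg S) h1 h2 (by simp [Ap]) (Nat.cast_nonneg n)
    (Nat.cast_nonneg d) (Nat.cast_nonneg q) (by simpa using hL) (p:ℝ) hp'
  have hf := (fl_bd (S * 216) (10 ^ E) (by positivity)).1
  have h' : (N:ℝ) * rp + q * ((2 * N + 1) * 8192 + ((S * 216 / 10 ^ E : ℕ):ℝ) + 1) + 1
      ≤ T := by exact_mod_cast g3
  have hn' : (n:ℝ) ≤ N := by exact_mod_cast hn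
  have hd' : (d:ℝ) ≤ N := by exact_mod_cast hd
  have e1 : (n:ℝ) * rp ≤ N * rp := by gcongr
  have e2 : (q:ℝ) * ((n + d + 1) * 8192 + S * (216 / 10 ^ E)) ≤
      q * ((2 * N + 1) * 8192 + ((S * 216 / 10 ^ E : ℕ):ℝ) + 1) := by
    refine mul_le_mul_of_nonneg_left ?_ (Nat.cast_nonneg q)
    push_cast at hf ⊢
    rw [show (S:ℝ) * (216 / 10 ^ E) = S * 216 / 10 ^ E by ring]
    linarith
  have hlt : |(q:ℝ) * 0 - (q * d - n * p) * T| < T := by linarith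
  have hT' : (0:ℝ) < T := by exact_mod_cast hT
  have hz : (q * d : ℤ) - n * p = 0 := by
    rw [mul_zero, zero_sub, abs_neg, abs_mul, abs_of_pos hT'] at hlt
    have : |(q:ℝ) * d - n * p| < 1 := by
      by_contra hc
      push Not at hc
      nlinarith
    have h3 : |(q * d : ℤ) - n * p| < 1 := by exact_mod_cast this
    exact Int.abs_lt_one_iff.mp h3
  have hz' : q * d = n * p := by
    have : (q * d : ℤ) = n * p := by linarith
    exact_mod_cast this
  have hdv : q ∣ n := (Nat.Coprime.dvd_of_dvd_mul_right (show Nat.Coprime q p from g1) ⟨d, hz'.symm⟩)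
  have := Nat.le_of_dvd hn0 hdv
  omega

/-- the approximations used for `k`, `a` -/
theorem setup {P L2 L3 L5 L7 k : ℕ} {α : ℝ} (hα : IsAlpha k α) (hP : 500 ≤ P)
    (h2 : Ap (2 ^ P) (Real.log 2) L2 21) (h3 : Ap (2 ^ P) (Real.log 3) L3 49)
    (h5 : Ap (2 ^ P) (Real.log 5) L5 49) (h7 : Ap (2 ^ P) (Real.log 7) L7 70) {U : ℕ}
    (hU : Ap (2 ^ P) (Real.log (9 * Cc k α) + Real.log 10) U 4100) (a : ℕ) (ha : 1 ≤ a) (ha9 : a ≤ 9) :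
    Ap (2 ^ P) (Real.log (9 * Cc k α / a) + Real.log 10) ((U - lga L2 L3 L5 L7 a : ℕ):ℝ) 8192 := by
  have hla := lga_sound h2 h3 h5 h7 a ha ha9
  have hC := Cc_ge hα
  have ha0 : (0:ℝ) < a := by exact_mod_cast ha
  have ha9' : (a:ℝ) ≤ 9 := by exact_mod_cast ha9
  have e : Real.log (9 * Cc k α / a) + Real.log 10 = Real.log (9 * Cc k α) + Real.log 10 - Real.log a := by
    rw [Real.log_div (by positivity) (by positivity)]; ring
  have hge : (1/2:ℝ) ≤ Real.log (9 * Cc k α / a) + Real.log 10 := by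
    rw [← Real.log_mul (by positivity) (by norm_num)]
    have : (2:ℝ) ≤ 9 * Cc k α / a * 10 := by
      rw [div_mul_eq_mul_div, le_div_iff₀ ha0]; linarith
    have h2' := Real.log_le_log (by norm_num) this
    linarith [log_facts.1]
  have hS : (2:ℝ) ^ 14 ≤ 2 ^ P := pow_le_pow_right₀ (by norm_num) (by omega)
  rw [e] at hge ⊢
  refine (Ap.natsub hU hla ?_).le (by norm_num)
  nlinarith only [hge, hS]

theorem T_ap {P L2 L5 : ℕ} (hP : 500 ≤ P) (h2 : Ap (2 ^ P) (Real.log 2) L2 21)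
    (h5 : Ap (2 ^ P) (Real.log 5) L5 49) :
    Ap (2 ^ P) (Real.log 10) ((L2 + L5 : ℕ):ℝ) 70 ∧ (2:ℝ) ^ P ≤ (L2 + L5 : ℕ) := by
  have e : Real.log 10 = Real.log 2 + Real.log 5 := by
    rw [← Real.log_mul (by norm_num) (by norm_num)]; norm_num
  have h := h2.add h5
  rw [← e] at h
  have h' : Ap (2 ^ P) (Real.log 10) ((L2 + L5 : ℕ):ℝ) 70 := by
    push_cast; exact h.le (by norm_num)
  refine ⟨h', ?_⟩
  have hS : (2:ℝ) ^ 14 ≤ 2 ^ P := pow_le_pow_right₀ (by norm_num) (by omega)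
  obtain ⟨f1, -, -, f2⟩ := log_facts
  unfold Ap at h'
  rw [abs_le] at h'
  have : (1.5:ℝ) ≤ Real.log 10 := by rw [e]; linarith
  nlinarith only [h'.2, this, hS]

theorem runC_sound {P na k0 nk k : ℕ} {α : ℝ} (hα : IsAlpha k α) (hk : k ≤ 470) (hP : 500 ≤ P)
    (h : runC P na k0 nk = true) (hk0 : k0 ≤ k) (hk1 : k < k0 + nk) (a : ℕ) (ha : 1 ≤ a) (ha9 : a ≤ 9)
    (hna : a ≤ na) (n d : ℕ) (hn : n ≤ 2 ^ 1601) (hd : d + 1 ≤ 2 ^ 1601)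
    (hL : |n * Real.log α - d * Real.log 10 + Real.log (9 * Cc k α / a)| ≤ 216 / 10 ^ 512) : False := by
  unfold runC at h
  rw [force_eq, force_eq] at h
  obtain ⟨L2, L3, L5, L7, h2, h3, h5, h7, h⟩ := lg_sound (by omega) h
  have h := allb_spec _ _ h (k - k0) (by omega)
  change dat P (2 ^ P) (k0 + (k - k0)) L2 L3 L5 _ = true at h
  rw [Nat.add_sub_cancel' hk0] at h
  obtain ⟨La, U, hLa, hU, h⟩ := dat_sound hα hk hP h2 h3 h5 h
  unfold chkC at h
  rw [force_eq, force_eq] at h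
  have h := allb_spec _ _ h (a - 1) (by omega)
  obtain ⟨hT, hT1⟩ := T_ap hP h2 h5
  have hUa := setup hα hP h2 h3 h5 h7 hU a ha ha9
  have ea : Nat.succ (a - 1) = a := by omega
  rw [ea] at h
  refine tst_sound (n := n) (d := d + 1) (l := Real.log α) (t := Real.log 10)
    (v := Real.log (9 * Cc k α / a) + Real.log 10) h ?_ ?_ ?_ ?_ hn hd ?_
  · push_cast; exact hLa.le (by norm_num)
  · rw [Nat.cast_pow]; exact hT.le (by norm_num)
  · rw [Nat.cast_pow]; exact hUa
  · have : (0:ℝ) < (L2 + L5 : ℕ) := lt_of_lt_of_le (by positivity) hT1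
    exact_mod_cast this
  · push_cast
    rw [show (n:ℝ) * Real.log α - (d + 1) * Real.log 10 + (Real.log (9 * Cc k α / a) + Real.log 10) =
      n * Real.log α - d * Real.log 10 + Real.log (9 * Cc k α / a) by ring]
    exact hL

theorem run9_sound {P N E : ℕ} {α : ℝ} (hα : IsAlpha 2 α) (hP : 500 ≤ P)
    (h : run9 P N E = true) (n d : ℕ) (hn0 : 1 ≤ n) (hn : n ≤ N) (hd : d ≤ N)
    (hL : |n * Real.log α - d * Real.log 10| ≤ 216 / 10 ^ E) : False := by
  unfold run9 at h
  obtain ⟨L2, L3, L5, L7, h2, h3, h5, h7, h⟩ := lg_sound (by omega) h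
  rw [force_eq] at h
  obtain ⟨La, U, hLa, hU, h⟩ := dat_sound hα (by norm_num) hP h2 h3 h5 h
  rw [force_eq] at h
  obtain ⟨hT, hT1⟩ := T_ap hP h2 h5
  refine tst9_sound (n := n) (d := d) (l := Real.log α) (t := Real.log 10) h ?_ ?_ ?_ hn0 hn hd hL
  · push_cast; exact hLa.le (by norm_num)
  · rw [Nat.cast_pow]; exact hT.le (by norm_num)
  · have : (0:ℝ) < (L2 + L5 : ℕ) := lt_of_lt_of_le (by positivity) hT1
    exact_mod_cast this


theorem pk_succ (g : ℕ → ℕ) (n : ℕ) : pk g (n + 1) = pk g n * 2 ^ 1024 + g n := by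
  change force (Nat.shiftLeft (pk g n) 1024 + g n) (fun v => v) = _
  have e : ∀ x w : ℕ, Nat.shiftLeft x w = x * 2 ^ w := fun x w => Nat.shiftLeft_eq _ _
  rw [force_eq, e]

theorem pk_lin (q c : ℕ) (g : ℕ → ℕ) (n : ℕ) :
    q * pk g n + c * pk (fun _ => 1) n = pk (fun i => q * g i + c) n := by
  induction n with
  | zero => rfl
  | succ n ih => rw [pk_succ, pk_succ, pk_succ, ← ih]; ring

theorem pk_const (c : ℕ) (n : ℕ) : c * pk (fun _ => 1) n = pk (fun _ => c) n := by
  have := pk_lin 0 c (fun _ => 0) n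
  simpa using this

theorem pk_add (g h : ℕ → ℕ) (n : ℕ) : pk g n + pk h n = pk (fun i => g i + h i) n := by
  induction n with
  | zero => rfl
  | succ n ih => rw [pk_succ, pk_succ, pk_succ, ← ih]; ring

theorem land_split (A B x y W : ℕ) (hx : x < 2 ^ W) (hy : y < 2 ^ W) :
    (A * 2 ^ W + x) &&& (B * 2 ^ W + y) = (A &&& B) * 2 ^ W + (x &&& y) := by
  apply Nat.eq_of_testBit_eq
  intro i
  have hxy : x &&& y < 2 ^ W := lt_of_le_of_lt Nat.and_le_left hx
  rw [Nat.testBit_and, mul_comm A, mul_comm B, mul_comm (A &&& B), Nat.testBit_two_pow_mul_add _ hx,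
    Nat.testBit_two_pow_mul_add _ hy, Nat.testBit_two_pow_mul_add _ hxy]
  split_ifs <;> simp

theorem pk_land (g h : ℕ → ℕ) (n : ℕ) (hg : ∀ i < n, g i < 2 ^ 1024) (hh : ∀ i < n, h i < 2 ^ 1024) :
    pk g n &&& pk h n = pk (fun i => g i &&& h i) n := by
  induction n with
  | zero => exact Nat.zero_and _
  | succ n ih =>
    rw [pk_succ, pk_succ, pk_succ, ← ih (fun i hi => hg i (by omega)) (fun i hi => hh i (by omega))]
    exact land_split _ _ _ _ _ (hg n (by omega)) (hh n (by omega))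

theorem pk_inj (g h : ℕ → ℕ) (n : ℕ) (hg : ∀ i < n, g i < 2 ^ 1024) (hh : ∀ i < n, h i < 2 ^ 1024)
    (he : pk g n = pk h n) : ∀ i < n, g i = h i := by
  induction n with
  | zero => intro i hi; omega
  | succ n ih =>
    rw [pk_succ, pk_succ] at he
    have h1 := hg n (by omega)
    have h2 := hh n (by omega)
    generalize (2:ℕ) ^ 1024 = M at *
    have hM : 0 < M := by omega
    have e1 : g n = h n := by
      have := congrArg (· % M) he
      simpa [Nat.mul_add_mod, Nat.mul_add_mod', Nat.mod_eq_of_lt h1, Nat.mod_eq_of_lt h2] using this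
    have e2 : pk g n = pk h n := by
      rw [e1] at he
      exact Nat.eq_of_mul_eq_mul_right hM (Nat.add_right_cancel he)
    intro i hi
    rcases Nat.lt_succ_iff_lt_or_eq.mp hi with h' | h'
    · exact ih (fun i hi => hg i (by omega)) (fun i hi => hh i (by omega)) e2 i h'
    · rw [h']; exact e1

theorem one_sound {q c n f s : ℕ} {g : ℕ → ℕ} (hf : f ≤ 1000) (hsf : s ≤ f)
    (hb : ∀ i < n, q * g i + c < 2 ^ 1024)
    (h : one q c (pk (fun _ => 1) n) ((2 ^ f - 1) * pk (fun _ => 1) n)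
      ((2 ^ f - 2 ^ s) * pk (fun _ => 1) n) (2 ^ f * pk (fun _ => 1) n) (pk g n) = true) :
    ∀ i < n, 2 ^ s ≤ (q * g i + c) % 2 ^ f := by
  have h := Nat.eq_of_beq_eq_true h
  change ((q * pk g n + c * pk (fun _ => 1) n) &&& ((2 ^ f - 1) * pk (fun _ => 1) n)) +
    (2 ^ f - 2 ^ s) * pk (fun _ => 1) n &&& 2 ^ f * pk (fun _ => 1) n = 2 ^ f * pk (fun _ => 1) n at h
  have hF : (2:ℕ) ^ f ≤ 2 ^ 1000 := Nat.pow_le_pow_right (by norm_num) hf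
  have hF1 : (2:ℕ) ^ 1000 * 2 ≤ 2 ^ 1024 := by
    rw [← pow_succ]; exact Nat.pow_le_pow_right (by norm_num) (by norm_num)
  have hs : (2:ℕ) ^ s ≤ 2 ^ f := Nat.pow_le_pow_right (by norm_num) hsf
  have hp : 0 < (2:ℕ) ^ s := by positivity
  generalize (2:ℕ) ^ 1000 = K at hF hF1
  rw [pk_lin, pk_const, pk_const, pk_const, pk_land _ _ _ hb (fun i _ => by omega), pk_add, pk_land] at h
  rotate_left
  · intro i hi
    have : (q * g i + c) &&& (2 ^ f - 1) ≤ 2 ^ f - 1 := Nat.and_le_right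
    show ((q * g i + c) &&& (2 ^ f - 1)) + (2 ^ f - 2 ^ s) < 2 ^ 1024
    generalize (2:ℕ) ^ 1024 = R at *
    omega
  · intro i hi; generalize (2:ℕ) ^ 1024 = R at *; omega
  have h := pk_inj _ _ n ?_ ?_ h
  · intro i hi
    have h := h i hi
    rw [Nat.and_two_pow_sub_one_eq_mod] at h
    have h1 : (((q * g i + c) % 2 ^ f + (2 ^ f - 2 ^ s)) &&& 2 ^ f) ≤
      (q * g i + c) % 2 ^ f + (2 ^ f - 2 ^ s) := Nat.and_le_left
    rw [h] at h1
    omega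
  · intro i hi
    refine lt_of_le_of_lt Nat.and_le_right ?_
    generalize (2:ℕ) ^ 1024 = R at *; omega
  · intro i hi; generalize (2:ℕ) ^ 1024 = R at *; omega

theorem mkL_eq (V : ℕ → ℕ) (f : List ℕ → Bool) (n : ℕ) : ∀ l, mkL V f n l = f ((List.range n).map V ++ l) := by
  induction n with
  | zero => intro l; rfl
  | succ n ih =>
    intro l
    change force (V n) (fun v => mkL V f n (v :: l)) = _
    rw [force_eq, ih, List.range_succ, List.map_append, List.append_assoc]
    rfl

theorem chkl_spec (h : ℕ → ℕ → Bool) (l : List ℕ) : ∀ j, chkl h l j = true →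
    ∀ i (hi : i < l.length), h (j + i) l[i] = true := by
  induction l with
  | nil => intro j _ i hi; simp at hi
  | cons v l ih =>
    intro j hj i hi
    have hj' : (h j v && chkl h l (Nat.succ j)) = true := hj
    rw [Bool.and_eq_true] at hj'
    cases i with
    | zero => exact hj'.1
    | succ i =>
      have := ih _ hj'.2 i (by simpa using hi)
      rw [show j + (i + 1) = Nat.succ j + i by omega]
      simpa using this

theorem log_quad (y : ℝ) (hy : |y| ≤ 1 / 2) : |Real.log (1 + y) - (y - y ^ 2 / 2)| ≤ 2 * |y| ^ 3 := by
  have h := Real.abs_log_sub_add_sum_range_le (x := -y) (by rw [abs_neg]; linarith) 2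
  rw [Finset.sum_range_succ, Finset.sum_range_succ, Finset.sum_range_zero] at h
  rw [abs_neg, sub_neg_eq_add] at h
  have e : Real.log (1 + y) - (y - y ^ 2 / 2) =
    0 + (-y) ^ (0 + 1) / ((0:ℕ) + 1) + (-y) ^ (1 + 1) / ((1:ℕ) + 1) + Real.log (1 + y) := by
    push_cast; ring
  rw [e]
  refine le_trans h ?_
  rw [div_le_iff₀ (by linarith)]
  have : 0 ≤ |y| ^ 3 := by positivity
  have h3 := mul_le_mul_of_nonneg_left hy this
  rw [show 2 + 1 = 3 from rfl]
  linarith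


set_option exponentiation.threshold 2000

theorem F_facts : (2:ℝ) ^ 530 * 2 * (81 / 10 ^ 65) ^ 3 ≤ 1 ∧ (4:ℝ) * 81 / 10 ^ 65 ≤ 1 ∧ (16:ℝ) ≤ 2 ^ 530 ∧
    (2:ℝ) ^ 530 * 2 ^ 20 ≤ 2 ^ 1000 := by
  refine ⟨?_, ?_, ?_, ?_⟩ <;> norm_num

theorem slot_real {F S T t y : ℝ} (hF : F = 2 ^ 530) (hS : 2 ^ 1000 ≤ S) (hT : Ap S t T 70) (hST : S ≤ T)
    (ht : 1 ≤ t) (hy : |y| ≤ 81 / 10 ^ 65) :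
    |F * (S / T) * (y - y ^ 2 / 2) - F * (Real.log (1 + y) / t)| ≤ 2 ∧
    |F * (Real.log (1 + y) / t)| ≤ F / 2 := by
  obtain ⟨f1, f2, f3, f4⟩ := F_facts
  rw [← hF] at f1 f3 f4
  have hF0 : 0 < F := by linarith
  have hS0 : 0 < S := lt_of_lt_of_le (by positivity) hS
  have hT0 : 0 < T := by linarith
  have ht0 : 0 < t := by linarith
  have hy2 : |y| ≤ 1 / 4 := by
    refine le_trans hy ?_
    rw [show (81:ℝ) / 10 ^ 65 = (4 * 81 / 10 ^ 65) / 4 by ring]; linarith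
  have hq := log_quad y (by linarith)
  have hz : |y - y ^ 2 / 2| ≤ 1 / 3 := by
    have : |y ^ 2 / 2| ≤ 1 / 32 := by
      rw [abs_div, abs_pow, abs_of_pos (by norm_num : (0:ℝ) < 2)]
      have := abs_nonneg y
      nlinarith
    have := abs_sub y (y ^ 2 / 2)
    linarith
  have h3 : F * (2 * |y| ^ 3) ≤ 1 := by
    have : |y| ^ 3 ≤ (81 / 10 ^ 65) ^ 3 := by gcongr
    calc F * (2 * |y| ^ 3) = F * 2 * |y| ^ 3 := by ring
      _ ≤ F * 2 * (81 / 10 ^ 65) ^ 3 := by gcongr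
      _ ≤ 1 := f1
  have hd : |S / T - 1 / t| ≤ 70 / T := by
    rw [div_sub_div _ _ hT0.ne' ht0.ne', abs_div, abs_of_pos (mul_pos hT0 ht0), mul_one]
    unfold Ap at hT
    rw [div_le_div_iff₀ (by positivity) hT0]
    have := abs_nonneg (S * t - T)
    have h5 : (70:ℝ) * T ≤ 70 * (T * t) := by nlinarith
    nlinarith
  have hF70 : F * (70 / T) ≤ 1 := by
    rw [mul_div_assoc', div_le_one hT0]
    nlinarith
  constructor
  · have e : F * (S / T) * (y - y ^ 2 / 2) - F * (Real.log (1 + y) / t) =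
      F * (S / T - 1 / t) * (y - y ^ 2 / 2) - F * (Real.log (1 + y) - (y - y ^ 2 / 2)) / t := by
      field_simp; ring
    rw [e]
    have a1 : |F * (S / T - 1 / t) * (y - y ^ 2 / 2)| ≤ 1 := by
      rw [abs_mul, abs_mul, abs_of_pos hF0]
      calc F * |S / T - 1 / t| * |y - y ^ 2 / 2| ≤ F * (70 / T) * 1 := by
            gcongr; linarith
        _ ≤ 1 := by linarith
    have a2 : |F * (Real.log (1 + y) - (y - y ^ 2 / 2)) / t| ≤ 1 := by
      rw [abs_div, abs_mul, abs_of_pos hF0, abs_of_pos ht0]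
      refine le_trans (div_le_self (by positivity) ht) ?_
      exact le_trans (mul_le_mul_of_nonneg_left hq hF0.le) h3
    have := abs_sub (F * (S / T - 1 / t) * (y - y ^ 2 / 2)) (F * (Real.log (1 + y) - (y - y ^ 2 / 2)) / t)
    linarith
  · rw [abs_mul, abs_div, abs_of_pos hF0, abs_of_pos ht0, div_eq_mul_one_div F 2]
    refine mul_le_mul_of_nonneg_left ?_ hF0.le
    refine le_trans (div_le_self (by positivity) ht) ?_
    have h6 : |Real.log (1 + y)| ≤ |Real.log (1 + y) - (y - y ^ 2 / 2)| + |y - y ^ 2 / 2| := by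
      have := abs_add_le (Real.log (1 + y) - (y - y ^ 2 / 2)) (y - y ^ 2 / 2)
      simpa using this
    have h7 : |y| ^ 3 ≤ (1/4) ^ 3 := by gcongr
    linarith

theorem slot_sound {F S T a b i : ℕ} {t : ℝ} (hF : F = 2 ^ 530) (hS : (2:ℝ) ^ 1000 ≤ S) (hT : Ap S t T 70)
    (hST : (S:ℝ) ≤ T) (ht : 1 ≤ t) (ha : 1 ≤ a) (ha9 : a ≤ 9) (hb : b ≤ 9) :
    |(slot (F * S) F T a b i : ℝ) - F * (1 - Real.log (1 + 9 * ((b:ℝ) - a) / (a * 10 ^ (65 + i))) / t)| ≤ 3 ∧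
    slot (F * S) F T a b i ≤ 2 * F := by
  have hFr : (F:ℝ) = 2 ^ 530 := by rw [hF]; norm_num
  have hv1 : (10:ℕ) ^ 65 ≤ a * 10 ^ (65 + i) := by
    calc (10:ℕ) ^ 65 ≤ 10 ^ (65 + i) := Nat.pow_le_pow_right (by norm_num) (by omega)
      _ ≤ _ := Nat.le_mul_of_pos_left _ ha
  have hF16 : (16:ℝ) ≤ F := by rw [hFr]; exact F_facts.2.2.1
  have hT0 : (0:ℝ) < T := lt_of_lt_of_le (lt_of_lt_of_le (by positivity) hS) hST
  have hT0' : 0 < T := by exact_mod_cast hT0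
  unfold slot
  rw [force_eq]
  change |((bif Nat.ble a b then
    F - F * S * (9 * (b - a)) * (2 * (a * 10 ^ (65 + i)) - 9 * (b - a)) / (2 * (a * 10 ^ (65 + i)) * (a * 10 ^ (65 + i)) * T)
  else
    F + F * S * (9 * (a - b)) * (2 * (a * 10 ^ (65 + i)) + 9 * (a - b)) / (2 * (a * 10 ^ (65 + i)) * (a * 10 ^ (65 + i)) * T) : ℕ):ℝ) - _| ≤ 3 ∧ (bif Nat.ble a b then
    F - F * S * (9 * (b - a)) * (2 * (a * 10 ^ (65 + i)) - 9 * (b - a)) / (2 * (a * 10 ^ (65 + i)) * (a * 10 ^ (65 + i)) * T)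
  else
    F + F * S * (9 * (a - b)) * (2 * (a * 10 ^ (65 + i)) + 9 * (a - b)) / (2 * (a * 10 ^ (65 + i)) * (a * 10 ^ (65 + i)) * T) : ℕ) ≤ 2 * F
  rw [show (a:ℝ) * 10 ^ (65 + i) = ((a * 10 ^ (65 + i) : ℕ):ℝ) by push_cast; ring]
  generalize a * 10 ^ (65 + i) = v at hv1 ⊢
  have hv1r : (10:ℝ) ^ 65 ≤ v := by exact_mod_cast hv1
  have hv0 : (0:ℝ) < v := lt_of_lt_of_le (by positivity) hv1r
  have hv2 : 81 ≤ v := le_trans (by norm_num) hv1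
  have hv00 : 0 < v := by omega
  have hba : |(b:ℝ) - a| ≤ 9 := by
    have h1 : (b:ℝ) ≤ 9 := by exact_mod_cast hb
    have h2 : (a:ℝ) ≤ 9 := by exact_mod_cast ha9
    have h3 : (0:ℝ) ≤ b := by positivity
    have h4 : (0:ℝ) ≤ a := by positivity
    rw [abs_le]; constructor <;> linarith
  have hy : |9 * ((b:ℝ) - a) / v| ≤ 81 / 10 ^ 65 := by
    rw [abs_div, abs_mul, abs_of_pos hv0, abs_of_pos (by norm_num : (0:ℝ) < 9)]
    gcongr; linarith
  obtain ⟨r1, r2⟩ := slot_real hFr hS hT hST ht hy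
  by_cases hab : a ≤ b
  · rw [Nat.ble_eq_true_of_le hab]
    simp only [cond_true]
    have hfl := fl_bd (F * S * (9 * (b - a)) * (2 * v - 9 * (b - a))) (2 * v * v * T) (by positivity)
    have e : ((F * S * (9 * (b - a)) * (2 * v - 9 * (b - a)) : ℕ):ℝ) / (2 * v * v * T : ℕ) =
        F * (S / T) * (9 * ((b:ℝ) - a) / v - (9 * ((b:ℝ) - a) / v) ^ 2 / 2) := by
      rw [Nat.cast_mul _ (2 * v - 9 * (b - a)), Nat.cast_sub (by omega)]
      push_cast [hab]
      field_simp
    rw [e] at hfl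
    generalize F * S * (9 * (b - a)) * (2 * v - 9 * (b - a)) / (2 * v * v * T) = X at *
    rw [abs_le] at r1 r2
    have hXF : X ≤ F := by
      have : (X:ℝ) ≤ F := by linarith
      exact_mod_cast this
    rw [Nat.cast_sub hXF]
    refine ⟨?_, by omega⟩
    rw [abs_le]
    constructor <;> linarith
  · have hab' : Nat.ble a b = false := by
      by_contra hc
      exact hab (Nat.le_of_ble_eq_true (by simpa using hc))
    rw [hab']
    simp only [cond_false]
    have hfl := fl_bd (F * S * (9 * (a - b)) * (2 * v + 9 * (a - b))) (2 * v * v * T) (by positivity)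
    have e : ((F * S * (9 * (a - b)) * (2 * v + 9 * (a - b)) : ℕ):ℝ) / (2 * v * v * T : ℕ) =
        -(F * (S / T) * (9 * ((b:ℝ) - a) / v - (9 * ((b:ℝ) - a) / v) ^ 2 / 2)) := by
      push_cast [(by omega : b ≤ a)]
      field_simp
      ring
    rw [e] at hfl
    generalize F * S * (9 * (a - b)) * (2 * v + 9 * (a - b)) / (2 * v * v * T) = X at *
    rw [abs_le] at r1 r2
    push_cast
    refine ⟨?_, ?_⟩
    · rw [abs_le]
      constructor <;> linarith
    · have : (X:ℝ) ≤ F := by linarith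
      have : X ≤ F := by exact_mod_cast this
      omega


set_option exponentiation.threshold 2000

theorem p_bd {q La T : ℕ} {S t l : ℝ} (hT : Ap S t T 70) (hST : S ≤ T) (hS : (100:ℝ) ≤ S) (hl : 0 ≤ l ∧ l ≤ 1 / 2 + 1 / 4)
    (hLa : Ap S l La 28) :
    ∃ p : ℤ, |S * (q * l - p * t)| ≤ dst (q * La) T + 2 * q * 8192 := by
  have hT0 : (0:ℝ) < T := by linarith
  have hT0' : 0 < T := by exact_mod_cast hT0
  obtain ⟨p, hp⟩ := dst_ex (q * La) T hT0'
  refine ⟨p, ?_⟩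
  have hLT : (La:ℝ) ≤ T + 10 := by
    unfold Ap at hLa; rw [abs_le] at hLa; nlinarith only [hLa.1, hl.2, hST, hS]
  have hp' : |(q:ℝ) * La - p * T| = dst (q * La) T := by exact_mod_cast hp
  have hdle : (dst (q * La) T : ℝ) ≤ q * La := by
    have : dst (q * La) T ≤ q * La := by
      rw [dst_eq]; exact le_trans (min_le_left _ _) (Nat.mod_le _ _)
    exact_mod_cast this
  have hq0 : (0:ℝ) ≤ q := Nat.cast_nonneg q
  have hpq : |(p:ℝ)| ≤ 4 * q := by
    have h1 : |(p:ℝ) * T| ≤ 2 * (q * La) := by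
      have h2 := hp'.le.trans hdle
      rw [abs_le] at h2 ⊢
      constructor <;> linarith [mul_nonneg hq0 (Nat.cast_nonneg La : (0:ℝ) ≤ La)]
    rw [abs_mul, abs_of_pos hT0] at h1
    have h3 : 2 * ((q:ℝ) * La) ≤ 4 * q * T := by
      have : (La:ℝ) ≤ 2 * T := by linarith
      nlinarith
    exact le_of_mul_le_mul_right (h1.trans h3) hT0
  have h1 : |(q:ℝ) * (S * l - La)| ≤ q * 28 := by
    rw [abs_mul, abs_of_nonneg hq0]; exact mul_le_mul_of_nonneg_left hLa hq0
  have h2 : |(p:ℝ) * (S * t - T)| ≤ 4 * q * 70 := by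
    rw [abs_mul]; exact mul_le_mul hpq hT (abs_nonneg _) (by positivity)
  have h0 := hp'.le
  rw [abs_le] at *
  constructor <;> nlinarith only [h0.1, h0.2, h1.1, h1.2, h2.1, h2.2, hq0]

theorem pack_contra {F S N T La Ua q w n d D : ℕ} {l t ν g : ℝ} (hD : D = 2 ^ 486) (hF : F = 2 ^ 44 * D)
    (hS : (2:ℝ) ^ 1000 ≤ S) (hT : Ap S t T 70) (hST : (S:ℝ) ≤ T) (ht : 1 ≤ t) (hl : 0 ≤ l ∧ l ≤ 1 / 2 + 1 / 4)
    (hLa : Ap S l La 28) (hU : Ap S ν Ua 8192) (hν0 : 0 ≤ ν) (hν : ν ≤ 8) (hq : q ≤ D)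
    (hN : q * (S * 108 / 10 ^ 160 + 1) + N * (dst (q * La) T + 2 * q * 8192) ≤ S / 2 ^ 35)
    (hw : |(w:ℝ) - F * (1 - g / t)| ≤ 3)
    (hx : 2048 * D ≤ (q * w + ((q * (Ua * F / T)) % F + 1024 * D)) % F)
    (hn : n ≤ N) (hL : |n * l - d * t + (ν - g)| ≤ 108 / 10 ^ 160) : False := by
  have hD0 : 0 < D := by rw [hD]; positivity
  have hDr : (D:ℝ) = 2 ^ 486 := by rw [hD]; norm_num
  have hFr : (F:ℝ) = 2 ^ 44 * D := by rw [hF]; norm_num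
  have hFS : (F:ℝ) * 2 ^ 20 ≤ S := by
    rw [hFr, hDr]
    refine le_trans ?_ hS
    norm_num
  have hS0 : (0:ℝ) < S := lt_of_lt_of_le (by positivity) hS
  have hT0 : (0:ℝ) < T := by linarith
  have hT0' : 0 < T := by exact_mod_cast hT0
  have hD0r : (0:ℝ) < D := by exact_mod_cast hD0
  have hF0r : (0:ℝ) < F := by rw [hFr]; positivity
  have hF0 : 0 < F := by exact_mod_cast hF0r
  have ht0 : 0 < t := by linarith
  have hq0 : (0:ℝ) ≤ q := Nat.cast_nonneg q
  have hqD : (q:ℝ) ≤ D := by exact_mod_cast hq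
  -- W
  have hW : |((Ua * F / T : ℕ):ℝ) - F * (ν / t)| ≤ 2 := by
    have h1 := fl_bd (Ua * F) T hT0'
    have h2 : |((Ua * F : ℕ):ℝ) / T - F * (ν / t)| ≤ 1 := by
      have e : ((Ua * F : ℕ):ℝ) / T - F * (ν / t) = F * (ν * (S * t - T) - t * (S * ν - Ua)) / (T * t) := by
        push_cast; field_simp; ring
      rw [e, abs_div, abs_of_pos (mul_pos hT0 ht0), div_le_one (mul_pos hT0 ht0), abs_mul, abs_of_pos hF0r]
      have h3 : |ν * (S * t - T) - t * (S * ν - Ua)| ≤ 8 * 70 + t * 8192 := by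
        refine le_trans (abs_sub _ _) ?_
        rw [abs_mul, abs_mul, abs_of_nonneg hν0, abs_of_pos ht0]
        exact add_le_add (mul_le_mul hν hT (abs_nonneg _) (by norm_num)) (mul_le_mul_of_nonneg_left hU ht0.le)
      calc (F:ℝ) * |ν * (S * t - T) - t * (S * ν - Ua)| ≤ F * (t * 2 ^ 20) := by
            refine mul_le_mul_of_nonneg_left (h3.trans ?_) hF0r.le
            linarith
        _ = (F * 2 ^ 20) * t := by ring
        _ ≤ T * t := by gcongr; linarith
    rw [abs_le] at *
    constructor <;> linarith [h1.1, h1.2, h2.1, h2.2]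
  -- linear form
  obtain ⟨p, hp⟩ := p_bd (q := q) hT hST (by
    have : (2:ℝ) ^ 7 ≤ 2 ^ 1000 := pow_le_pow_right₀ (by norm_num) (by norm_num)
    linarith) hl hLa
  have hm : |(q:ℝ) * (ν - g) - (q * d - n * p) * t| ≤ 1 / 2 ^ 35 := by
    have hN' : (q:ℝ) * (((S * 108 / 10 ^ 160 : ℕ):ℝ) + 1) + N * (dst (q * La) T + 2 * q * 8192) ≤ S / 2 ^ 35 := by
      have h1 : ((q * (S * 108 / 10 ^ 160 + 1) + N * (dst (q * La) T + 2 * q * 8192) : ℕ):ℝ) ≤ ((S / 2 ^ 35 : ℕ):ℝ) := by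
        exact_mod_cast hN
      have h2 := (fl_bd S (2 ^ 35) (by positivity)).2
      push_cast at h1 h2
      linarith
    have hf := (fl_bd (S * 108) (10 ^ 160) (by positivity)).1
    generalize S * 108 / 10 ^ 160 = G at *
    have h1 : |(q:ℝ) * (S * (n * l - d * t + (ν - g)))| ≤ q * (S * (108 / 10 ^ 160)) := by
      rw [abs_mul, abs_mul, abs_of_nonneg hq0, abs_of_pos hS0]
      gcongr
    have h1' : (q:ℝ) * (S * (108 / 10 ^ 160)) ≤ q * ((G:ℝ) + 1) := by
      refine mul_le_mul_of_nonneg_left ?_ hq0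
      rw [mul_div_assoc']
      push_cast at hf
      linarith
    have h2 : |(n:ℝ) * (S * (q * l - p * t))| ≤ N * (dst (q * La) T + 2 * q * 8192) := by
      rw [abs_mul, abs_of_nonneg (Nat.cast_nonneg n)]
      exact mul_le_mul (by exact_mod_cast hn) hp (abs_nonneg _) (by positivity)
    have h3 : |(S:ℝ) * ((q:ℝ) * (ν - g) - (q * d - n * p) * t)| ≤ S / 2 ^ 35 := by
      have e : (S:ℝ) * ((q:ℝ) * (ν - g) - (q * d - n * p) * t) =
        q * (S * (n * l - d * t + (ν - g))) - n * (S * (q * l - p * t)) := by ring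
      rw [e]
      refine le_trans (abs_sub _ _) ?_
      linarith
    rw [abs_mul, abs_of_pos hS0, div_eq_mul_one_div] at h3
    exact le_of_mul_le_mul_left h3 hS0
  have hm2 : |(q:ℝ) * (F * ((ν - g) / t)) - (q * d - n * p) * F| ≤ 512 * D := by
    have e : (q:ℝ) * (F * ((ν - g) / t)) - (q * d - n * p) * F =
      F * (((q:ℝ) * (ν - g) - (q * d - n * p) * t) / t) := by field_simp
    rw [e, abs_mul, abs_div, abs_of_pos ht0, abs_of_pos hF0r]
    calc (F:ℝ) * (|(q:ℝ) * (ν - g) - (q * d - n * p) * t| / t) ≤ F * (1 / 2 ^ 35) := by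
          refine mul_le_mul_of_nonneg_left (le_trans (div_le_self (abs_nonneg _) ht) hm) hF0r.le
      _ = 512 * D := by rw [hFr]; ring
  generalize Ua * F / T = W at hW hx
  have hqq : |(q:ℝ) * (w + W) - q * (F * (1 + (ν - g) / t))| ≤ 5 * D := by
    have e : (q:ℝ) * (w + W) - q * (F * (1 + (ν - g) / t)) =
      q * ((w - F * (1 - g / t)) + (W - F * (ν / t))) := by ring
    rw [e, abs_mul, abs_of_nonneg hq0]
    have := abs_add_le ((w:ℝ) - F * (1 - g / t)) (W - F * (ν / t))
    calc (q:ℝ) * |(w - F * (1 - g / t)) + (W - F * (ν / t))| ≤ q * 5 := by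
          refine mul_le_mul_of_nonneg_left (by linarith) hq0
      _ ≤ 5 * D := by linarith
  -- modular
  have hx2 := Nat.mod_lt (q * w + ((q * W) % F + 1024 * D)) hF0
  have hx3 := Nat.mod_add_div (q * w + ((q * W) % F + 1024 * D)) F
  have hx4 := Nat.mod_add_div (q * W) F
  generalize (q * w + ((q * W) % F + 1024 * D)) % F = x at *
  generalize (q * w + ((q * W) % F + 1024 * D)) / F = z at *
  generalize (q * W) % F = r at *
  generalize (q * W) / F = s at *
  have k1 : (x:ℝ) + F * z = q * w + (r + 1024 * D) := by exact_mod_cast hx3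
  have k2 : (r:ℝ) + F * s = q * W := by exact_mod_cast hx4
  have k3 : (2048:ℝ) * D ≤ x := by exact_mod_cast hx
  have k4 : (x:ℝ) < F := by exact_mod_cast hx2
  have hj : |((((z:ℤ) + s - q - (q * d - n * p) : ℤ)):ℝ) * F + (x - 1024 * D)| ≤ 517 * D := by
    have e : ((((z:ℤ) + s - q - (q * d - n * p) : ℤ)):ℝ) * F + (x - 1024 * D) =
      ((q:ℝ) * (w + W) - q * (F * (1 + (ν - g) / t))) + ((q:ℝ) * (F * ((ν - g) / t)) - (q * d - n * p) * F) := by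
      push_cast
      linear_combination k1 + k2
    rw [e]
    refine le_trans (abs_add_le _ _) ?_
    linarith
  generalize (z:ℤ) + s - q - (q * d - n * p) = j at hj
  rw [abs_le] at hj
  rcases le_or_gt 0 j with h0 | h0
  · have : (0:ℝ) ≤ j := by exact_mod_cast h0
    have := mul_nonneg this hF0r.le
    linarith [hj.2]
  · have : (j:ℝ) ≤ -1 := by exact_mod_cast (by omega : j ≤ -1)
    have := mul_le_mul_of_nonneg_right this hF0r.le
    linarith [hj.1]

theorem v_facts {k : ℕ} {α : ℝ} (hα : IsAlpha k α) (a : ℕ) (ha : 1 ≤ a) (ha9 : a ≤ 9) :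
    0 ≤ Real.log (9 * Cc k α / a) + Real.log 10 ∧ Real.log (9 * Cc k α / a) + Real.log 10 ≤ 8 ∧
    0 ≤ Real.log α ∧ Real.log α ≤ 1 / 2 + 1 / 4 := by
  have hC := Cc_ge hα
  have hC2 := Cc_le hα
  have ha0 : (1:ℝ) ≤ a := by exact_mod_cast ha
  have ha9' : (a:ℝ) ≤ 9 := by exact_mod_cast ha9
  have ev : Real.log (9 * Cc k α / a) + Real.log 10 = Real.log (9 * Cc k α / a * 10) := by
    rw [Real.log_mul (by positivity) (by norm_num)]
  have hd1 : (2:ℝ) ≤ 9 * Cc k α / a * 10 := by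
    rw [div_mul_eq_mul_div, le_div_iff₀ (by linarith)]; linarith
  have hd2 : 9 * Cc k α / a * 10 ≤ (2:ℝ) ^ 8 := by
    rw [div_mul_eq_mul_div, div_le_iff₀ (by linarith)]; linarith
  have hl2 := log_facts
  have hv0 : 0 ≤ Real.log (9 * Cc k α / a) + Real.log 10 := by
    rw [ev]; exact Real.log_nonneg (by linarith)
  have hv8 : Real.log (9 * Cc k α / a) + Real.log 10 ≤ 8 := by
    rw [ev]
    refine (Real.log_le_log (by linarith) hd2).trans ?_
    rw [Real.log_pow]; push_cast; linarith [hl2.2.1]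
  have hα2 : 0 ≤ Real.log α ∧ Real.log α ≤ 1 / 2 + 1 / 4 := by
    refine ⟨Real.log_nonneg hα.h1.le, ?_⟩
    have := Real.log_le_log (by linarith [hα.h1]) hα.h2.le
    linarith [hl2.2.1]
  exact ⟨hv0, hv8, hα2⟩

theorem one_le_log10 : 1 ≤ Real.log 10 := by
  have := log_facts.2.2.2
  have h' := Real.log_le_log (by norm_num) (show (5:ℝ) ≤ 10 by norm_num)
  linarith

theorem runB_sound {ne j0 nj na k0 nk k : ℕ} {α : ℝ} (hα : IsAlpha k α) (hk : k ≤ 470)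
    (h : runB 1000 ne j0 nj na k0 nk = true) (hk0 : k0 ≤ k) (hk1 : k < k0 + nk) (a : ℕ) (ha : 1 ≤ a) (ha9 : a ≤ 9)
    (n d : ℕ) :
    (a ≤ na → n ≤ 2 ^ 425 → d + 1 ≤ 2 ^ 425 →
      |n * Real.log α - d * Real.log 10 + Real.log (9 * Cc k α / a)| ≤ 216 / 10 ^ 160 → False) ∧
    (a ≤ na → n ≤ 2 ^ 20 → d + 1 ≤ 2 ^ 20 →
      |n * Real.log α - d * Real.log 10 + Real.log (9 * Cc k α / a)| ≤ 216 / 10 ^ 65 → False) ∧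
    (∀ b i : ℕ, b ≤ 9 → j0 ≤ 10 * (a - 1) + b → 10 * (a - 1) + b < j0 + nj → i < ne → n ≤ 2 ^ 425 →
      |n * Real.log α - d * Real.log 10 + Real.log (9 * Cc k α / a) -
        Real.log (1 + 9 * ((b:ℝ) - a) / (a * 10 ^ (65 + i)))| ≤ 108 / 10 ^ 160 → False) := by
  unfold runB at h
  obtain ⟨L2, L3, L5, L7, h2, h3, h5, h7, h⟩ := lg_sound (by norm_num) h
  rw [force_eq, force_eq, force_eq, force_eq, force_eq, force_eq, force_eq, force_eq, force_eq, mkL_eq] at h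
  have h := allb_spec _ _ h (k - k0) (by omega)
  change dat 1000 (2 ^ 1000) (k0 + (k - k0)) L2 L3 L5 _ = true at h
  rw [Nat.add_sub_cancel' hk0] at h
  obtain ⟨La, U, hLa, hU, h⟩ := dat_sound hα hk (by norm_num) h2 h3 h5 h
  unfold chkB at h
  rw [force_eq, force_eq, force_eq] at h
  generalize cfl (2 ⋏ 466) (L2 ⊹ L5) La = q at h
  generalize cfl (2 ⋏ 60) (L2 ⊹ L5) La = qA at h
  rw [Bool.and_eq_true, Bool.and_eq_true, Bool.and_eq_true, Bool.and_eq_true] at h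
  obtain ⟨g1, g2, g3, g4, g5⟩ := h
  have hS' : (((2:ℕ) ^ 1000 : ℕ) : ℝ) = 2 ^ 1000 := by rw [Nat.cast_pow]; rfl
  obtain ⟨hT, hT1⟩ := T_ap (by norm_num) h2 h5
  have hUa := setup hα (by norm_num) h2 h3 h5 h7 hU a ha ha9
  have hT0 : 0 < L2 + L5 := by
    have : (0:ℝ) < (L2 + L5 : ℕ) := lt_of_lt_of_le (by positivity) hT1
    exact_mod_cast this
  have ea : Nat.succ (a - 1) = a := by omega
  rw [← hS'] at hLa hUa hT hT1
  refine ⟨fun hna hn hd hL => ?_, fun hna hn hd hL => ?_, fun b i hb hj0 hj1 hi hn hL => ?_⟩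
  · have g1 := allb_spec _ _ g1 (a - 1) (by omega)
    simp only [ea] at g1
    refine tst_sound (n := n) (d := d + 1) (l := Real.log α) (t := Real.log 10)
      (v := Real.log (9 * Cc k α / a) + Real.log 10) g1 (hLa.le (by norm_num)) (hT.le (by norm_num)) hUa hT0 hn hd ?_
    push_cast
    rw [show (n:ℝ) * Real.log α - (d + 1) * Real.log 10 + (Real.log (9 * Cc k α / a) + Real.log 10) =
      n * Real.log α - d * Real.log 10 + Real.log (9 * Cc k α / a) by ring]
    exact hL
  · have g2 := allb_spec _ _ g2 (a - 1) (by omega)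
    simp only [ea] at g2
    refine tst_sound (n := n) (d := d + 1) (l := Real.log α) (t := Real.log 10)
      (v := Real.log (9 * Cc k α / a) + Real.log 10) g2 (hLa.le (by norm_num)) (hT.le (by norm_num)) hUa hT0 hn hd ?_
    push_cast
    rw [show (n:ℝ) * Real.log α - (d + 1) * Real.log 10 + (Real.log (9 * Cc k α / a) + Real.log 10) =
      n * Real.log α - d * Real.log 10 + Real.log (9 * Cc k α / a) by ring]
    exact hL
  · have g5 := chkl_spec _ _ _ g5 (10 * (a - 1) + b - j0) (by simp; omega)
    rw [force_eq] at g5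
    have e1 : j0 + (10 * (a - 1) + b - j0) = 10 * (a - 1) + b := by omega
    have e2 : (10 * (a - 1) + b) / 10 = a - 1 := by omega
    have e3 : (10 * (a - 1) + b) % 10 = b := by omega
    simp only [List.append_nil, List.getElem_map, List.getElem_range] at g5
    change one q ((q * ((U - lga L2 L3 L5 L7 (Nat.succ ((j0 + (10 * (a - 1) + b - j0)) / 10))) * 2 ^ 530 / (L2 + L5))) % 2 ^ 530 + 2 ^ 496)
      (pk (fun _ => 1) ne) ((2 ^ 530 - 1) * pk (fun _ => 1) ne) ((2 ^ 530 - 2 ^ 497) * pk (fun _ => 1) ne)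
      (2 ^ 530 * pk (fun _ => 1) ne)
      (pk (slot (2 ^ 530 * 2 ^ 1000) (2 ^ 530) (L2 + L5) (Nat.succ ((j0 + (10 * (a - 1) + b - j0)) / 10))
        ((j0 + (10 * (a - 1) + b - j0)) % 10)) ne) = true at g5
    rw [e1, e2, e3, ea] at g5
    have g3 : q ≤ 2 ^ 486 := Nat.le_of_ble_eq_true g3
    have g4 := Nat.le_of_ble_eq_true g4
    have ht := one_le_log10
    have hsl := fun i => slot_sound (i := i) (b := b) rfl (le_of_eq hS'.symm) hT hT1 ht ha ha9 hb
    have hx := one_sound (by norm_num) (by norm_num) (fun i _ => ?_) g5 i hi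
    · obtain ⟨hv0, hv8, hα2⟩ := v_facts hα a ha ha9
      refine pack_contra (D := 2 ^ 486) (n := n) (d := d + 1) (w := slot (2 ^ 530 * 2 ^ 1000) (2 ^ 530) (L2 + L5) a b i)
        rfl (by norm_num) (le_of_eq hS'.symm) hT hT1 ht hα2 hLa hUa hv0 hv8 g3 g4 (hsl i).1 ?_ hn ?_
      · have e4 : 2048 * 2 ^ 486 = 2 ^ 497 := by norm_num
        have e5 : 1024 * 2 ^ 486 = 2 ^ 496 := by norm_num
        rw [e4, e5]
        exact hx
      · push_cast
        rw [show (n:ℝ) * Real.log α - (d + 1) * Real.log 10 + (Real.log (9 * Cc k α / a) + Real.log 10 -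
          Real.log (1 + 9 * ((b:ℝ) - a) / (a * 10 ^ (65 + i)))) =
          n * Real.log α - d * Real.log 10 + Real.log (9 * Cc k α / a) -
            Real.log (1 + 9 * ((b:ℝ) - a) / (a * 10 ^ (65 + i))) by ring]
        exact hL
    · have h1 := (hsl i).2
      have h2 := Nat.mod_lt (q * ((U - lga L2 L3 L5 L7 a) * 2 ^ 530 / (L2 + L5))) (show 0 < 2 ^ 530 by positivity)
      have h3 := Nat.mul_le_mul g3 h1
      refine lt_of_lt_of_le (Nat.add_lt_add_of_le_of_lt h3 (Nat.add_lt_add_right h2 _)) ?_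
      norm_num

theorem rC0 : runC 3320 8 2 1 = true := by decide +kernel
theorem rC1 : runC 3320 9 3 78 = true := by decide +kernel
theorem rC2 : runC 3320 9 81 78 = true := by decide +kernel
theorem rC3 : runC 3320 9 159 78 = true := by decide +kernel
theorem rC4 : runC 3320 9 237 78 = true := by decide +kernel
theorem rC5 : runC 3320 9 315 78 = true := by decide +kernel
theorem rC6 : runC 3320 9 393 78 = true := by decide +kernel
theorem rB0 : runB 1000 95 0 80 8 2 1 = true := by decide +kernel
theorem rB0' : runB 1000 70 80 9 0 2 1 = true := by decide +kernel
theorem rB1 : runB 1000 95 0 90 9 3 117 = true := by decide +kernel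
theorem rB2 : runB 1000 95 0 90 9 120 117 = true := by decide +kernel
theorem rB3 : runB 1000 95 0 90 9 237 117 = true := by decide +kernel
theorem rB4 : runB 1000 95 0 90 9 354 117 = true := by decide +kernel
theorem r91 : run9 3320 (2 ⋏ 1601) 512 = true := by decide +kernel
theorem r92 : run9 1000 (2 ⋏ 425) 135 = true := by decide +kernel
theorem r93 : run9 1000 (2 ⋏ 20) 65 = true := by decide +kernel


set_option exponentiation.threshold 2000

theorem Cc_two {α : ℝ} (hα : IsAlpha 2 α) : Cc 2 α = 1 := by
  have h := hα.h3
  have h1 := hα.h1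
  have h4 : α ^ 2 = α + 1 := by
    have : (α - 1) * (α ^ 2 - α - 1) = 0 := by linear_combination -h
    rcases mul_eq_zero.mp this with h5 | h5
    · linarith
    · linarith
  have hd := hα.den_pos
  unfold Cc
  have hd' : α * (((2:ℕ) + 1) * α - 2 * (2:ℕ)) ≠ 0 := by
    push_cast at hd ⊢
    refine mul_ne_zero (by linarith) (by linarith)
  rw [div_eq_one_iff_eq hd']
  push_cast
  linear_combination -h4

theorem L_two {α : ℝ} (hα : IsAlpha 2 α) (x : ℝ) : x + Real.log (9 * Cc 2 α / (9:ℕ)) = x := by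
  rw [Cc_two hα]; norm_num

theorem stC {k : ℕ} {α : ℝ} (hα : IsAlpha k α) (hk : k ≤ 470) (a : ℕ) (ha : 1 ≤ a) (ha9 : a ≤ 9)
    (n d : ℕ) (hn0 : 1 ≤ n) (hn : n ≤ 2 ^ 1601) (hd : d + 1 ≤ 2 ^ 1601)
    (hL : |n * Real.log α - d * Real.log 10 + Real.log (9 * Cc k α / a)| ≤ 216 / 10 ^ 512) : False := by
  have h2 := hα.hk
  by_cases hk2 : k = 2
  · subst hk2
    by_cases h9 : a = 9
    · subst h9
      rw [L_two hα] at hL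
      exact run9_sound hα (by norm_num) r91 n d hn0 hn (Nat.le_of_succ_le hd) hL
    · exact runC_sound hα hk (by norm_num) rC0 le_rfl (by norm_num) a ha ha9 (by omega) n d hn hd hL
  · rcases (by omega : k < 81 ∨ (81 ≤ k ∧ k < 159) ∨ (159 ≤ k ∧ k < 237) ∨ (237 ≤ k ∧ k < 315) ∨
      (315 ≤ k ∧ k < 393) ∨ 393 ≤ k) with h | h | h | h | h | h
    · exact runC_sound hα hk (by norm_num) rC1 (by omega) (by omega) a ha ha9 ha9 n d hn hd hL
    · exact runC_sound hα hk (by norm_num) rC2 (by omega) (by omega) a ha ha9 ha9 n d hn hd hL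
    · exact runC_sound hα hk (by norm_num) rC3 (by omega) (by omega) a ha ha9 ha9 n d hn hd hL
    · exact runC_sound hα hk (by norm_num) rC4 (by omega) (by omega) a ha ha9 ha9 n d hn hd hL
    · exact runC_sound hα hk (by norm_num) rC5 (by omega) (by omega) a ha ha9 ha9 n d hn hd hL
    · exact runC_sound hα hk (by norm_num) rC6 (by omega) (by omega) a ha ha9 ha9 n d hn hd hL

theorem rB_ex {k : ℕ} (h3 : 3 ≤ k) (hk : k ≤ 470) :
    ∃ k0 nk, runB 1000 95 0 90 9 k0 nk = true ∧ k0 ≤ k ∧ k < k0 + nk := by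
  rcases (by omega : k < 120 ∨ (120 ≤ k ∧ k < 237) ∨ (237 ≤ k ∧ k < 354) ∨ 354 ≤ k) with h | h | h | h
  · exact ⟨_, _, rB1, by omega, by omega⟩
  · exact ⟨_, _, rB2, by omega, by omega⟩
  · exact ⟨_, _, rB3, by omega, by omega⟩
  · exact ⟨_, _, rB4, by omega, by omega⟩

/-- bound for `e` depending on the case -/
def eB (k a : ℕ) : ℕ := if k = 2 ∧ a = 9 then 135 else 160

theorem stD {k : ℕ} {α : ℝ} (hα : IsAlpha k α) (hk : k ≤ 470) (a : ℕ) (ha : 1 ≤ a) (ha9 : a ≤ 9)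
    (n d : ℕ) (hn0 : 1 ≤ n) (hn : n ≤ 2 ^ 425) (hd : d + 1 ≤ 2 ^ 425)
    (hL : |n * Real.log α - d * Real.log 10 + Real.log (9 * Cc k α / a)| ≤ 216 / 10 ^ (eB k a)) : False := by
  have h2 := hα.hk
  unfold eB at hL
  by_cases hk2 : k = 2
  · subst hk2
    by_cases h9 : a = 9
    · subst h9
      rw [L_two hα] at hL
      exact run9_sound hα (by norm_num) r92 n d hn0 hn (Nat.le_of_succ_le hd) (by simpa using hL)
    · rw [if_neg (by omega)] at hL
      exact (runB_sound hα hk rB0 le_rfl (by norm_num) a ha ha9 n d).1 (by omega) hn hd hL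
  · rw [if_neg (by omega)] at hL
    obtain ⟨k0, nk, h, h', h''⟩ := rB_ex (by omega : 3 ≤ k) hk
    exact (runB_sound hα hk h h' h'' a ha ha9 n d).1 ha9 hn hd hL

theorem stA {k : ℕ} {α : ℝ} (hα : IsAlpha k α) (hk : k ≤ 470) (a : ℕ) (ha : 1 ≤ a) (ha9 : a ≤ 9)
    (n d : ℕ) (hn0 : 1 ≤ n) (hn : n ≤ 2 ^ 20) (hd : d + 1 ≤ 2 ^ 20)
    (hL : |n * Real.log α - d * Real.log 10 + Real.log (9 * Cc k α / a)| ≤ 216 / 10 ^ 65) : False := by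
  have h2 := hα.hk
  by_cases hk2 : k = 2
  · subst hk2
    by_cases h9 : a = 9
    · subst h9
      rw [L_two hα] at hL
      exact run9_sound hα (by norm_num) r93 n d hn0 hn (Nat.le_of_succ_le hd) hL
    · exact (runB_sound hα hk rB0 le_rfl (by norm_num) a ha ha9 n d).2.1 (by omega) hn hd hL
  · obtain ⟨k0, nk, h, h', h''⟩ := rB_ex (by omega : 3 ≤ k) hk
    exact (runB_sound hα hk h h' h'' a ha ha9 n d).2.1 ha9 hn hd hL

theorem stB {k : ℕ} {α : ℝ} (hα : IsAlpha k α) (hk : k ≤ 470) (a b e : ℕ) (ha : 1 ≤ a) (ha9 : a ≤ 9) (hb : b ≤ 9)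
    (n d : ℕ) (hn : n ≤ 2 ^ 425) (hab : b ≠ a) (he : 65 ≤ e) (he2 : e < eB k a)
    (hL : |n * Real.log α - d * Real.log 10 + Real.log (9 * Cc k α / a) -
        Real.log (1 + 9 * ((b:ℝ) - a) / (a * 10 ^ e))| ≤ 108 / 10 ^ 160) : False := by
  have h2 := hα.hk
  obtain ⟨i, rfl⟩ := Nat.exists_eq_add_of_le he
  unfold eB at he2
  by_cases hk2 : k = 2
  · subst hk2
    by_cases h9 : a = 9
    · rw [if_pos ⟨rfl, h9⟩] at he2
      exact (runB_sound hα hk rB0' le_rfl (by norm_num) a ha ha9 n d).2.2 b i hb (by omega) (by omega) (by omega) hn hL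
    · rw [if_neg (by omega)] at he2
      exact (runB_sound hα hk rB0 le_rfl (by norm_num) a ha ha9 n d).2.2 b i hb (by omega) (by omega) (by omega) hn hL
  · rw [if_neg (by omega)] at he2
    obtain ⟨k0, nk, h, h', h''⟩ := rB_ex (by omega : 3 ≤ k) hk
    exact (runB_sound hα hk h h' h'' a ha ha9 n d).2.2 b i hb (by omega) (by omega) (by omega) hn hL


set_option exponentiation.threshold 5000

section
open Polynomial

theorem growth (Z : ℕ) (hZ : 2048 ≤ Z) : 2 ^ 1300 * Z ^ 68 ≤ 2 ^ Z := by
  induction Z, hZ using Nat.le_induction with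
  | base => norm_num
  | succ Z hZ ih =>
    have h : 2048 ^ 68 * (Z + 1) ^ 68 ≤ 2049 ^ 68 * Z ^ 68 := by
      rw [← mul_pow, ← mul_pow]
      exact Nat.pow_le_pow_left (by omega) _
    have h2 : (2049:ℕ) ^ 68 * Z ^ 68 ≤ 2048 ^ 68 * (2 * Z ^ 68) := by
      rw [← mul_assoc]
      exact Nat.mul_le_mul_right _ (by norm_num)
    have h3 : (Z + 1) ^ 68 ≤ 2 * Z ^ 68 := Nat.le_of_mul_le_mul_left (h.trans h2) (by positivity)
    calc 2 ^ 1300 * (Z + 1) ^ 68 ≤ 2 ^ 1300 * (2 * Z ^ 68) := Nat.mul_le_mul_left _ h3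
      _ = 2 * (2 ^ 1300 * Z ^ 68) := by ring
      _ ≤ 2 * 2 ^ Z := Nat.mul_le_mul_left _ ih
      _ = 2 ^ (Z + 1) := by ring

theorem exp_bound {Λ : ℝ} {Q E : ℕ} (h : 1 ≤ |Λ| * 2 ^ Q) (hL : |Λ| ≤ 216 / 10 ^ E) (hQ : 16 ≤ Q) : E ≤ Q := by
  by_contra hc
  push Not at hc
  have h1 : (10:ℝ) ^ E ≤ 216 * 2 ^ Q := by
    have : |Λ| * 2 ^ Q ≤ 216 / 10 ^ E * 2 ^ Q := by gcongr
    have h2 := h.trans this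
    rw [div_mul_eq_mul_div, le_div_iff₀ (by positivity), one_mul] at h2
    exact h2
  have h2 : (8:ℝ) ^ E ≤ 10 ^ E := by gcongr; norm_num
  have h3 : (8:ℝ) ^ Q ≤ 8 ^ E := pow_le_pow_right₀ (by norm_num) hc.le
  have h4 : (8:ℝ) ^ Q = 4 ^ Q * 2 ^ Q := by rw [← mul_pow]; norm_num
  have h5 : (4:ℝ) ^ 16 ≤ 4 ^ Q := pow_le_pow_right₀ (by norm_num) hQ
  have h6 : (0:ℝ) < 2 ^ Q := by positivity
  have h7 : (216:ℝ) < 4 ^ 16 := by norm_num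
  nlinarith only [h1, h2, h3, h4, h5, h6, h7]

theorem dom_sub {P Q : ℤ[X]} {c d : ℝ} (hP : Dom P c) (hQ : Dom Q d) : Dom (P - Q) (c + d) := by
  have h := hP.add ((Dom.C (-1)).mul hQ)
  have e : P + C (-1) * Q = P - Q := by rw [C_neg, C_1]; ring
  rw [e] at h
  exact h.mono (by norm_num)

theorem dom_GG : Dom GG 135 := by
  have h := ((Dom.C 9).mul (dom_sub Dom.X Dom.one)).mul (dom_sub ((Dom.C 2).mul Dom.X) (Dom.C 1))
  refine Dom.mono h ?_
  norm_num

theorem dom_HH (k M : ℕ) (hk : k ≤ 470) : Dom (HH k M) (M * 1882) := by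
  have h := (Dom.C (M:ℤ)).mul (dom_sub ((Dom.C ((k:ℤ) + 1)).mul Dom.X) (Dom.C (2 * (k:ℤ))))
  refine Dom.mono h ?_
  have hk' : (k:ℝ) ≤ 470 := by exact_mod_cast hk
  push_cast
  rw [abs_of_nonneg (Nat.cast_nonneg M), abs_of_nonneg (by positivity), abs_of_nonneg (by positivity)]
  refine mul_le_mul_of_nonneg_left ?_ (Nat.cast_nonneg M)
  linarith

theorem quo_eq {k : ℕ} {α : ℝ} (hα : IsAlpha k α) (M : ℕ) (hM : 1 ≤ M) :
    aeval α GG / aeval α (HH k M) = 9 * Cc k α / M * α := by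
  rw [GG_eval, HH_eval]
  unfold Cc
  have h1 := hα.h1
  have h2 := hα.den_pos
  have h3 : ((k:ℝ) + 1) * α - 2 * k ≠ 0 := by linarith
  have h4 : (M:ℝ) ≠ 0 := by
    have : 0 < M := hM
    positivity
  have h5 : α ≠ 0 := by linarith
  field_simp

theorem bk {k : ℕ} {α : ℝ} (hα : IsAlpha k α) (hk : k ≤ 470) {M Hh Z n d E : ℕ} (hM : 1 ≤ M) (hZ : 2048 ≤ Z)
    (hn0 : 1 ≤ n) (hn : n ≤ 2 ^ Z) (hd : d ≤ 2 ^ Z) (hHh : 16 ≤ Hh) (hMH : M * 1882 ≤ 2 ^ Hh)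
    (hN : 2 ^ 141 * Hh ^ 2 * Z ^ 12 ≤ 2 ^ Z)
    (hind : ∀ x y z : ℤ, x * Real.log α + y * Real.log (10:ℕ) + z * Real.log (aeval α GG / aeval α (HH k M)) = 0 →
      x = 0 ∧ y = 0 ∧ z = 0)
    (hL : |n * Real.log α - d * Real.log 10 + Real.log (9 * Cc k α / M)| ≤ 216 / 10 ^ E) :
    E ≤ 2 ^ 201 * Hh ^ 3 * Z ^ 17 := by
  have hM1 : (1:ℝ) ≤ M := by exact_mod_cast hM
  have hC1 := Cc_ge hα
  have hC2 := Cc_le hα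
  have hα1 := hα.ge
  have hα2 := hα.h2
  have hH2 : (2:ℝ) ^ 16 ≤ 2 ^ Hh := pow_le_pow_right₀ (by norm_num) hHh
  have hq := quo_eq hα M hM
  have hpos : 0 < 9 * Cc k α / M * α := by positivity
  have hlM : Real.log M ≤ Hh := by
    have h1 : (M:ℝ) ≤ 2 ^ Hh := by
      have : ((M * 1882 : ℕ):ℝ) ≤ ((2 ^ Hh : ℕ):ℝ) := by exact_mod_cast hMH
      push_cast at this; linarith
    have h2 := Real.log_le_log (by linarith) h1
    rw [Real.log_pow] at h2
    have h3 := log_facts.2.1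
    have h4 : (0:ℝ) ≤ Hh := Nat.cast_nonneg _
    nlinarith only [h2, h3, h4]
  have hl3 : |Real.log (aeval α GG / aeval α (HH k M))| ≤ Hh := by
    rw [hq, abs_le]
    constructor
    · have h1 : (M:ℝ)⁻¹ ≤ 9 * Cc k α / M * α := by
        rw [inv_eq_one_div, div_mul_eq_mul_div]
        gcongr
        nlinarith only [hC1, hα1]
      have h2 := Real.log_le_log (by positivity) h1
      rw [Real.log_inv] at h2
      linarith
    · have h1 : 9 * Cc k α / M * α ≤ 2 ^ 5 := by
        rw [div_mul_eq_mul_div, div_le_iff₀ (by linarith)]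
        nlinarith only [hC1, hC2, hα1, hα2, hM1]
      have h2 := Real.log_le_log hpos h1
      rw [Real.log_pow] at h2
      have h3 := log_facts.2.1
      have h4 : (16:ℝ) ≤ Hh := by exact_mod_cast hHh
      push_cast at h2
      linarith
  have hB := baker_lower hα hk Hh Z 10 GG (HH k M) ((n:ℤ) - 1) (-(d:ℤ)) 1 hZ (by omega) (by norm_num) (by norm_num)
    (dom_GG.mono (by linarith)) ((dom_HH k M hk).mono (by exact_mod_cast hMH)) (GG_pos hα) (HH_pos hα hM) hl3
    (by
      rw [abs_of_nonneg (by omega)]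
      have : (n:ℤ) ≤ 2 ^ Z := by exact_mod_cast hn
      omega)
    (by rw [abs_neg, abs_of_nonneg (by omega)]; exact_mod_cast hd)
    (by exact_mod_cast Nat.one_le_two_pow) le_rfl hN hind
  refine exp_bound hB ?_ ?_
  · have e : (((n:ℤ) - 1 : ℤ):ℝ) * Real.log α + ((-(d:ℤ) : ℤ):ℝ) * Real.log (10:ℕ) +
      ((1:ℤ):ℝ) * Real.log (aeval α GG / aeval α (HH k M)) =
      n * Real.log α - d * Real.log 10 + Real.log (9 * Cc k α / M) := by
      rw [hq, Real.log_mul (by positivity) (by positivity)]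
      push_cast
      ring
    rw [e]; exact hL
  · calc 16 ≤ 2 ^ 201 * 1 * 1 := by norm_num
      _ ≤ _ := Nat.mul_le_mul (Nat.mul_le_mul_left _ (Nat.one_le_pow _ _ (by omega))) (Nat.one_le_pow _ _ (by omega))

theorem bk9 {α : ℝ} (hα : IsAlpha 2 α) {Z n d E : ℕ} (hZ : 2048 ≤ Z)
    (hd0 : 1 ≤ d) (hn : n ≤ 2 ^ Z) (hd : d ≤ 2 ^ Z)
    (hN : 2 ^ 141 * 16 ^ 2 * Z ^ 12 ≤ 2 ^ Z)
    (hL : |n * Real.log α - d * Real.log 10| ≤ 216 / 10 ^ E) :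
    E ≤ 2 ^ 201 * 16 ^ 3 * Z ^ 17 := by
  have e2 : aeval α (C 2 : ℤ[X]) / aeval α (1:ℤ[X]) = 2 := by
    rw [aeval_C, map_one]; norm_num
  have hB := baker_lower hα (by norm_num) 16 Z 5 (C 2) 1 (-(n:ℤ)) d d hZ (by omega) (by norm_num) (by norm_num)
    ((Dom.C 2).mono (by norm_num)) (Dom.one.mono (by norm_num))
    (by rw [aeval_C]; norm_num) (by simp)
    (by
      rw [e2, abs_of_nonneg (by linarith [log_facts.1])]
      push_cast
      linarith [log_facts.2.1])
    (by rw [abs_neg, abs_of_nonneg (by omega)]; exact_mod_cast hn)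
    (by rw [abs_of_nonneg (by omega)]; exact_mod_cast hd)
    (by exact_mod_cast hd) (by exact_mod_cast hd0) hN (ind_52 hα)
  refine exp_bound hB ?_ ?_
  · rw [e2]
    have e : Real.log 10 = Real.log 2 + Real.log 5 := by
      rw [← Real.log_mul (by norm_num) (by norm_num)]; norm_num
    have e' : ((-(n:ℤ) : ℤ):ℝ) * Real.log α + ((d:ℤ):ℝ) * Real.log (5:ℕ) + ((d:ℤ):ℝ) * Real.log 2 =
      -(n * Real.log α - d * Real.log 10) := by
      rw [e]; push_cast; ring
    rw [e', abs_neg]; exact hL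
  · calc 16 ≤ 2 ^ 201 * 16 ^ 3 * 1 := by norm_num
      _ ≤ _ := Nat.mul_le_mul_left _ (Nat.one_le_pow _ _ (by omega))

theorem v3_ne (M : ℕ) (hM : ¬ 9 ∣ M) : padicValNat 3 9 ≠ padicValNat 3 M := by
  intro h
  apply hM
  haveI : Fact (Nat.Prime 3) := ⟨Nat.prime_three⟩
  have h9 : padicValNat 3 9 = 2 := by
    rw [show 9 = 3 ^ 2 by norm_num, padicValNat.prime_pow]
  have := pow_padicValNat_dvd (p := 3) (n := M)
  rw [← h, h9] at this
  exact this

theorem ind_a {k : ℕ} {α : ℝ} (hα : IsAlpha k α) (hk : k ≤ 470) (a b e : ℕ) (ha : 1 ≤ a) (ha9 : a ≤ 9) (hb : b ≤ 9)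
    (he : 65 ≤ e) (M : ℕ) (hM : M + 9 * a = a * 10 ^ e + 9 * b) (hab : b ≠ a) (hM1 : 1 ≤ M) :
    ∀ x y z : ℤ, x * Real.log α + y * Real.log (10:ℕ) + z * Real.log (aeval α GG / aeval α (HH k M)) = 0 →
      x = 0 ∧ y = 0 ∧ z = 0 := by
  have h2 := hα.hk
  by_cases hk2 : k = 2
  · subst hk2
    by_cases h9 : a = 9
    · subst h9
      obtain ⟨f, rfl⟩ := Nat.exists_eq_add_of_le he
      have h100 : 10 ^ (65 + f) = 400 * (25 * 10 ^ 61 * 10 ^ f) := by rw [pow_add]; ring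
      have hpos : 1 ≤ 25 * 10 ^ 61 * 10 ^ f := Nat.one_le_iff_ne_zero.mpr (by positivity)
      rw [h100] at hM
      generalize 25 * 10 ^ 61 * 10 ^ f = u at hM hpos
      obtain ⟨p, hp, hp2, hp5, hpd⟩ := exists_prime_not_10 (400 * u + b - 9) (by omega) (by omega) (by omega)
      have hMe : M = 9 * (400 * u + b - 9) := by omega
      refine ind_2 hα M hM1 p hp hp2 hp5 ?_
      haveI : Fact p.Prime := ⟨hp⟩
      rw [hMe, padicValNat.mul (by norm_num) (by omega)]
      have := one_le_padicValNat_of_dvd (by omega) hpd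
      omega
    · refine ind_2 hα M hM1 3 Nat.prime_three (by norm_num) (by norm_num) (v3_ne M ?_)
      have h1 : 10 ^ e % 9 = 1 := by
        rw [Nat.pow_mod]; simp
      obtain ⟨u, hu⟩ : ∃ u, 10 ^ e = 9 * u + 1 := ⟨10 ^ e / 9, by omega⟩
      rw [hu] at hM
      have : a * (9 * u + 1) = 9 * (a * u) + a := by ring
      rw [this] at hM
      generalize a * u = w at hM
      omega
  · exact ind_ge3 hα (by omega) hk M hM1

theorem bk1 {k : ℕ} {α : ℝ} (hα : IsAlpha k α) (hk : k ≤ 470) {a Z n d E : ℕ} (ha : 1 ≤ a) (ha9 : a ≤ 9)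
    (hZ : 2048 ≤ Z) (hn0 : 1 ≤ n) (hn : n ≤ 2 ^ Z) (hd0 : 1 ≤ d) (hd : d ≤ 2 ^ Z)
    (hL : |n * Real.log α - d * Real.log 10 + Real.log (9 * Cc k α / a)| ≤ 216 / 10 ^ E) :
    E ≤ 2 ^ 213 * Z ^ 17 := by
  have h2 := hα.hk
  have hN : 2 ^ 141 * 16 ^ 2 * Z ^ 12 ≤ 2 ^ Z := by
    refine le_trans ?_ (growth Z hZ)
    exact Nat.mul_le_mul (by norm_num) (Nat.pow_le_pow_right (by omega) (by norm_num))
  rw [show 2 ^ 213 * Z ^ 17 = 2 ^ 201 * 16 ^ 3 * Z ^ 17 by norm_num]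
  by_cases hk2 : k = 2
  · subst hk2
    by_cases h9 : a = 9
    · subst h9
      rw [L_two hα] at hL
      exact bk9 hα hZ hd0 hn hd hN hL
    · exact bk hα hk ha hZ hn0 hn hd le_rfl (by omega) hN
        (ind_2 hα a ha 3 Nat.prime_three (by norm_num) (by norm_num) (v3_ne a (by omega))) hL
  · exact bk hα hk ha hZ hn0 hn hd le_rfl (by omega) hN (ind_ge3 hα (by omega) hk a ha) hL

end


set_option exponentiation.threshold 5000

theorem lam2 {k : ℕ} {α : ℝ} (hα : IsAlpha k α) (n d2 e M : ℕ) (he : 65 ≤ e)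
    (hM : (10:ℝ) ^ e / 2 ≤ M) (h : |9 * (Cc k α * α ^ n) - M * 10 ^ d2| ≤ 27) :
    |n * Real.log α - d2 * Real.log 10 + Real.log (9 * Cc k α / M)| ≤ 108 / 10 ^ (d2 + e) := by
  have hC := Cc_ge hα
  have hα1 := hα.h1
  have hp : (0:ℝ) < 10 ^ e := by positivity
  have hM0 : (0:ℝ) < M := by linarith
  have hY : (10:ℝ) ^ (d2 + e) / 2 ≤ M * 10 ^ d2 := by
    rw [pow_add]
    have : (0:ℝ) < 10 ^ d2 := by positivity
    nlinarith only [this, hM]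
  have hbig : (10:ℝ) ^ 3 ≤ 10 ^ (d2 + e) := pow_le_pow_right₀ (by norm_num) (by omega)
  have hY0 : (0:ℝ) < M * 10 ^ d2 := by positivity
  have hu : |9 * (Cc k α * α ^ n) / (M * 10 ^ d2) - 1| ≤ 54 / 10 ^ (d2 + e) := by
    rw [div_sub_one hY0.ne', abs_div, abs_of_pos hY0]
    calc _ ≤ 27 / ((10:ℝ) ^ (d2 + e) / 2) := by gcongr
      _ = _ := by rw [div_div_eq_mul_div]; norm_num
  have h54 : (54:ℝ) / 10 ^ (d2 + e) ≤ 1 / 2 := by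
    rw [div_le_iff₀ (by positivity)]; linarith
  have hl := log_lip (9 * (Cc k α * α ^ n) / (M * 10 ^ d2)) 1 (1/2) (by norm_num)
    (by have := (abs_le.mp hu).1; linarith) (by norm_num)
  rw [Real.log_one, sub_zero] at hl
  have e1 : n * Real.log α - d2 * Real.log 10 + Real.log (9 * Cc k α / M) =
      Real.log (9 * (Cc k α * α ^ n) / (M * 10 ^ d2)) := by
    have : 9 * (Cc k α * α ^ n) / (M * 10 ^ d2) = 9 * Cc k α / M * α ^ n / 10 ^ d2 := by
      field_simp
    rw [this, Real.log_div (x := 9 * Cc k α / M * α ^ n) (by positivity) (by positivity),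
      Real.log_mul (x := 9 * Cc k α / M) (by positivity) (by positivity), Real.log_pow, Real.log_pow]
    ring
  rw [e1]
  refine hl.trans ?_
  calc _ ≤ 54 / 10 ^ (d2 + e) / (1 / 2 : ℝ) := by gcongr
    _ = _ := by ring

theorem lam1 {k : ℕ} {α : ℝ} (hα : IsAlpha k α) (n d2 e M a b : ℕ) (he : 65 ≤ e) (ha : 1 ≤ a) (ha9 : a ≤ 9)
    (hb9 : b ≤ 9) (hM : M + 9 * a = a * 10 ^ e + 9 * b) :
    n * Real.log α - d2 * Real.log 10 + Real.log (9 * Cc k α / M) =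
      n * Real.log α - (d2 + e : ℕ) * Real.log 10 + Real.log (9 * Cc k α / a)
        - Real.log (1 + 9 * ((b:ℝ) - a) / (a * 10 ^ e)) ∧
    |Real.log (1 + 9 * ((b:ℝ) - a) / (a * 10 ^ e))| ≤ 100 / 10 ^ e ∧ (10:ℝ) ^ e / 2 ≤ M := by
  have hC := Cc_ge hα
  have ha' : (1:ℝ) ≤ a := by exact_mod_cast ha
  have ha9' : (a:ℝ) ≤ 9 := by exact_mod_cast ha9
  have hb' : (0:ℝ) ≤ b := Nat.cast_nonneg b
  have hb9' : (b:ℝ) ≤ 9 := by exact_mod_cast hb9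
  have hM' : (M:ℝ) + 9 * a = a * 10 ^ e + 9 * b := by exact_mod_cast hM
  have hbig : (10:ℝ) ^ 3 ≤ 10 ^ e := pow_le_pow_right₀ (by norm_num) (by omega)
  have hp : (0:ℝ) < 10 ^ e := by positivity
  have hy : |9 * ((b:ℝ) - a) / (a * 10 ^ e)| ≤ 80 / 10 ^ e := by
    rw [abs_div, abs_of_pos (show (0:ℝ) < a * 10 ^ e by positivity), div_le_div_iff₀ (by positivity) hp]
    have : |9 * ((b:ℝ) - a)| ≤ 80 * a := by
      rw [abs_le]; constructor <;> linarith
    nlinarith only [this, hp]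
  have hMl : (10:ℝ) ^ e / 2 ≤ M := by nlinarith only [hM', ha', ha9', hb', hbig]
  have h80 : (80:ℝ) / 10 ^ e ≤ 1 / 10 := by
    rw [div_le_iff₀ hp]; linarith
  have hM0 : (0:ℝ) < M := by linarith
  have e1 : (M:ℝ) = a * 10 ^ e * (1 + 9 * ((b:ℝ) - a) / (a * 10 ^ e)) := by
    field_simp
    linarith
  have h1y : (9/10:ℝ) ≤ 1 + 9 * ((b:ℝ) - a) / (a * 10 ^ e) := by
    have := (abs_le.mp hy).1; linarith
  refine ⟨?_, ?_, hMl⟩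
  · have h1 : Real.log M = Real.log a + e * Real.log 10 + Real.log (1 + 9 * ((b:ℝ) - a) / (a * 10 ^ e)) := by
      conv_lhs => rw [e1]
      rw [Real.log_mul (by positivity) (by linarith), Real.log_mul (by positivity) (by positivity), Real.log_pow]
    rw [Real.log_div (by positivity) hM0.ne', Real.log_div (by positivity) (by positivity), h1]
    push_cast
    ring
  · have hl := log_lip (1 + 9 * ((b:ℝ) - a) / (a * 10 ^ e)) 1 (9/10) (by norm_num) h1y (by norm_num)
    rw [Real.log_one, sub_zero, add_sub_cancel_left] at hl
    refine hl.trans ?_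
    calc _ ≤ 80 / 10 ^ e / (9 / 10 : ℝ) := by gcongr
      _ = (800 / 9) / 10 ^ e := by ring
      _ ≤ _ := by gcongr; norm_num

theorem n_bounds {k : ℕ} {α : ℝ} (hα : IsAlpha k α) (n d2 e M a b : ℕ) (he : 65 ≤ e) (ha : 1 ≤ a) (ha9 : a ≤ 9)
    (hb9 : b ≤ 9) (hM : M + 9 * a = a * 10 ^ e + 9 * b) (hMl : (10:ℝ) ^ e / 2 ≤ M)
    (h : |9 * (Cc k α * α ^ n) - M * 10 ^ d2| ≤ 27) : n ≤ 5 * (d2 + e + 1) ∧ d2 + e ≤ n := by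
  have hC := Cc_ge hα
  have hC2 := Cc_le hα
  have hα1 := hα.ge
  have hα2 := hα.h2
  have ha' : (1:ℝ) ≤ a := by exact_mod_cast ha
  have ha9' : (a:ℝ) ≤ 9 := by exact_mod_cast ha9
  have hb9' : (b:ℝ) ≤ 9 := by exact_mod_cast hb9
  have hM' : (M:ℝ) + 9 * a = a * 10 ^ e + 9 * b := by exact_mod_cast hM
  have hbig : (10:ℝ) ^ 3 ≤ 10 ^ e := pow_le_pow_right₀ (by norm_num) (by omega)
  have hd : (1:ℝ) ≤ 10 ^ d2 := one_le_pow₀ (by norm_num)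
  have hMu : (M:ℝ) ≤ 10 * 10 ^ e := by nlinarith only [hM', ha', ha9', hb9', hbig]
  obtain ⟨h1, h2⟩ := abs_le.mp h
  have hs : (10:ℝ) ^ (d2 + e) = 10 ^ d2 * 10 ^ e := pow_add _ _ _
  have hbig2 : (10:ℝ) ^ 65 ≤ 10 ^ (d2 + e) := pow_le_pow_right₀ (by norm_num) (by omega)
  have hMd : (M:ℝ) * 10 ^ d2 ≤ 10 * 10 ^ (d2 + e) := by rw [hs]; nlinarith only [hMu, hd]
  have hMd2 : (10:ℝ) ^ (d2 + e) / 2 ≤ M * 10 ^ d2 := by rw [hs]; nlinarith only [hMl, hd]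
  constructor
  · by_contra hc
    push Not at hc
    have h3 : (8/5:ℝ) ^ n ≤ α ^ n := pow_le_pow_left₀ (by norm_num) hα1 n
    have h4 : (8/5:ℝ) ^ (5 * (d2 + e + 1)) ≤ (8/5) ^ n := pow_le_pow_right₀ (by norm_num) hc.le
    have h5 : (10:ℝ) ^ (d2 + e + 1) ≤ (8/5:ℝ) ^ (5 * (d2 + e + 1)) := by
      rw [pow_mul]; gcongr; norm_num
    rw [pow_succ] at h5
    have h6 : (0:ℝ) < α ^ n := by positivity
    have h7 : (9/4) * α ^ n ≤ 9 * (Cc k α * α ^ n) := by nlinarith only [h6, hC]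
    have : (10:ℝ) ^ 65 > 27 := by norm_num
    linarith only [h1, h2, h3, h4, h5, h7, hMd, hbig2, this]
  · by_contra hc
    push Not at hc
    have h3 : α ^ n ≤ 2 ^ n := pow_le_pow_left₀ (by linarith) hα2.le n
    have h4 : (2:ℝ) ^ n ≤ 2 ^ (d2 + e) := pow_le_pow_right₀ (by norm_num) hc.le
    have h5 : (10:ℝ) ^ (d2 + e) = 5 ^ (d2 + e) * 2 ^ (d2 + e) := by rw [← mul_pow]; norm_num
    have h6 : (5:ℝ) ^ 65 ≤ 5 ^ (d2 + e) := pow_le_pow_right₀ (by norm_num) (by omega)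
    have h7 : (0:ℝ) < α ^ n := by positivity
    have h8 : 9 * (Cc k α * α ^ n) ≤ 14 * α ^ n := by nlinarith only [h7, hC2]
    have h9 : (1:ℝ) ≤ 2 ^ (d2 + e) := one_le_pow₀ (by norm_num)
    have h10 : (100:ℝ) * 2 ^ (d2 + e) ≤ 10 ^ (d2 + e) := by
      rw [h5]
      have : (100:ℝ) ≤ 5 ^ 65 := by norm_num
      gcongr; linarith
    linarith only [h1, h2, h3, h4, h8, h9, h10, hMd2]

theorem boot {n : ℕ} (h : ∀ Z, 2048 ≤ Z → n ≤ 2 ^ Z → n ≤ 2 ^ 853 * Z ^ 68) : n ≤ 2 ^ 2048 := by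
  by_contra hc
  push Not at hc
  have hZ : 2048 < Nat.clog 2 n := (Nat.lt_clog_iff_pow_lt (by norm_num)).mpr hc
  have h1 : n ≤ 2 ^ Nat.clog 2 n := Nat.le_pow_clog (by norm_num) n
  have h2 : 2 ^ (Nat.clog 2 n - 1) < n := (Nat.lt_clog_iff_pow_lt (by norm_num)).mp (by omega)
  clear hc
  have h3 := h _ hZ.le h1
  obtain ⟨W, hW⟩ : ∃ W, Nat.clog 2 n = W + 1 := ⟨Nat.clog 2 n - 1, by omega⟩
  rw [hW] at h1 h2 h3 hZ
  rw [Nat.add_sub_cancel] at h2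
  have h5 := growth (W + 1) (by omega)
  have h6 : 2 ^ 1300 * (W + 1) ^ 68 ≤ 2 * 2 ^ 853 * (W + 1) ^ 68 :=
    calc _ ≤ 2 ^ (W + 1) := h5
      _ = 2 * 2 ^ W := pow_succ' _ _
      _ ≤ 2 * (2 ^ 853 * (W + 1) ^ 68) := Nat.mul_le_mul_left _ (h2.le.trans h3)
      _ = _ := (mul_assoc _ _ _).symm
  have h7 : 0 < (W + 1) ^ 68 := Nat.pow_pos (Nat.succ_pos W)
  exact absurd (Nat.le_of_mul_le_mul_right h6 h7) (by norm_num)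

theorem M_bound (e M a b : ℕ) (he : 65 ≤ e) (ha9 : a ≤ 9)
    (hb9 : b ≤ 9) (hM : M + 9 * a = a * 10 ^ e + 9 * b) : M * 1882 ≤ 2 ^ (4 * e + 16) := by
  have h1 : 10 ^ e ≤ 16 ^ e := Nat.pow_le_pow_left (by norm_num) e
  have h2 : 2 ^ (4 * e + 16) = 65536 * 16 ^ e := by rw [pow_add, pow_mul]; norm_num [mul_comm]
  have h3 : a * 10 ^ e ≤ 9 * 10 ^ e := Nat.mul_le_mul_right _ ha9
  have h4 : 10 ^ 3 ≤ 10 ^ e := Nat.pow_le_pow_right (by norm_num) (by omega)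
  rw [h2]
  norm_num at h4
  omega


set_option exponentiation.threshold 5000

theorem core {k : ℕ} {α : ℝ} (hα : IsAlpha k α) (hk : k ≤ 470) (n d2 e M a b : ℕ) (he : 65 ≤ e) (ha : 1 ≤ a)
    (ha9 : a ≤ 9) (hb9 : b ≤ 9) (hM : M + 9 * a = a * 10 ^ e + 9 * b)
    (h : |9 * (Cc k α * α ^ n) - M * 10 ^ d2| ≤ 27) : False := by
  obtain ⟨e1, hy, hMl⟩ := lam1 hα n d2 e M a b he ha ha9 hb9 hM
  have hL2 := lam2 hα n d2 e M he hMl h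
  obtain ⟨hnd, hdn⟩ := n_bounds hα n d2 e M a b he ha ha9 hb9 hM hMl h
  have hM1 : 1 ≤ M := by
    have : (0:ℝ) < M := lt_of_lt_of_le (by positivity) hMl
    exact_mod_cast this
  have hMu := M_bound e M a b he ha9 hb9 hM
  have hL2' : |n * Real.log α - d2 * Real.log 10 + Real.log (9 * Cc k α / M)| ≤ 216 / 10 ^ (d2 + e) :=
    hL2.trans (by gcongr; norm_num)
  have hlt : ∀ E F : ℕ, F ≤ E → (216:ℝ) / 10 ^ E ≤ 216 / 10 ^ F := by
    intro E F hEF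
    gcongr
    norm_num
  have hL1 : |n * Real.log α - (d2 + e : ℕ) * Real.log 10 + Real.log (9 * Cc k α / a)| ≤ 216 / 10 ^ e := by
    rw [e1] at hL2
    have h1 := abs_sub_abs_le_abs_sub
      (n * Real.log α - (d2 + e : ℕ) * Real.log 10 + Real.log (9 * Cc k α / a))
      (Real.log (1 + 9 * ((b:ℝ) - a) / (a * 10 ^ e)))
    have h2 : (108:ℝ) / 10 ^ (d2 + e) ≤ 108 / 10 ^ e := by
      gcongr
      · norm_num
      · omega
    have h3 : (216:ℝ) / 10 ^ e = 108 / 10 ^ e + 100 / 10 ^ e + 8 / 10 ^ e := by ring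
    have h4 : (0:ℝ) ≤ 8 / 10 ^ e := by positivity
    linarith only [h1, h2, h3, h4, hL2, hy]
  by_cases hab : b = a
  · -- repdigit case
    have hL : |n * Real.log α - (d2 + e : ℕ) * Real.log 10 + Real.log (9 * Cc k α / a)| ≤ 216 / 10 ^ (d2 + e) := by
      rw [e1, hab] at hL2'
      simpa using hL2'
    have hZ : ∀ Z, 2048 ≤ Z → n ≤ 2 ^ Z → d2 + e ≤ 2 ^ 213 * Z ^ 17 := fun Z hZ hn =>
      bk1 hα hk ha ha9 hZ (by omega) hn (by omega) (by omega) hL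
    have hn := boot (n := n) (fun Z hZ1 hn => by
      have h1 := hZ Z hZ1 hn
      have h2 : 2 ^ 213 * Z ^ 17 ≤ 2 ^ 213 * Z ^ 68 :=
        Nat.mul_le_mul_left _ (Nat.pow_le_pow_right (by omega) (by norm_num))
      have h3 : 2 ^ 853 * Z ^ 68 = 2 ^ 640 * (2 ^ 213 * Z ^ 68) := by rw [← mul_assoc, ← pow_add]
      have h4 : 10 * (2 ^ 213 * Z ^ 68) ≤ 2 ^ 640 * (2 ^ 213 * Z ^ 68) :=
        Nat.mul_le_mul_right _ (by norm_num)
      rw [h3]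
      omega)
    have h1 := hZ 2048 le_rfl hn
    clear hn
    have h2 : 2 ^ 213 * 2048 ^ 17 = 2 ^ 400 := by norm_num
    have h3 : 10 * 2 ^ 400 ≤ 2 ^ 1601 := by norm_num
    rw [h2] at h1
    have hd : d2 + e < 512 := by
      by_contra hc
      push Not at hc
      refine stC hα hk a ha ha9 n (d2 + e) (by omega) ?_ ?_ (hL.trans (hlt _ _ hc))
      · generalize 2 ^ 400 = u at *
        omega
      · generalize 2 ^ 400 = u at *
        omega
    refine stA hα hk a ha ha9 n (d2 + e) (by omega) ?_ ?_ (hL.trans (hlt _ _ (by omega)))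
    · norm_num; omega
    · norm_num; omega
  · have hZ : ∀ Z, 2048 ≤ Z → n ≤ 2 ^ Z → d2 + e ≤ 2 ^ 849 * Z ^ 68 := by
      intro Z hZ hn
      have h1 := bk1 hα hk ha ha9 hZ (by omega) hn (by omega) (by omega) hL1
      have h2 : 4 * e + 16 ≤ 2 ^ 216 * Z ^ 17 := by
        have : 2 ^ 216 * Z ^ 17 = 8 * (2 ^ 213 * Z ^ 17) := by ring
        rw [this]
        omega
      have h3 : 2 ^ 141 * (4 * e + 16) ^ 2 * Z ^ 12 ≤ 2 ^ Z := by
        calc _ ≤ 2 ^ 141 * (2 ^ 216 * Z ^ 17) ^ 2 * Z ^ 12 := by gcongr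
          _ = 2 ^ 573 * Z ^ 46 := by ring
          _ ≤ 2 ^ 1300 * Z ^ 68 :=
            Nat.mul_le_mul (by norm_num) (Nat.pow_le_pow_right (by omega) (by norm_num))
          _ ≤ 2 ^ Z := growth Z hZ
      have h4 := bk hα hk hM1 hZ (by omega) hn (by omega) (by omega) hMu h3
        (ind_a hα hk a b e ha ha9 hb9 he M hM hab hM1) hL2'
      calc d2 + e ≤ 2 ^ 201 * (4 * e + 16) ^ 3 * Z ^ 17 := h4
        _ ≤ 2 ^ 201 * (2 ^ 216 * Z ^ 17) ^ 3 * Z ^ 17 := by gcongr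
        _ = 2 ^ 849 * Z ^ 68 := by ring
    have hn := boot (n := n) (fun Z hZ1 hn => by
      have h1 := hZ Z hZ1 hn
      have h3 : 2 ^ 853 * Z ^ 68 = 16 * (2 ^ 849 * Z ^ 68) := by ring
      rw [h3]
      omega)
    have h1 := hZ 2048 le_rfl hn
    have h2 : 2 ^ 849 * 2048 ^ 68 = 2 ^ 1597 := by norm_num
    have h3 : 10 * 2 ^ 1597 ≤ 2 ^ 1601 := by norm_num
    rw [h2] at h1
    have he2 : e < 512 := by
      by_contra hc
      push Not at hc
      refine stC hα hk a ha ha9 n (d2 + e) (by omega) ?_ ?_ (hL1.trans (hlt _ _ hc))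
      · generalize 2 ^ 1597 = u at *
        omega
      · generalize 2 ^ 1597 = u at *
        omega
    have h4 := bk (Hh := 2064) (Z := 2048) hα hk hM1 le_rfl (by omega) hn (by omega) (by norm_num)
      (hMu.trans (Nat.pow_le_pow_right (by norm_num) (by omega))) (by norm_num)
        (ind_a hα hk a b e ha ha9 hb9 he M hM hab hM1) hL2'
    have h6 : d2 + e ≤ 2 ^ 422 := h4.trans (by norm_num)
    clear h1 h2 h3 h4 hn hZ
    have h7 : 7 * 2 ^ 422 ≤ 2 ^ 425 := by norm_num
    have hn : n ≤ 2 ^ 425 := by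
      generalize 2 ^ 422 = u at *
      omega
    have he3 : e < eB k a := by
      by_contra hc
      push Not at hc
      refine stD hα hk a ha ha9 n (d2 + e) (by omega) hn ?_ (hL1.trans (hlt _ _ hc))
      generalize 2 ^ 422 = u at *
      omega
    have hd : d2 + e < 160 := by
      by_contra hc
      push Not at hc
      rw [e1] at hL2
      refine stB hα hk a b e ha ha9 hb9 n (d2 + e) hn hab he he3 (hL2.trans ?_)
      gcongr
      norm_num
    clear h6 h7 hn
    refine stA hα hk a ha ha9 n (d2 + e) (by omega) ?_ ?_ (hL1.trans (hlt _ _ he))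
    · norm_num; omega
    · norm_num; omega

theorem d1_sub_d2_lt_65 (k n : ℕ) (hk : 2 ≤ k) (hk470 : k ≤ 470)
    (hnk : k + 1 ≤ n) (hn : 5 < n)
    (d1 d2 : ℕ) (a b : ℤ) (hd : d2 < d1) (hd1 : 3 ≤ d1)
    (ha1 : 1 ≤ a) (ha9 : a ≤ 9) (hb0 : 0 ≤ b) (hb9 : b ≤ 9)
    (heq : lucasL k n = a * ((10 ^ d1 - 1) / 9) + (b - a) * 10 ^ d2) :
    d1 - d2 < 65 := by
  by_contra hc
  push Not at hc
  obtain ⟨e, rfl⟩ := Nat.exists_eq_add_of_le hd.le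
  rw [Nat.add_sub_cancel_left] at hc
  lift a to ℕ using (by omega)
  lift b to ℕ using hb0
  obtain ⟨α, hα⟩ := exists_isAlpha k hk
  have ha : a ≤ 9 := by omega
  have h10 : 10 ^ 3 ≤ 10 ^ e := Nat.pow_le_pow_right (by norm_num) (by omega)
  have h11 : 1 * 10 ^ e ≤ a * 10 ^ e := Nat.mul_le_mul_right _ (by omega)
  obtain ⟨M, hM⟩ : ∃ M, M + 9 * a = a * 10 ^ e + 9 * b := ⟨a * 10 ^ e + 9 * b - 9 * a, by
    apply Nat.sub_add_cancel
    norm_num at h10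
    omega⟩
  refine core hα hk470 n d2 e M a b hc (by omega) ha (by omega) hM ?_
  have hdiv : (9:ℤ) ∣ 10 ^ (d2 + e) - 1 := by
    have := sub_dvd_pow_sub_pow (10:ℤ) 1 (d2 + e)
    simpa using this
  obtain ⟨u, hu⟩ := hdiv
  rw [hu, Int.mul_ediv_cancel_left _ (by norm_num)] at heq
  have hu' : (10:ℝ) ^ (d2 + e) - 1 = 9 * u := by exact_mod_cast hu
  have heq' : (lucasL k n : ℝ) = a * u + (b - a) * 10 ^ d2 := by
    rw [heq]; push_cast; ring
  have hM' : (M:ℝ) = a * 10 ^ e + 9 * b - 9 * a := by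
    have : (M:ℝ) + 9 * a = a * 10 ^ e + 9 * b := by exact_mod_cast hM
    linarith
  have hl := abs_le.mp (lucas_approx hα n)
  have e2 : (M:ℝ) * 10 ^ d2 = 9 * lucasL k n + a := by
    rw [hM', heq']
    rw [pow_add] at hu'
    linear_combination (a:ℝ) * hu'
  have ha' : (a:ℝ) ≤ 9 := by exact_mod_cast ha
  have ha0 : (0:ℝ) ≤ a := Nat.cast_nonneg a
  rw [e2, abs_le]
  constructor <;> linarith [hl.1, hl.2]
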